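/- Main theorem: Let Ω ⊂ ℝ³ be a bounded domain with C² boundary and μ₀ > 0. Let u ∈ C^{1,α}(Ω̄)³ with div u ∈ H_{μ₀}(Ω) and curl u ∈ H_{μ₀}(Ω)³. If either ν·u = 0 on ∂Ω or ν × u = 0 on ∂Ω, then ‖u‖_{L(3/2,1)(Ω)} ≤ C (‖div u‖_{H_{μ₀}(Ω)} + ‖curl u‖_{H_{μ₀}(Ω)} + ‖u‖_{L¹(Ω)}), where C depends only on μ₀ and Ω. -/

import Mathlib

open MeasureTheory Set
open scoped ENNReal

noncomputable section

/-- ℝ³ as the pi type `Fin 3 → ℝ`. -/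
abbrev E3 := Fin 3 → ℝ

/-- Euclidean dot product on ℝ³. -/
def dot3 (a b : E3) : ℝ := ∑ i, a i * b i

/-- Cross product on ℝ³. -/
def cross3 (a b : E3) : E3 :=
  ![a 1 * b 2 - a 2 * b 1, a 2 * b 0 - a 0 * b 2, a 0 * b 1 - a 1 * b 0]

/-- Euclidean distance on ℝ³. -/
def edist3 (x y : E3) : ℝ := Real.sqrt (∑ i, (x i - y i) ^ 2)

/-- Partial derivative of a scalar function in direction `i`. -/
def pd (f : E3 → ℝ) (i : Fin 3) (x : E3) : ℝ := fderiv ℝ f x (Pi.single i 1)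

/-- Gradient of a scalar field. -/
def grad3 (f : E3 → ℝ) (x : E3) : E3 := fun i => pd f i x

/-- Divergence of a vector field. -/
def div3 (u : E3 → E3) (x : E3) : ℝ := ∑ i, pd (fun y => u y i) i x

/-- Curl of a vector field. -/
def curl3 (u : E3 → E3) (x : E3) : E3 :=
  ![pd (fun y => u y 2) 1 x - pd (fun y => u y 1) 2 x,
    pd (fun y => u y 0) 2 x - pd (fun y => u y 2) 0 x,
    pd (fun y => u y 1) 0 x - pd (fun y => u y 0) 1 x]

/-- Pointwise norm of the full Jacobian of a vector field. -/
def jacNorm (u : E3 → E3) (x : E3) : ℝ := ∑ i, ‖grad3 (fun y => u y i) x‖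

/-- A (closed, axis-parallel) cube in ℝ³. -/
def IsCube (Q : Set E3) : Prop :=
  ∃ (c : E3) (r : ℝ), 0 < r ∧ Q = {x | ∀ i, |x i - c i| ≤ r}

/-- The nonincreasing rearrangement of `f` with respect to the measure `μ`. -/
def rearr (μ : Measure E3) (f : E3 → ℝ) (t : ℝ) : ℝ :=
  sInf {s : ℝ | 0 < s ∧ μ {x | s < |f x|} ≤ ENNReal.ofReal t}

/-- The Lorentz quasi-norm `‖f‖_{L(m,q)(μ)}`, with value in `ℝ≥0∞`. -/
def lorentzNorm (μ : Measure E3) (f : E3 → ℝ) (m : ℝ) (q : ℝ≥0∞) : ℝ≥0∞ :=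
  if q = ∞ then ⨆ t ∈ Ioi (0 : ℝ), ENNReal.ofReal (t ^ (1 / m) * rearr μ f t)
  else (∫⁻ t in Ioi (0 : ℝ),
      ENNReal.ofReal ((t ^ (1 / m) * rearr μ f t) ^ q.toReal / t)) ^ (1 / q.toReal)

/-- The Lorentz quasi-norm of a vector field, applied to its pointwise norm. -/
def lorentzNormV (μ : Measure E3) (u : E3 → E3) (m : ℝ) (q : ℝ≥0∞) : ℝ≥0∞ :=
  lorentzNorm μ (fun x => ‖u x‖) m q

/-- An `H_{μ₀}` atom with respect to the cube `Q`. -/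
structure IsHAtom (μ₀ : ℝ) (Q : Set E3) (a : E3 → ℝ) : Prop where
  meas : Measurable a
  cube : IsCube Q
  supp : ∀ x, x ∉ Q → a x = 0
  bdd : ∀ᵐ x ∂(volume : Measure E3), |a x| ≤ ((volume Q).toReal)⁻¹
  cancel : ∃ μ : ℝ, μ₀ ≤ μ ∧
    ((volume Q).toReal < 1 → |∫ x in Q, a x| ≤ (volume Q).toReal ^ μ)

/-- An atomic decomposition of `f` on `Ω` in the Hardy space `H_{μ₀}(Ω)`. -/
def IsHardyDecomp (Ω : Set E3) (μ₀ : ℝ) (f : E3 → ℝ)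
    (lam : ℕ → ℝ) (a : ℕ → E3 → ℝ) (Q : ℕ → Set E3) : Prop :=
  (∀ k, IsHAtom μ₀ (Q k) (a k) ∧ Q k ⊆ Ω) ∧ Summable (fun k => |lam k|) ∧
    ∀ x ∈ Ω, f x = ∑' k, lam k * a k x

/-- Membership in the atomic Hardy space `H_{μ₀}(Ω)`. -/
def MemHardy (Ω : Set E3) (μ₀ : ℝ) (f : E3 → ℝ) : Prop :=
  ∃ lam a Q, IsHardyDecomp Ω μ₀ f lam a Q

/-- The atomic Hardy norm `‖f‖_{H_{μ₀}(Ω)}`. -/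
def hardyNorm (Ω : Set E3) (μ₀ : ℝ) (f : E3 → ℝ) : ℝ :=
  sInf {S : ℝ | ∃ lam a Q, IsHardyDecomp Ω μ₀ f lam a Q ∧ S = ∑' k, |lam k|}

/-- Componentwise membership of a vector field in `H_{μ₀}(Ω)`. -/
def MemHardyV (Ω : Set E3) (μ₀ : ℝ) (u : E3 → E3) : Prop :=
  ∀ i, MemHardy Ω μ₀ (fun x => u x i)

/-- Hardy norm of a vector field: sum of the Hardy norms of its components. -/
def hardyNormV (Ω : Set E3) (μ₀ : ℝ) (u : E3 → E3) : ℝ :=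
  ∑ i : Fin 3, hardyNorm Ω μ₀ (fun x => u x i)

/-- Mean value of `g` over `Q` (w.r.t. Lebesgue measure). -/
def avgQ (Q : Set E3) (g : E3 → ℝ) : ℝ := ((volume Q).toReal)⁻¹ * ∫ x in Q, g x

/-- The set of mean oscillations of `g` over cubes contained in `Ω`. -/
def bmoSet (Ω : Set E3) (g : E3 → ℝ) : Set ℝ :=
  {A | ∃ Q, IsCube Q ∧ Q ⊆ Ω ∧
    A = ((volume Q).toReal)⁻¹ * ∫ x in Q, |g x - avgQ Q g|}

/-- The BMO seminorm of `g` on `Ω`. -/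
def bmoNorm (Ω : Set E3) (g : E3 → ℝ) : ℝ := sSup (bmoSet Ω g)

/-- Membership in `BMO(Ω)`. -/
def MemBMO (Ω : Set E3) (g : E3 → ℝ) : Prop :=
  LocallyIntegrableOn g Ω ∧ BddAbove (bmoSet Ω g)

/-- A bounded domain in ℝ³. -/
def BoundedDomain (Ω : Set E3) : Prop :=
  IsOpen Ω ∧ IsConnected Ω ∧ Bornology.IsBounded Ω

/-- `Ω` has `C²` boundary: near each boundary point, `Ω` is the sublevel set of a
`C²` function with nonvanishing differential. -/
def C2Boundary (Ω : Set E3) : Prop :=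
  ∀ x ∈ frontier Ω, ∃ (U : Set E3) (f : E3 → ℝ), IsOpen U ∧ x ∈ U ∧
    ContDiff ℝ 2 f ∧ (∀ y ∈ U, fderiv ℝ f y ≠ 0) ∧ Ω ∩ U = {y | f y < 0} ∩ U

/-- `ν` is an outward unit normal field for `Ω`: it has unit length on the boundary
and every differentiable curve staying in `closure Ω` has inward-pointing velocity. -/
def IsOutwardNormal (Ω : Set E3) (ν : E3 → E3) : Prop :=
  ∀ x ∈ frontier Ω, ‖ν x‖ = 1 ∧
    ∀ γ : ℝ → E3, γ 0 = x → DifferentiableAt ℝ γ 0 →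
      (∀ t : ℝ, 0 ≤ t → γ t ∈ closure Ω) → dot3 (deriv γ 0) (ν x) ≤ 0

/-- `u ∈ C^{1,α}(closure Ω)`: continuously differentiable with `α`-Hölder derivative. -/
def HolderC1 (α : ℝ) (Ω : Set E3) (u : E3 → E3) : Prop :=
  ContDiffOn ℝ 1 u (closure Ω) ∧ ∃ C : ℝ, ∀ x ∈ closure Ω, ∀ y ∈ closure Ω,
    ‖fderivWithin ℝ u (closure Ω) x - fderivWithin ℝ u (closure Ω) y‖ ≤ C * ‖x - y‖ ^ α

/-- The Neumann harmonic fields `H₁(Ω)`. -/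
def MemH1 (Ω : Set E3) (ν : E3 → E3) (h : E3 → E3) : Prop :=
  ContDiffOn ℝ 2 h Ω ∧ (∀ x ∈ Ω, div3 h x = 0 ∧ curl3 h x = 0) ∧
    ∀ x ∈ frontier Ω, dot3 (ν x) (h x) = 0

/-- The Dirichlet harmonic fields `H₂(Ω)`. -/
def MemH2 (Ω : Set E3) (ν : E3 → E3) (h : E3 → E3) : Prop :=
  ContDiffOn ℝ 2 h Ω ∧ (∀ x ∈ Ω, div3 h x = 0 ∧ curl3 h x = 0) ∧
    ∀ x ∈ frontier Ω, cross3 (ν x) (h x) = 0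

/-- The radial profile `r ^ θ * (r + ρ) ^ (-(2 + θ))` dominating the potential of an atom. -/
def atomProfile (θ r ρ : ℝ) : ℝ := r ^ θ * (r + ρ) ^ (-(2 + θ))

lemma lintegral_ball_norm_rpow_le {s : ℝ} (hs : s < 3) :
    ∃ C : ℝ, 0 < C ∧ ∀ (c : E3) (ρ : ℝ), 0 < ρ →
      ∫⁻ y in Metric.ball c ρ, ENNReal.ofReal (‖y - c‖ ^ (-s)) ≤
        ENNReal.ofReal (C * ρ ^ (3 - s)) := by
  refine ⟨24 / (3 - s), by have : 0 < 3 - s := by linarith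
                           positivity, fun c ρ hρ => ?_⟩
  have h1 : ∫⁻ y in Metric.ball c ρ, ENNReal.ofReal (‖y - c‖ ^ (-s)) =
      ∫⁻ y in Metric.ball (0 : E3) ρ, ENNReal.ofReal (‖y‖ ^ (-s)) := by
    rw [← lintegral_indicator Metric.isOpen_ball.measurableSet,
      ← lintegral_indicator Metric.isOpen_ball.measurableSet,
      ← lintegral_sub_right_eq_self (μ := (volume : Measure E3))
        ((Metric.ball (0 : E3) ρ).indicator _) c]
    congr 1
    ext y
    simp [indicator, dist_eq_norm]
  rw [h1]
  have hint : IntegrableOn (fun y : ℝ => y ^ (2 - s)) (Ioo 0 ρ) := by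
    have := (intervalIntegral.intervalIntegrable_rpow' (a := 0) (b := ρ) (r := 2 - s)
      (by linarith))
    rw [intervalIntegrable_iff_integrableOn_Ioo_of_le hρ.le] at this
    exact this
  have hint' : IntegrableOn (fun y : ℝ => y ^ 2 • y ^ (-s)) (Ioo 0 ρ) := by
    refine hint.congr_fun (fun y hy => ?_) measurableSet_Ioo
    simp only [smul_eq_mul]
    rw [sub_eq_add_neg, Real.rpow_add hy.1]
    norm_num
  have hi : IntegrableOn (fun y : E3 => ‖y‖ ^ (-s)) (Metric.ball 0 ρ) := by
    rw [integrableOn_fun_norm_addHaar (volume : Measure E3) (f := fun t => t ^ (-s))]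
    simpa using hint'
  rw [← ofReal_integral_eq_lintegral_ofReal hi (Filter.Eventually.of_forall fun y => by positivity)]
  apply ENNReal.ofReal_le_ofReal
  rw [← integral_indicator Metric.isOpen_ball.measurableSet]
  have h2 : (Metric.ball (0 : E3) ρ).indicator (fun y => ‖y‖ ^ (-s)) =
      fun y : E3 => (Iio ρ).indicator (fun t : ℝ => t ^ (-s)) ‖y‖ := by
    ext y; simp [indicator]
  rw [h2, integral_fun_norm_addHaar]
  have h3 : ∫ y in Ioi (0 : ℝ), y ^ (Module.finrank ℝ E3 - 1) •
      (Iio ρ).indicator (fun t : ℝ => t ^ (-s)) y = ∫ y in (0 : ℝ)..ρ, y ^ (2 - s) := by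
    rw [intervalIntegral.integral_of_le hρ.le, integral_Ioc_eq_integral_Ioo,
      ← integral_indicator measurableSet_Ioi, ← integral_indicator measurableSet_Ioo]
    congr 1
    ext y
    by_cases hy : 0 < y <;> by_cases hy' : y < ρ <;> simp [indicator, hy, hy']
    rw [sub_eq_add_neg, Real.rpow_add hy]
    norm_num
  rw [h3, integral_rpow (Or.inl (by linarith))]
  have hv : volume.real (Metric.ball (0 : E3) 1) = 8 := by
    rw [Measure.real, Real.volume_pi_ball _ one_pos]
    norm_num
  rw [hv, Real.zero_rpow (by linarith)]
  have : (2 - s + 1) = 3 - s := by ring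
  rw [this]
  simp only [Module.finrank_fintype_fun_eq_card, Fintype.card_fin, nsmul_eq_mul, smul_eq_mul]
  apply le_of_eq
  push_cast
  ring

lemma atomProfile_nonneg {θ r ρ : ℝ} (hr : 0 < r) (hρ : 0 ≤ ρ) : 0 ≤ atomProfile θ r ρ := by
  unfold atomProfile; positivity

lemma atomProfile_anti {θ r ρ ρ' : ℝ} (hθ : 0 < θ) (hr : 0 < r) (hρ : 0 ≤ ρ) (h : ρ ≤ ρ') :
    atomProfile θ r ρ' ≤ atomProfile θ r ρ := by
  unfold atomProfile
  gcongr ?_ * ?_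
  exact Real.rpow_le_rpow_of_nonpos (by linarith) (by linarith) (by linarith)

lemma rpow_neg_two_add_half_le {θ a b : ℝ} (hθ : 0 < θ) (hθ1 : θ < 1) (ha : 0 < a)
    (hab : a / 2 ≤ b) : b ^ (-(2 + θ)) ≤ 8 * a ^ (-(2 + θ)) := by
  calc b ^ (-(2 + θ)) ≤ (a / 2) ^ (-(2 + θ)) :=
        Real.rpow_le_rpow_of_nonpos (by linarith) hab (by linarith)
    _ = 2 ^ (2 + θ) * a ^ (-(2 + θ)) := by
        rw [Real.div_rpow ha.le (by norm_num), Real.rpow_neg (by norm_num : (0 : ℝ) ≤ 2)]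
        field_simp
    _ ≤ 8 * a ^ (-(2 + θ)) := by
        gcongr
        calc (2 : ℝ) ^ (2 + θ) ≤ 2 ^ (3 : ℝ) :=
              Real.rpow_le_rpow_of_exponent_le (by norm_num) (by linarith)
          _ = 8 := by norm_num

lemma atomProfile_half_le {θ r ρ ρ' : ℝ} (hθ : 0 < θ) (hθ1 : θ < 1) (hr : 0 < r) (hρ : 0 ≤ ρ)
    (h : ρ / 2 ≤ ρ') : atomProfile θ r ρ' ≤ 8 * atomProfile θ r ρ := by
  unfold atomProfile
  have := rpow_neg_two_add_half_le hθ hθ1 (a := r + ρ) (b := r + ρ') (by linarith) (by linarith)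
  calc _ ≤ r ^ θ * (8 * (r + ρ) ^ (-(2 + θ))) := by gcongr
    _ = _ := by ring

lemma measurable_atomProfile {θ r : ℝ} : Measurable (atomProfile θ r) := by
  unfold atomProfile; fun_prop

lemma lintegral_ball_atomProfile_le {θ : ℝ} (hθ : 0 < θ) (hθ1 : θ < 1) :
    ∃ C : ℝ, 0 < C ∧ ∀ (r : ℝ) (c : E3) (ρ : ℝ), 0 < r → 0 < ρ →
      ∫⁻ y in Metric.ball c ρ, ENNReal.ofReal (atomProfile θ r ‖y - c‖) ≤
        ENNReal.ofReal (C * ρ ^ 3 * atomProfile θ r ρ) := by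
  obtain ⟨C, hC, hI⟩ := lintegral_ball_norm_rpow_le (s := 2 + θ) (by linarith)
  refine ⟨64 + 8 * C, by positivity, fun r c ρ hr hρ => ?_⟩
  have hP := atomProfile_nonneg (θ := θ) hr hρ.le
  rcases le_total ρ r with h | h
  · have h1 : atomProfile θ r 0 ≤ 8 * atomProfile θ r ρ := by
      unfold atomProfile
      have := rpow_neg_two_add_half_le hθ hθ1 (a := r + ρ) (b := r + 0) (by linarith) (by linarith)
      calc _ ≤ r ^ θ * (8 * (r + ρ) ^ (-(2 + θ))) := by gcongr
        _ = _ := by ring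
    calc _ ≤ ∫⁻ y in Metric.ball c ρ, ENNReal.ofReal (8 * atomProfile θ r ρ) := by
          apply lintegral_mono
          intro y
          apply ENNReal.ofReal_le_ofReal
          exact (atomProfile_anti hθ hr le_rfl (norm_nonneg _)).trans h1
      _ = ENNReal.ofReal (8 * atomProfile θ r ρ * (2 * ρ) ^ 3) := by
          rw [setLIntegral_const, Real.volume_pi_ball _ hρ, ← ENNReal.ofReal_mul (by positivity)]
          simp
      _ ≤ _ := by
          apply ENNReal.ofReal_le_ofReal
          have : 0 ≤ C * ρ ^ 3 * atomProfile θ r ρ := by positivity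
          nlinarith
  · calc _ ≤ ∫⁻ y in Metric.ball c ρ, ENNReal.ofReal (r ^ θ) *
            ENNReal.ofReal (‖y - c‖ ^ (-(2 + θ))) := by
          have : ∀ᵐ y ∂((volume : Measure E3).restrict (Metric.ball c ρ)), y ≠ c := by
            apply ae_restrict_of_ae
            exact Measure.ae_ne volume c
          apply lintegral_mono_ae
          filter_upwards [this] with y hy
          rw [← ENNReal.ofReal_mul (by positivity)]
          apply ENNReal.ofReal_le_ofReal
          unfold atomProfile
          have : 0 < ‖y - c‖ := norm_pos_iff.2 (sub_ne_zero.2 hy)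
          gcongr ?_ * ?_
          exact Real.rpow_le_rpow_of_nonpos this (by linarith) (by linarith)
      _ = ENNReal.ofReal (r ^ θ) * ∫⁻ y in Metric.ball c ρ,
            ENNReal.ofReal (‖y - c‖ ^ (-(2 + θ))) := by
          rw [lintegral_const_mul]
          fun_prop
      _ ≤ ENNReal.ofReal (r ^ θ) * ENNReal.ofReal (C * ρ ^ (3 - (2 + θ))) := by
          gcongr; exact hI c ρ hρ
      _ ≤ _ := by
          rw [← ENNReal.ofReal_mul (by positivity)]
          apply ENNReal.ofReal_le_ofReal
          have h2 := rpow_neg_two_add_half_le hθ hθ1 (a := r + ρ) (b := ρ) (by linarith)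
            (by linarith)
          have h3 : ρ ^ (3 - (2 + θ)) = ρ ^ 3 * ρ ^ (-(2 + θ)) := by
            rw [sub_eq_add_neg, Real.rpow_add hρ]
            norm_num
          calc r ^ θ * (C * ρ ^ (3 - (2 + θ)))
              ≤ r ^ θ * (C * (ρ ^ 3 * (8 * (r + ρ) ^ (-(2 + θ))))) := by
                rw [h3]; gcongr
            _ = 8 * C * ρ ^ 3 * atomProfile θ r ρ := by unfold atomProfile; ring
            _ ≤ _ := by
                have : 0 ≤ ρ ^ 3 * atomProfile θ r ρ := by positivity
                nlinarith

/-- Convolution with the truncated kernel `‖z‖⁻²` is a small perturbation on atom profiles. -/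
lemma lintegral_truncated_riesz_atomProfile_le {θ : ℝ} (hθ : 0 < θ) (hθ1 : θ < 1) :
    ∃ C : ℝ, 0 < C ∧ ∀ (r : ℝ) (c x : E3) (δ : ℝ), 0 < r → 0 < δ →
      ∫⁻ y in Metric.ball x δ, ENNReal.ofReal (‖y - x‖ ^ (-2 : ℝ)) *
          ENNReal.ofReal (atomProfile θ r ‖y - c‖) ≤
        ENNReal.ofReal (C * δ) * ENNReal.ofReal (atomProfile θ r ‖x - c‖) := by
  obtain ⟨C, hC, hI⟩ := lintegral_ball_norm_rpow_le (s := 2) (by norm_num)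
  obtain ⟨C', hC', hI'⟩ := lintegral_ball_atomProfile_le hθ hθ1
  refine ⟨8 * C + 8 * C', by positivity, fun r c x δ hr hδ => ?_⟩
  set d := ‖x - c‖ with hd
  have hd0 : 0 ≤ d := norm_nonneg _
  have hP := atomProfile_nonneg (θ := θ) hr hd0
  have hsplit := lintegral_inter_add_sdiff (μ := (volume : Measure E3))
    (fun y => ENNReal.ofReal (‖y - x‖ ^ (-2 : ℝ)) *
          ENNReal.ofReal (atomProfile θ r ‖y - c‖)) (Metric.ball x δ)
    (B := Metric.ball c (d / 2)) Metric.isOpen_ball.measurableSet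
  rw [← hsplit]
  have far : ∫⁻ y in Metric.ball x δ \ Metric.ball c (d / 2),
      ENNReal.ofReal (‖y - x‖ ^ (-2 : ℝ)) * ENNReal.ofReal (atomProfile θ r ‖y - c‖) ≤
      ENNReal.ofReal (8 * C * δ * atomProfile θ r d) := by
    calc _ ≤ ∫⁻ y in Metric.ball x δ \ Metric.ball c (d / 2),
          ENNReal.ofReal (‖y - x‖ ^ (-2 : ℝ)) * ENNReal.ofReal (8 * atomProfile θ r d) := by
          apply setLIntegral_mono' (Metric.isOpen_ball.measurableSet.diff
            Metric.isOpen_ball.measurableSet)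
          intro y hy
          gcongr
          apply atomProfile_half_le hθ hθ1 hr hd0
          have := hy.2
          rw [Metric.mem_ball, not_lt, dist_eq_norm] at this
          exact this
      _ ≤ ∫⁻ y in Metric.ball x δ,
          ENNReal.ofReal (‖y - x‖ ^ (-2 : ℝ)) * ENNReal.ofReal (8 * atomProfile θ r d) :=
          lintegral_mono_set sdiff_subset
      _ ≤ ENNReal.ofReal (C * δ ^ (3 - 2 : ℝ)) * ENNReal.ofReal (8 * atomProfile θ r d) := by
          rw [lintegral_mul_const _ (by fun_prop)]
          gcongr
          exact hI x δ hδ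
      _ = _ := by
          rw [← ENNReal.ofReal_mul (by positivity)]
          congr 1
          norm_num
          ring
  have near : ∫⁻ y in Metric.ball x δ ∩ Metric.ball c (d / 2),
      ENNReal.ofReal (‖y - x‖ ^ (-2 : ℝ)) * ENNReal.ofReal (atomProfile θ r ‖y - c‖) ≤
      ENNReal.ofReal (8 * C' * δ * atomProfile θ r d) := by
    rcases (Metric.ball x δ ∩ Metric.ball c (d / 2)).eq_empty_or_nonempty with h | ⟨y0, hy0⟩
    · rw [h]; simp
    have hdist : ∀ y ∈ Metric.ball c (d / 2), d / 2 ≤ ‖y - x‖ := by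
      intro y hy
      rw [Metric.mem_ball, dist_eq_norm] at hy
      have := norm_sub_le_norm_sub_add_norm_sub x y c
      rw [norm_sub_rev x y] at this
      linarith
    have hdδ : d / 2 ≤ δ := by
      have := hdist y0 hy0.2
      have h2 := hy0.1
      rw [Metric.mem_ball, dist_eq_norm] at h2
      linarith
    have hdpos : 0 < d / 2 := (dist_nonneg).trans_lt hy0.2
    calc _ ≤ ∫⁻ y in Metric.ball x δ ∩ Metric.ball c (d / 2),
          ENNReal.ofReal ((d / 2) ^ (-2 : ℝ)) * ENNReal.ofReal (atomProfile θ r ‖y - c‖) := by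
          apply setLIntegral_mono' (Metric.isOpen_ball.measurableSet.inter
            Metric.isOpen_ball.measurableSet)
          intro y hy
          refine mul_le_mul_left ?_ _
          apply ENNReal.ofReal_le_ofReal
          exact Real.rpow_le_rpow_of_nonpos hdpos (hdist y hy.2) (by norm_num)
      _ ≤ ∫⁻ y in Metric.ball c (d / 2),
          ENNReal.ofReal ((d / 2) ^ (-2 : ℝ)) * ENNReal.ofReal (atomProfile θ r ‖y - c‖) :=
          lintegral_mono_set inter_subset_right
      _ ≤ ENNReal.ofReal ((d / 2) ^ (-2 : ℝ)) *
          ENNReal.ofReal (C' * (d / 2) ^ 3 * atomProfile θ r (d / 2)) := by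
          rw [lintegral_const_mul]
          · gcongr
            exact hI' r c _ hr hdpos
          · exact (measurable_atomProfile.comp (by fun_prop)).ennreal_ofReal
      _ ≤ _ := by
          rw [← ENNReal.ofReal_mul (by positivity)]
          apply ENNReal.ofReal_le_ofReal
          have h0 := atomProfile_nonneg (θ := θ) hr hdpos.le
          have h1 := atomProfile_half_le hθ hθ1 hr hd0 (le_refl (d / 2))
          have h2 : (d / 2) ^ (-2 : ℝ) * (d / 2) ^ 3 = d / 2 := by
            rw [Real.rpow_neg hdpos.le]
            norm_num
            field_simp
          calc (d / 2) ^ (-2 : ℝ) * (C' * (d / 2) ^ 3 * atomProfile θ r (d / 2))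
              = C' * ((d / 2) ^ (-2 : ℝ) * (d / 2) ^ 3) * atomProfile θ r (d / 2) := by ring
            _ = C' * (d / 2) * atomProfile θ r (d / 2) := by rw [h2]
            _ ≤ C' * δ * (8 * atomProfile θ r d) := by gcongr
            _ = _ := by ring
  calc _ ≤ _ := add_le_add near far
    _ = _ := by
      rw [← ENNReal.ofReal_add (by positivity) (by positivity), ← ENNReal.ofReal_mul (by positivity)]
      congr 1; ring

lemma lintegral_rpow_mul_atomProfile_le {θ : ℝ} (hθ : 0 < θ) :
    ∃ C : ℝ, 0 < C ∧ ∀ r : ℝ, 0 < r →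
      ∫⁻ t in Ioi (0 : ℝ), ENNReal.ofReal (t ^ (-(1 / 3) : ℝ)) *
        ENNReal.ofReal (atomProfile θ r (t ^ (1 / 3 : ℝ))) ≤ ENNReal.ofReal C := by
  refine ⟨3 / 2 + 3 / θ, by positivity, fun r hr => ?_⟩
  have hr3 : 0 < r ^ 3 := by positivity
  have hu : Ioi (0 : ℝ) = Ioc 0 (r ^ 3) ∪ Ioi (r ^ 3) := (Ioc_union_Ioi_eq_Ioi hr3.le).symm
  have hsmall : ∫⁻ t in Ioc 0 (r ^ 3), ENNReal.ofReal (t ^ (-(1 / 3) : ℝ)) *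
        ENNReal.ofReal (atomProfile θ r (t ^ (1 / 3 : ℝ))) ≤ ENNReal.ofReal (3 / 2) := by
    calc _ ≤ ∫⁻ t in Ioc 0 (r ^ 3), ENNReal.ofReal (t ^ (-(1 / 3) : ℝ) * r ^ (-2 : ℝ)) := by
          apply setLIntegral_mono' measurableSet_Ioc
          intro t ht
          have : 0 < t := ht.1
          rw [← ENNReal.ofReal_mul (by positivity)]
          apply ENNReal.ofReal_le_ofReal
          gcongr
          unfold atomProfile
          calc r ^ θ * (r + t ^ (1 / 3 : ℝ)) ^ (-(2 + θ)) ≤ r ^ θ * r ^ (-(2 + θ)) := by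
                gcongr ?_ * ?_
                exact Real.rpow_le_rpow_of_nonpos hr (by simp; positivity) (by linarith)
            _ = r ^ (-2 : ℝ) := by
                rw [← Real.rpow_add hr]; congr 1; ring
      _ = ENNReal.ofReal (∫ t in (0 : ℝ)..r ^ 3, t ^ (-(1 / 3) : ℝ) * r ^ (-2 : ℝ)) := by
          rw [intervalIntegral.integral_of_le hr3.le, ofReal_integral_eq_lintegral_ofReal]
          · have := (intervalIntegral.intervalIntegrable_rpow' (a := 0) (b := r ^ 3)
              (r := -(1 / 3)) (by norm_num)).mul_const (r ^ (-2 : ℝ))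
            rwa [intervalIntegrable_iff_integrableOn_Ioc_of_le hr3.le] at this
          · filter_upwards [self_mem_ae_restrict measurableSet_Ioc] with t ht
            have : 0 < t := ht.1
            simp only [Pi.zero_apply]
            positivity
      _ = _ := by
          congr 1
          rw [intervalIntegral.integral_mul_const, integral_rpow (Or.inl (by norm_num))]
          have h0 : (-(1 / 3) + 1 : ℝ) = 2 / 3 := by norm_num
          rw [h0, Real.zero_rpow (by norm_num), ← Real.rpow_natCast, ← Real.rpow_mul hr.le,
            sub_zero, div_mul_eq_mul_div, ← Real.rpow_add hr]
          norm_num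
  have hlarge : ∫⁻ t in Ioi (r ^ 3), ENNReal.ofReal (t ^ (-(1 / 3) : ℝ)) *
        ENNReal.ofReal (atomProfile θ r (t ^ (1 / 3 : ℝ))) ≤ ENNReal.ofReal (3 / θ) := by
    have hexp : -1 - θ / 3 < -1 := by linarith
    calc _ ≤ ∫⁻ t in Ioi (r ^ 3), ENNReal.ofReal (r ^ θ * t ^ (-1 - θ / 3 : ℝ)) := by
          apply setLIntegral_mono' measurableSet_Ioi
          intro t ht
          have ht0 : 0 < t := hr3.trans ht
          rw [← ENNReal.ofReal_mul (by positivity)]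
          apply ENNReal.ofReal_le_ofReal
          unfold atomProfile
          have hp : 0 < t ^ (1 / 3 : ℝ) := by positivity
          calc t ^ (-(1 / 3) : ℝ) * (r ^ θ * (r + t ^ (1 / 3 : ℝ)) ^ (-(2 + θ)))
              ≤ t ^ (-(1 / 3) : ℝ) * (r ^ θ * (t ^ (1 / 3 : ℝ)) ^ (-(2 + θ))) := by
                gcongr ?_ * (?_ * ?_)
                exact Real.rpow_le_rpow_of_nonpos hp (by linarith) (by linarith)
            _ = r ^ θ * t ^ (-1 - θ / 3 : ℝ) := by
                rw [← Real.rpow_mul ht0.le, mul_left_comm, ← Real.rpow_add ht0]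
                congr 2; ring
      _ = ENNReal.ofReal (∫ t in Ioi (r ^ 3), r ^ θ * t ^ (-1 - θ / 3 : ℝ)) := by
          rw [ofReal_integral_eq_lintegral_ofReal]
          · exact (integrableOn_Ioi_rpow_of_lt hexp hr3).const_mul _
          · filter_upwards [self_mem_ae_restrict measurableSet_Ioi] with t ht
            have : 0 < t := hr3.trans ht
            simp only [Pi.zero_apply]
            positivity
      _ = _ := by
          congr 1
          rw [integral_const_mul, integral_Ioi_rpow_of_lt hexp hr3, ← Real.rpow_natCast,
            ← Real.rpow_mul hr.le]
          have h0 : ((3 : ℕ) : ℝ) * (-1 - θ / 3 + 1) = -θ := by push_cast; ring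
          have h1 : (-1 - θ / 3 + 1) = -(θ / 3) := by ring
          rw [h0, h1, neg_div_neg_eq, mul_div_assoc', ← Real.rpow_add hr]
          simp
  rw [hu, lintegral_union measurableSet_Ioi (by
    rw [Set.disjoint_left]; intro t ht ht'; exact not_lt.2 ht.2 ht')]
  rw [ENNReal.ofReal_add (by positivity) (by positivity)]
  exact add_le_add hsmall hlarge

lemma ofReal_rearr_le {μ : Measure E3} {f : E3 → ℝ} {t : ℝ} {V : ℝ≥0∞}
    (h : ∀ s : ℝ, 0 < s → V < ENNReal.ofReal s → μ {x | s < |f x|} ≤ ENNReal.ofReal t) :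
    ENNReal.ofReal (rearr μ f t) ≤ V := by
  induction V with
  | top => exact le_top
  | coe V =>
    rw [ENNReal.ofReal_le_iff_le_toReal ENNReal.coe_ne_top]
    refine le_of_forall_gt_imp_ge_of_dense fun s hs => ?_
    have hs0 : 0 < s := lt_of_le_of_lt (NNReal.coe_nonneg V) hs
    refine csInf_le ⟨0, fun a ha => ha.1.le⟩ ⟨hs0, h s hs0 ?_⟩
    rw [ENNReal.lt_ofReal_iff_toReal_lt ENNReal.coe_ne_top]
    exact hs

lemma measure_lt_le_of_le_add {μ : Measure E3} {f : E3 → ℝ} {g : E3 → ℝ≥0∞} {h : ℝ≥0∞} {s t : ℝ}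
    (hg : AEMeasurable g μ) (hf : ∀ᵐ x ∂μ, ENNReal.ofReal |f x| ≤ g x + h) (ht : 0 < t)
    (hs : h + (∫⁻ x, g x ∂μ) / ENNReal.ofReal t < ENNReal.ofReal s) :
    μ {x | s < |f x|} ≤ ENNReal.ofReal t := by
  set ε := ENNReal.ofReal s - h with hε
  have ht0 : ENNReal.ofReal t ≠ 0 := by simpa using ht
  have hhs : h < ENNReal.ofReal s := lt_of_le_of_lt le_self_add hs
  have hε0 : ε ≠ 0 := (tsub_pos_of_lt hhs).ne'
  have hεt : ε ≠ ∞ := ne_top_of_le_ne_top ENNReal.ofReal_ne_top tsub_le_self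
  have h1 : μ {x | s < |f x|} ≤ μ {x | ε ≤ g x} := by
    apply measure_mono_ae
    filter_upwards [hf] with x hx hsx
    change s < |f x| at hsx
    change ε ≤ g x
    rw [hε, tsub_le_iff_right]
    exact (ENNReal.ofReal_le_ofReal hsx.le).trans hx
  have h2 : (∫⁻ x, g x ∂μ) / ENNReal.ofReal t ≤ ε := by
    rw [hε]
    apply ENNReal.le_sub_of_add_le_left hhs.ne_top hs.le
  have h3 : (∫⁻ x, g x ∂μ) ≤ ε * ENNReal.ofReal t := by
    rwa [ENNReal.div_le_iff_le_mul (Or.inl ht0) (Or.inl ENNReal.ofReal_ne_top)] at h2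
  have h4 := (mul_meas_ge_le_lintegral₀ hg ε).trans h3
  exact h1.trans ((ENNReal.mul_le_mul_iff_right hε0 hεt).1 h4)

/-- A superposition of atom profiles has controlled `L(3/2,1)` norm. -/
lemma lorentzNorm_le_of_le_tsum {Ω : Set E3} (hΩ : MeasurableSet Ω) {R : ℝ} (hR : 0 < R)
    (hvol : volume Ω ≤ ENNReal.ofReal R) {θ : ℝ} (hθ : 0 < θ) (hθ1 : θ < 1) :
    ∃ C : ℝ, 0 < C ∧ ∀ {ι : Type} [Countable ι] (Λ : ι → ℝ≥0∞) (r : ι → ℝ) (c : ι → E3)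
      (N : ℝ≥0∞) (v : E3 → ℝ), (∀ j, 0 < r j) →
      (∀ x ∈ Ω, ENNReal.ofReal |v x| ≤
        ∑' j, Λ j * ENNReal.ofReal (atomProfile θ (r j) ‖x - c j‖) + N) →
      lorentzNorm (volume.restrict Ω) v (3 / 2) 1 ≤ ENNReal.ofReal C * (∑' j, Λ j + N) := by
  obtain ⟨C1, hC1, hI1⟩ := lintegral_ball_atomProfile_le hθ hθ1
  obtain ⟨C2, hC2, hI2⟩ := lintegral_rpow_mul_atomProfile_le hθ
  set J := ∫⁻ t in Ioo 0 R, ENNReal.ofReal (t ^ (-(1 / 3) : ℝ)) with hJ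
  have hJtop : J ≠ ∞ := by
    have := (intervalIntegral.intervalIntegrable_rpow' (a := 0) (b := R) (r := -(1 / 3))
      (by norm_num))
    rw [intervalIntegrable_iff_integrableOn_Ioo_of_le hR.le] at this
    exact this.lintegral_lt_top.ne
  refine ⟨(C1 + 1) * C2 + J.toReal, by positivity, ?_⟩
  intro ι _ Λ r c N v hr hv
  set μ := (volume : Measure E3).restrict Ω with hμ
  have key : ∀ t : ℝ, 0 < t → ENNReal.ofReal (rearr μ v t) ≤
      ENNReal.ofReal (C1 + 1) * (∑' j, Λ j * ENNReal.ofReal (atomProfile θ (r j) (t ^ (1 / 3 : ℝ))))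
        + (Ioo 0 R).indicator (fun _ => N) t := by
    intro t ht
    by_cases htR : t < R
    swap
    · refine (ofReal_rearr_le (V := 0) fun s _ _ => ?_).trans (zero_le)
      calc μ _ ≤ μ univ := measure_mono (subset_univ _)
        _ = volume Ω := by simp [hμ]
        _ ≤ ENNReal.ofReal R := hvol
        _ ≤ _ := ENNReal.ofReal_le_ofReal (not_lt.1 htR)
    have hind : (Ioo 0 R).indicator (fun _ => N) t = N := by simp [ht, htR]
    rw [hind]
    set ρ := t ^ (1 / 3 : ℝ) with hρ
    have hρ0 : 0 < ρ := by positivity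
    have hρ3 : ρ ^ 3 = t := by
      rw [hρ, ← Real.rpow_natCast, ← Real.rpow_mul ht.le]; norm_num
    set W := fun (j : ι) (x : E3) => ENNReal.ofReal (atomProfile θ (r j) ‖x - c j‖) with hW
    have hWm : ∀ j, Measurable (W j) := fun j =>
      (measurable_atomProfile.comp (by fun_prop)).ennreal_ofReal
    set g : E3 → ℝ≥0∞ := fun x => ∑' j, Λ j * (Metric.ball (c j) ρ).indicator (W j) x with hg
    set S := ∑' j, Λ j * ENNReal.ofReal (atomProfile θ (r j) ρ) with hS
    have hgm : Measurable g := by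
      apply Measurable.tsum
      intro j
      exact ((hWm j).indicator Metric.isOpen_ball.measurableSet).const_mul _
    have hgint : ∫⁻ x, g x ∂μ ≤ ENNReal.ofReal C1 * ENNReal.ofReal t * S := by
      calc ∫⁻ x, g x ∂μ ≤ ∫⁻ x, g x := setLIntegral_le_lintegral _ _
        _ = ∑' j, Λ j * ∫⁻ x in Metric.ball (c j) ρ, W j x := by
          rw [hg, lintegral_tsum]
          · congr 1
            ext j
            rw [lintegral_const_mul _ ((hWm j).indicator Metric.isOpen_ball.measurableSet),
              lintegral_indicator Metric.isOpen_ball.measurableSet]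
          · intro j
            exact (((hWm j).indicator Metric.isOpen_ball.measurableSet).const_mul _).aemeasurable
        _ ≤ ∑' j, ENNReal.ofReal C1 * ENNReal.ofReal t *
              (Λ j * ENNReal.ofReal (atomProfile θ (r j) ρ)) := by
          apply ENNReal.tsum_le_tsum
          intro j
          calc _ ≤ Λ j * ENNReal.ofReal (C1 * ρ ^ 3 * atomProfile θ (r j) ρ) := by
                gcongr; exact hI1 _ _ _ (hr j) hρ0
            _ = _ := by
                rw [hρ3, ENNReal.ofReal_mul (by positivity), ENNReal.ofReal_mul (by positivity)]
                ring
        _ = _ := by rw [ENNReal.tsum_mul_left]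
    have hle : ∀ᵐ x ∂μ, ENNReal.ofReal |v x| ≤ g x + (S + N) := by
      filter_upwards [self_mem_ae_restrict hΩ] with x hx
      refine (hv x hx).trans ?_
      rw [← add_assoc]
      gcongr
      rw [hg, hS, ← ENNReal.tsum_add]
      apply ENNReal.tsum_le_tsum
      intro j
      rw [← mul_add]
      gcongr
      by_cases hxj : x ∈ Metric.ball (c j) ρ
      · rw [indicator_of_mem hxj]; exact le_self_add
      · rw [indicator_of_notMem hxj, zero_add]
        apply ENNReal.ofReal_le_ofReal
        apply atomProfile_anti hθ (hr j) hρ0.le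
        rw [Metric.mem_ball, not_lt, dist_eq_norm] at hxj
        exact hxj
    apply ofReal_rearr_le
    intro s hs hVs
    refine measure_lt_le_of_le_add hgm.aemeasurable hle ht (lt_of_le_of_lt ?_ hVs)
    calc S + N + (∫⁻ x, g x ∂μ) / ENNReal.ofReal t
        ≤ S + N + ENNReal.ofReal C1 * S := by
          gcongr
          rw [ENNReal.div_le_iff_le_mul (Or.inl (by simpa using ht))
            (Or.inl ENNReal.ofReal_ne_top)]
          refine hgint.trans (le_of_eq ?_)
          ring
      _ = _ := by
          rw [ENNReal.ofReal_add hC1.le zero_le_one, ENNReal.ofReal_one]; ring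
  have hexp : lorentzNorm μ v (3 / 2) 1 =
      ∫⁻ t in Ioi (0 : ℝ), ENNReal.ofReal (t ^ (1 / (3 / 2) : ℝ) * rearr μ v t / t) := by
    simp [lorentzNorm]
  rw [hexp]
  have hPm : ∀ j, Measurable fun t : ℝ =>
      ENNReal.ofReal (atomProfile θ (r j) (t ^ (1 / 3 : ℝ))) := fun j =>
    (measurable_atomProfile.comp (by fun_prop)).ennreal_ofReal
  calc _ ≤ ∫⁻ t in Ioi (0 : ℝ), (ENNReal.ofReal (C1 + 1) * ∑' j, Λ j *
          (ENNReal.ofReal (t ^ (-(1 / 3) : ℝ)) *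
            ENNReal.ofReal (atomProfile θ (r j) (t ^ (1 / 3 : ℝ)))) +
          (Ioo 0 R).indicator (fun t => N * ENNReal.ofReal (t ^ (-(1 / 3) : ℝ))) t) := by
        apply setLIntegral_mono' measurableSet_Ioi
        intro t ht
        have ht0 : 0 < t := ht
        have h1 : t ^ (1 / (3 / 2) : ℝ) * rearr μ v t / t = t ^ (-(1 / 3) : ℝ) * rearr μ v t := by
          have : t ^ (1 / (3 / 2) : ℝ) = t ^ (-(1 / 3) : ℝ) * t := by
            nth_rewrite 3 [← Real.rpow_one t]
            rw [← Real.rpow_add ht0]; norm_num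
          rw [this]; field_simp
        rw [h1, ENNReal.ofReal_mul (by positivity)]
        refine (mul_le_mul_right (key t ht0) _).trans (le_of_eq ?_)
        rw [mul_add, mul_left_comm, ← ENNReal.tsum_mul_left]
        congr 1
        · congr 2
          ext j
          ring
        · by_cases h : t ∈ Ioo 0 R
          · simp [h, mul_comm]
          · simp [h]
    _ = ENNReal.ofReal (C1 + 1) * ∑' j, Λ j * (∫⁻ t in Ioi (0 : ℝ),
          ENNReal.ofReal (t ^ (-(1 / 3) : ℝ)) *
            ENNReal.ofReal (atomProfile θ (r j) (t ^ (1 / 3 : ℝ)))) + N * J := by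
        rw [lintegral_add_right]
        · congr 1
          · rw [lintegral_const_mul, lintegral_tsum]
            · congr 2
              ext j
              rw [lintegral_const_mul]
              exact (by fun_prop : Measurable fun t : ℝ =>
                ENNReal.ofReal (t ^ (-(1 / 3) : ℝ))).mul (hPm j)
            · intro j
              exact (((by fun_prop : Measurable fun t : ℝ =>
                ENNReal.ofReal (t ^ (-(1 / 3) : ℝ))).mul (hPm j)).const_mul _).aemeasurable
            · apply Measurable.tsum
              intro j
              exact (((by fun_prop : Measurable fun t : ℝ =>
                ENNReal.ofReal (t ^ (-(1 / 3) : ℝ))).mul (hPm j)).const_mul _)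
          · rw [lintegral_indicator measurableSet_Ioo, Measure.restrict_restrict measurableSet_Ioo,
              inter_eq_left.2 (fun x hx => hx.1), lintegral_const_mul]
            fun_prop
        · apply Measurable.indicator _ measurableSet_Ioo
          fun_prop
    _ ≤ ENNReal.ofReal (C1 + 1) * ∑' j, Λ j * ENNReal.ofReal C2 + N * J := by
        gcongr with j
        exact hI2 _ (hr j)
    _ = ENNReal.ofReal ((C1 + 1) * C2) * ∑' j, Λ j + N * ENNReal.ofReal J.toReal := by
        rw [ENNReal.tsum_mul_right, ENNReal.ofReal_mul (by positivity),
          ENNReal.ofReal_toReal hJtop]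
        ring
    _ ≤ _ := by
        rw [ENNReal.ofReal_add (by positivity) (by positivity), mul_add, mul_comm N]
        gcongr
        · exact le_self_add
        · exact le_add_self

lemma le_two_mul_of_le_add_integral {Ω : Set E3} {T : E3 → Measure E3} {v G : E3 → ℝ≥0∞}
    {A B : ℝ≥0∞} (hA : A ≠ 0) (hAt : A ≠ ∞) (hB : B ≠ ∞)
    (hΩ : ∀ x ∈ Ω, ∀ᵐ y ∂T x, y ∈ Ω)
    (hTG : ∀ x ∈ Ω, ∫⁻ y, G y ∂T x ≤ 2⁻¹ * G x)
    (hv : ∀ x ∈ Ω, v x ≤ A * G x + ∫⁻ y, v y ∂T x) (hvB : ∀ x ∈ Ω, v x ≤ B * G x) :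
    ∀ x ∈ Ω, v x ≤ 2 * A * G x := by
  have step : ∀ n : ℕ, ∀ x ∈ Ω, v x ≤ (2 * A + B * 2⁻¹ ^ n) * G x := by
    intro n
    induction n with
    | zero => intro x hx; refine (hvB x hx).trans ?_; gcongr; simp
    | succ n ih =>
      intro x hx
      have hne : 2 * A + B * 2⁻¹ ^ n ≠ ∞ := by
        refine ENNReal.add_ne_top.2 ⟨ENNReal.mul_ne_top (by simp) hAt, ENNReal.mul_ne_top hB ?_⟩
        exact ENNReal.pow_ne_top (by simp)
      calc v x ≤ A * G x + ∫⁻ y, v y ∂T x := hv x hx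
        _ ≤ A * G x + ∫⁻ y, (2 * A + B * 2⁻¹ ^ n) * G y ∂T x := by
            refine add_le_add le_rfl (lintegral_mono_ae ?_)
            filter_upwards [hΩ x hx] with y hy using ih y hy
        _ ≤ A * G x + (2 * A + B * 2⁻¹ ^ n) * (2⁻¹ * G x) := by
            rw [lintegral_const_mul' _ _ hne]
            gcongr
            exact hTG x hx
        _ = A * G x + (2 * 2⁻¹) * A * G x + (B * 2⁻¹ ^ (n + 1)) * G x := by ring
        _ = _ := by
            rw [ENNReal.mul_inv_cancel (by simp) (by simp)]; ring
  intro x hx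
  by_cases hG : G x = ∞
  · rw [hG, ENNReal.mul_top]
    · exact le_top
    · simpa using hA
  · have hlim : Filter.Tendsto (fun n : ℕ => (2 * A + B * 2⁻¹ ^ n) * G x) Filter.atTop
        (nhds ((2 * A + B * 0) * G x)) := by
      refine ENNReal.Tendsto.mul_const ?_ (Or.inr hG)
      refine tendsto_const_nhds.add (ENNReal.Tendsto.const_mul ?_ (Or.inr hB))
      exact ENNReal.tendsto_pow_atTop_nhds_zero_of_lt_one (by simp)
    simpa using ge_of_tendsto' hlim (fun n => step n x hx)

/-- A bounded field dominated by atom profiles plus its own Riesz potential has controlled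
`L(3/2,1)` norm: the potential term is absorbed. -/
lemma lorentzNormV_le_of_potential_bound {Ω : Set E3} (hΩ : MeasurableSet Ω) {R : ℝ} (hR : 0 < R)
    (hvol : volume Ω ≤ ENNReal.ofReal R) {θ : ℝ} (hθ : 0 < θ) (hθ1 : θ < 1) {K : ℝ} (hK : 0 < K) :
    ∃ C : ℝ, 0 < C ∧ ∀ {ι : Type} [Countable ι] (Λ : ι → ℝ≥0∞) (r : ι → ℝ) (c : ι → E3)
      (N : ℝ) (u : E3 → E3) (M : ℝ), (∀ j, 0 < r j) → 0 < N → (∀ x ∈ Ω, ‖u x‖ ≤ M) →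
      ∫⁻ x in Ω, ENNReal.ofReal ‖u x‖ ≤ ENNReal.ofReal N →
      (∀ x ∈ Ω, ENNReal.ofReal ‖u x‖ ≤ ENNReal.ofReal K *
        (∑' j, Λ j * ENNReal.ofReal (atomProfile θ (r j) ‖x - c j‖) +
          ∫⁻ y in Ω, ENNReal.ofReal (‖y - x‖ ^ (-2 : ℝ)) * ENNReal.ofReal ‖u y‖)) →
      lorentzNormV (volume.restrict Ω) u (3 / 2) 1 ≤
        ENNReal.ofReal C * (∑' j, Λ j + ENNReal.ofReal N) := by
  obtain ⟨C0, hC0, hL⟩ := lorentzNorm_le_of_le_tsum hΩ hR hvol hθ hθ1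
  obtain ⟨C1, hC1, hI1⟩ := lintegral_ball_norm_rpow_le (s := 2) (by norm_num)
  obtain ⟨C2, hC2, hI2⟩ := lintegral_truncated_riesz_atomProfile_le hθ hθ1
  set δ := (2 * K * (C1 + C2))⁻¹ with hδ
  have hδ0 : 0 < δ := by positivity
  have hδ1 : K * (C1 * δ) ≤ 2⁻¹ := by
    have : K * ((C1 + C2) * δ) = 2⁻¹ := by rw [hδ]; field_simp
    have h2 : 0 ≤ K * (C2 * δ) := by positivity
    nlinarith
  have hδ2 : K * (C2 * δ) ≤ 2⁻¹ := by
    have : K * ((C1 + C2) * δ) = 2⁻¹ := by rw [hδ]; field_simp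
    have h2 : 0 ≤ K * (C1 * δ) := by positivity
    nlinarith
  set A : ℝ := K * (1 + δ ^ (-2 : ℝ)) with hA
  have hA0 : 0 < A := by positivity
  refine ⟨C0 * (2 * A), by positivity, ?_⟩
  intro ι _ Λ r c N u M hr hN hM hint hpt
  set W := fun (j : ι) (x : E3) => ENNReal.ofReal (atomProfile θ (r j) ‖x - c j‖) with hW
  have hWm : ∀ j, Measurable (W j) := fun j =>
    (measurable_atomProfile.comp (by fun_prop)).ennreal_ofReal
  set G : E3 → ℝ≥0∞ := fun x => ∑' j, Λ j * W j x + ENNReal.ofReal N with hG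
  set k : E3 → E3 → ℝ≥0∞ := fun x y => ENNReal.ofReal (‖y - x‖ ^ (-2 : ℝ)) with hk
  have hkm : ∀ x, Measurable (k x) := fun x => by fun_prop
  have hball : ∀ x : E3, MeasurableSet (Metric.ball x δ) := fun x =>
    Metric.isOpen_ball.measurableSet
  set T : E3 → Measure E3 := fun x =>
    ENNReal.ofReal K • (volume.restrict (Ω ∩ Metric.ball x δ)).withDensity (k x) with hT
  have hTint : ∀ (x : E3) (F : E3 → ℝ≥0∞), ∫⁻ y, F y ∂T x =
      ENNReal.ofReal K * ∫⁻ y in Ω ∩ Metric.ball x δ, k x y * F y := by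
    intro x F
    rw [hT, lintegral_smul_measure,
      lintegral_withDensity_eq_lintegral_mul_non_measurable _ (hkm x)
        (Filter.Eventually.of_forall fun y => ENNReal.ofReal_lt_top)]
    simp
  have hmain := le_two_mul_of_le_add_integral (Ω := Ω) (T := T)
    (v := fun x => ENNReal.ofReal ‖u x‖) (G := G) (A := ENNReal.ofReal A)
    (B := ENNReal.ofReal M / ENNReal.ofReal N) (by simpa using hA0) ENNReal.ofReal_ne_top
    (ENNReal.div_ne_top ENNReal.ofReal_ne_top (by simpa using hN)) ?_ ?_ ?_ ?_
  · have hv : ∀ x ∈ Ω, ENNReal.ofReal |‖u x‖| ≤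
        ∑' j, (2 * ENNReal.ofReal A * Λ j) * ENNReal.ofReal (atomProfile θ (r j) ‖x - c j‖) +
          2 * ENNReal.ofReal A * ENNReal.ofReal N := by
      intro x hx
      rw [abs_of_nonneg (norm_nonneg _)]
      refine (hmain x hx).trans (le_of_eq ?_)
      simp only [hG, mul_add, mul_assoc, ENNReal.tsum_mul_left, hW]
    refine (hL _ r c _ (fun x => ‖u x‖) hr hv).trans (le_of_eq ?_)
    rw [ENNReal.tsum_mul_left, ← mul_add, ENNReal.ofReal_mul hC0.le,
      ENNReal.ofReal_mul (by norm_num : (0 : ℝ) ≤ 2), mul_assoc]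
    simp [mul_assoc]
  · intro x _
    rw [hT]
    have : ∀ᵐ y ∂(volume.restrict (Ω ∩ Metric.ball x δ)).withDensity (k x), y ∈ Ω := by
      apply (withDensity_absolutelyContinuous _ _).ae_le
      filter_upwards [self_mem_ae_restrict (hΩ.inter (hball x))] with y hy using hy.1
    exact (Measure.smul_absolutelyContinuous (c := ENNReal.ofReal K)).ae_le this
  · intro x _
    rw [hTint]
    calc ENNReal.ofReal K * ∫⁻ y in Ω ∩ Metric.ball x δ, k x y * G y
        ≤ ENNReal.ofReal K * ∫⁻ y in Metric.ball x δ, k x y * G y := by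
          gcongr; exact inter_subset_right
      _ = ENNReal.ofReal K * (∑' j, Λ j * (∫⁻ y in Metric.ball x δ, k x y * W j y) +
            (∫⁻ y in Metric.ball x δ, k x y) * ENNReal.ofReal N) := by
          congr 1
          simp only [hG, mul_add]
          rw [lintegral_add_right _ ((hkm x).mul_const _), lintegral_mul_const _ (hkm x)]
          congr 1
          simp only [← ENNReal.tsum_mul_left]
          rw [lintegral_tsum]
          · congr 1
            ext j
            have := lintegral_const_mul (μ := volume.restrict (Metric.ball x δ)) (Λ j)
              ((hkm x).mul (hWm j))
            simp only [Pi.mul_apply] at this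
            rw [← this]
            congr 1
            ext y
            ring
          · intro j
            exact ((hkm x).mul ((hWm j).const_mul _)).aemeasurable
      _ ≤ ENNReal.ofReal K * (∑' j, Λ j * (ENNReal.ofReal (C2 * δ) * W j x) +
            ENNReal.ofReal (C1 * δ) * ENNReal.ofReal N) := by
          gcongr with j
          · exact hI2 (r j) (c j) x δ (hr j) hδ0
          · have := hI1 x δ hδ0
            norm_num at this
            simpa [hk] using this
      _ = ENNReal.ofReal (K * (C2 * δ)) * ∑' j, Λ j * W j x +
            ENNReal.ofReal (K * (C1 * δ)) * ENNReal.ofReal N := by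
          rw [mul_add, ENNReal.ofReal_mul hK.le, ENNReal.ofReal_mul hK.le, ← mul_assoc]
          congr 1
          rw [mul_assoc]
          congr 1
          rw [← ENNReal.tsum_mul_left]
          exact tsum_congr fun j => by ring
      _ ≤ 2⁻¹ * G x := by
          have h2 : ENNReal.ofReal 2⁻¹ = 2⁻¹ := by
            rw [ENNReal.ofReal_inv_of_pos (by norm_num)]; simp
          rw [hG, mul_add, ← h2]
          gcongr
  · intro x hx
    rw [hTint]
    refine (hpt x hx).trans ?_
    have hsplit := lintegral_inter_add_sdiff (μ := (volume : Measure E3))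
      (fun y => k x y * ENNReal.ofReal ‖u y‖) Ω (hball x)
    have hfar : ∫⁻ y in Ω \ Metric.ball x δ, k x y * ENNReal.ofReal ‖u y‖ ≤
        ENNReal.ofReal (δ ^ (-2 : ℝ)) * ENNReal.ofReal N := by
      calc _ ≤ ∫⁻ y in Ω \ Metric.ball x δ,
            ENNReal.ofReal (δ ^ (-2 : ℝ)) * ENNReal.ofReal ‖u y‖ := by
            apply setLIntegral_mono' (hΩ.diff (hball x))
            intro y hy
            refine mul_le_mul_left ?_ _
            apply ENNReal.ofReal_le_ofReal
            apply Real.rpow_le_rpow_of_nonpos hδ0 _ (by norm_num)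
            have := hy.2
            rwa [Metric.mem_ball, not_lt, dist_eq_norm] at this
        _ ≤ ∫⁻ y in Ω, ENNReal.ofReal (δ ^ (-2 : ℝ)) * ENNReal.ofReal ‖u y‖ :=
            lintegral_mono_set sdiff_subset
        _ ≤ _ := by
            rw [lintegral_const_mul' _ _ ENNReal.ofReal_ne_top]
            gcongr
    calc _ ≤ ENNReal.ofReal K * (∑' j, Λ j * W j x +
          ((∫⁻ y in Ω ∩ Metric.ball x δ, k x y * ENNReal.ofReal ‖u y‖) +
            ENNReal.ofReal (δ ^ (-2 : ℝ)) * ENNReal.ofReal N)) := by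
          gcongr
          rw [← hsplit]
          gcongr
      _ = ENNReal.ofReal K * (∑' j, Λ j * W j x +
            ENNReal.ofReal (δ ^ (-2 : ℝ)) * ENNReal.ofReal N) + ENNReal.ofReal K *
          (∫⁻ y in Ω ∩ Metric.ball x δ, k x y * ENNReal.ofReal ‖u y‖) := by ring
      _ ≤ _ := by
          gcongr ?_ + _
          rw [hA, ENNReal.ofReal_mul hK.le, ENNReal.ofReal_add zero_le_one (by positivity),
            ENNReal.ofReal_one, mul_assoc]
          gcongr
          rw [add_mul, one_mul, hG]
          simp only [mul_add]
          calc _ ≤ ∑' j, Λ j * W j x + (ENNReal.ofReal N +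
                (ENNReal.ofReal (δ ^ (-2 : ℝ)) * ∑' j, Λ j * W j x +
                  ENNReal.ofReal (δ ^ (-2 : ℝ)) * ENNReal.ofReal N)) := by
                gcongr
                exact le_add_self.trans le_add_self
            _ = _ := by ring
  · intro x hx
    calc ENNReal.ofReal ‖u x‖ ≤ ENNReal.ofReal M := ENNReal.ofReal_le_ofReal (hM x hx)
      _ = ENNReal.ofReal M / ENNReal.ofReal N * ENNReal.ofReal N := by
          rw [ENNReal.div_mul_cancel (by simpa using hN) ENNReal.ofReal_ne_top]
      _ ≤ _ := by
          gcongr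
          exact le_add_self

/-- Quantitative local description of `Ω` near `p` as a sublevel set of `f`. -/
structure IsChart (Ω : Set E3) (f : E3 → ℝ) (p : E3) (R M L : ℝ) (n : E3) : Prop where
  pos : 0 < R
  smooth : ContDiff ℝ 2 f
  mem_iff : ∀ y ∈ Metric.ball p (4 * R), y ∈ Ω ↔ f y < 0
  bound : ∀ y ∈ Metric.ball p (4 * R), ‖fderiv ℝ f y‖ ≤ M
  lip : ∀ y ∈ Metric.ball p (4 * R), ∀ z ∈ Metric.ball p (4 * R),
    ‖fderiv ℝ f y - fderiv ℝ f z‖ ≤ L * ‖y - z‖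
  one_le : ∀ y ∈ Metric.ball p (4 * R), 1 ≤ fderiv ℝ f y n

namespace IsChart

variable {Ω : Set E3} {f : E3 → ℝ} {p : E3} {R M L : ℝ} {n : E3}

theorem M_nonneg (h : IsChart Ω f p R M L n) : 0 ≤ M :=
  (norm_nonneg _).trans (h.bound p (Metric.mem_ball_self (by have := h.pos; positivity)))

theorem differentiable (h : IsChart Ω f p R M L n) : Differentiable ℝ f :=
  h.smooth.differentiable (by norm_num)

theorem L_nonneg (h : IsChart Ω f p R M L n) : 0 ≤ L := by
  have hR := h.pos
  have h1 := h.lip p (Metric.mem_ball_self (by positivity)) (p + fun _ => R) (by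
    simp [dist_eq_norm, abs_of_pos hR]; linarith)
  have h2 := (norm_nonneg _).trans h1
  have h3 : ‖p - (p + fun _ => R)‖ = R := by
    rw [sub_add_cancel_left, norm_neg, pi_norm_const, Real.norm_eq_abs, abs_of_pos hR]
  rw [h3] at h2
  exact nonneg_of_mul_nonneg_left h2 hR

theorem eq_zero (h : IsChart Ω f p R M L n) (hΩ : IsOpen Ω) {y : E3} (hy : y ∈ frontier Ω)
    (hyb : y ∈ Metric.ball p (4 * R)) : f y = 0 := by
  have hc := h.smooth.continuous
  apply le_antisymm
  · have h1 : y ∈ closure (Metric.ball p (4 * R) ∩ Ω) :=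
      Metric.isOpen_ball.inter_closure ⟨hyb, hy.1⟩
    refine closure_minimal (t := {y | f y ≤ 0}) ?_ (isClosed_le hc continuous_const) h1
    rintro z ⟨hzb, hz⟩
    exact ((h.mem_iff z hzb).1 hz).le
  · by_contra hlt
    have := (h.mem_iff y hyb).2 (not_le.1 hlt)
    rw [hΩ.frontier_eq] at hy
    exact hy.2 this

/-- Points of `Ω` near `p` are close to the boundary when `f` is small. -/
theorem exists_frontier (h : IsChart Ω f p R M L n) {y : E3} (hΩ : IsOpen Ω) (hy : y ∈ Ω)
    (hyb : y ∈ Metric.closedBall p (2 * R)) (hs : |f y| * ‖n‖ < R) :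
    ∃ z ∈ frontier Ω, z ∈ Metric.ball p (4 * R) ∧ ‖z - y‖ ≤ |f y| * ‖n‖ ∧
      ∀ s ∈ Ico (0 : ℝ) 1, y + s • (z - y) ∈ Ω := by
  have hR := h.pos
  have hyb' : dist y p ≤ 2 * R := hyb
  have hfy : f y < 0 := (h.mem_iff y (lt_of_le_of_lt hyb' (by linarith))).1 hy
  have hnear : ∀ t ∈ Icc 0 |f y|, y + t • n ∈ Metric.ball p (4 * R) := by
    intro t ht
    have h1 : dist (y + t • n) p ≤ ‖t • n‖ + dist y p := by
      rw [dist_eq_norm, dist_eq_norm, add_comm y, add_sub_assoc]; exact norm_add_le _ _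
    have h2 : ‖t • n‖ ≤ |f y| * ‖n‖ := by
      rw [norm_smul, Real.norm_eq_abs, abs_of_nonneg ht.1]
      exact mul_le_mul_of_nonneg_right ht.2 (norm_nonneg _)
    rw [Metric.mem_ball]; linarith
  set q := y + |f y| • n with hq
  have hder : ∀ t : ℝ, HasDerivAt (fun t : ℝ => f (y + t • n)) (fderiv ℝ f (y + t • n) n) t := by
    intro t
    have h1 : HasDerivAt (fun t : ℝ => y + t • n) n t := by
      simpa using ((hasDerivAt_id t).smul_const n).const_add y
    exact (h.differentiable _).hasFDerivAt.comp_hasDerivAt t h1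
  have hfq : 0 ≤ f q := by
    have := Convex.mul_sub_le_image_sub_of_le_deriv (convex_Icc 0 |f y|)
      (f := fun t : ℝ => f (y + t • n)) (C := 1)
      (fun t _ => (hder t).continuousAt.continuousWithinAt)
      (fun t _ => (hder t).differentiableAt.differentiableWithinAt)
      (fun t ht => by
        rw [(hder t).deriv]
        exact h.one_le _ (hnear t (interior_subset ht)))
      0 (left_mem_Icc.2 (abs_nonneg _)) |f y| (right_mem_Icc.2 (abs_nonneg _)) (abs_nonneg _)
    simp only [zero_smul, add_zero, sub_zero, one_mul, ← hq] at this
    rw [abs_of_neg hfy] at this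
    linarith
  have hqΩ : q ∈ Ωᶜ := fun hqΩ => by
    have := (h.mem_iff q (hnear _ (right_mem_Icc.2 (abs_nonneg _)))).1 hqΩ
    linarith
  obtain ⟨z, hz, hzd⟩ := hΩ.isClosed_compl.exists_infDist_eq_dist ⟨q, hqΩ⟩ y
  have hdq : dist y z ≤ |f y| * ‖n‖ := by
    rw [← hzd]
    refine (Metric.infDist_le_dist_of_mem hqΩ).trans (le_of_eq ?_)
    rw [hq, dist_eq_norm, sub_add_cancel_left, norm_neg, norm_smul, Real.norm_eq_abs, abs_abs]
  have hseg : ∀ s ∈ Ico (0 : ℝ) 1, y + s • (z - y) ∈ Ω := by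
    intro s hs
    by_contra hcon
    have h1 : dist y z ≤ dist y (y + s • (z - y)) := by
      rw [← hzd]; exact Metric.infDist_le_dist_of_mem hcon
    rw [dist_eq_norm y (y + _), sub_add_cancel_left, norm_neg, norm_smul, ← dist_eq_norm,
      dist_comm z, Real.norm_eq_abs, abs_of_nonneg hs.1] at h1
    have h2 : 0 < dist y z := dist_pos.2 fun hyz => hz (hyz ▸ hy)
    nlinarith [hs.2]
  refine ⟨z, ?_, ?_, ?_, hseg⟩
  · rw [hΩ.frontier_eq]
    refine ⟨?_, hz⟩
    have hcont : ContinuousWithinAt (fun s : ℝ => y + s • (z - y)) (Ico 0 1) 1 := by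
      fun_prop
    have h1 : (1 : ℝ) ∈ closure (Ico (0 : ℝ) 1) := by
      rw [closure_Ico (by norm_num)]; simp
    have := hcont.mem_closure h1 (fun s hs => hseg s hs)
    simpa using this
  · have : dist z p ≤ dist y z + dist y p := dist_triangle_left z p y |>.trans (by simp)
    rw [Metric.mem_ball]; linarith
  · rwa [← dist_eq_norm, dist_comm]

/-- A field that is tangential on the boundary has normal component `O(|f|)`. -/
theorem abs_fderiv_apply_le (h : IsChart Ω f p R M L n) (hΩ : IsOpen Ω) {F : E3 → E3} {B0 B1 : ℝ}
    (hcont : ContinuousOn F (closure Ω)) (hdiff : ∀ x ∈ Ω, DifferentiableAt ℝ F x)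
    (hB0 : ∀ x ∈ Ω, ‖F x‖ ≤ B0) (hB1 : ∀ x ∈ Ω, ‖fderiv ℝ F x‖ ≤ B1)
    (bc : ∀ y ∈ frontier Ω, y ∈ Metric.ball p (4 * R) → fderiv ℝ f y (F y) = 0)
    {y : E3} (hy : y ∈ Ω) (hyb : y ∈ Metric.closedBall p (2 * R)) :
    |fderiv ℝ f y (F y)| ≤ ((L * B0 + M * B1) * ‖n‖ + M * B0 * ‖n‖ / R) * |f y| := by
  have hR := h.pos
  have hM := h.M_nonneg
  have hL := h.L_nonneg
  have hB0' : 0 ≤ B0 := (norm_nonneg _).trans (hB0 y hy)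
  have hB1' : 0 ≤ B1 := (norm_nonneg _).trans (hB1 y hy)
  have hyb4 : y ∈ Metric.ball p (4 * R) := lt_of_le_of_lt (show dist y p ≤ 2 * R from hyb)
    (by linarith)
  rcases lt_or_ge (|f y| * ‖n‖) R with hs | hs
  · obtain ⟨z, hzf, hzb, hzd, hseg⟩ := h.exists_frontier hΩ hy hyb hs
    have hF : ‖F z - F y‖ ≤ B1 * ‖z - y‖ := by
      have hcl : ∀ s ∈ Icc (0 : ℝ) 1, y + s • (z - y) ∈ closure Ω := by
        intro s hs
        rcases hs.2.eq_or_lt with h1 | h1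
        · subst h1; simpa using hzf.1
        · exact subset_closure (hseg s ⟨hs.1, h1⟩)
      have := norm_image_sub_le_of_norm_deriv_right_le_segment (a := 0) (b := 1)
        (f := fun s : ℝ => F (y + s • (z - y)))
        (f' := fun s => fderiv ℝ F (y + s • (z - y)) (z - y)) (C := B1 * ‖z - y‖)
        (hcont.comp (by fun_prop) hcl) ?_ ?_ 1 (by simp)
      · simpa using this
      · intro s hs
        have h1 : HasDerivAt (fun t : ℝ => y + t • (z - y)) (z - y) s := by
          simpa using ((hasDerivAt_id s).smul_const (z - y)).const_add y
        exact ((hdiff _ (hseg s hs)).hasFDerivAt.comp_hasDerivAt s h1).hasDerivWithinAt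
      · intro s hs
        exact (ContinuousLinearMap.le_opNorm _ _).trans
          (mul_le_mul_of_nonneg_right (hB1 _ (hseg s hs)) (norm_nonneg _))
    have hz0 := bc z hzf hzb
    have heq : fderiv ℝ f y (F y) = (fderiv ℝ f y - fderiv ℝ f z) (F y) -
        fderiv ℝ f z (F z - F y) := by
      rw [map_sub, hz0, sub_apply]; ring
    have h1 : |(fderiv ℝ f y - fderiv ℝ f z) (F y)| ≤ L * ‖z - y‖ * B0 := by
      rw [← Real.norm_eq_abs]
      refine (ContinuousLinearMap.le_opNorm _ _).trans ?_
      have := h.lip y hyb4 z hzb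
      rw [norm_sub_rev y z] at this
      exact mul_le_mul this (hB0 y hy) (norm_nonneg _) (by positivity)
    have h2 : |fderiv ℝ f z (F z - F y)| ≤ M * (B1 * ‖z - y‖) := by
      rw [← Real.norm_eq_abs]
      exact (ContinuousLinearMap.le_opNorm _ _).trans
        (mul_le_mul (h.bound z hzb) hF (norm_nonneg _) hM)
    rw [heq]
    refine (abs_sub _ _).trans ((add_le_add h1 h2).trans ?_)
    have h3 : 0 ≤ M * B0 * ‖n‖ / R * |f y| := by positivity
    have h4 : (L * B0 + M * B1) * ‖z - y‖ ≤ (L * B0 + M * B1) * (|f y| * ‖n‖) :=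
      mul_le_mul_of_nonneg_left hzd (by positivity)
    nlinarith
  · have h1 : |fderiv ℝ f y (F y)| ≤ M * B0 := by
      rw [← Real.norm_eq_abs]
      exact (ContinuousLinearMap.le_opNorm _ _).trans
        (mul_le_mul (h.bound y hyb4) (hB0 y hy) (norm_nonneg _) hM)
    have h2 : M * B0 ≤ M * B0 * ‖n‖ / R * |f y| := by
      rw [div_mul_eq_mul_div, le_div_iff₀ hR]
      have : 0 ≤ M * B0 := by positivity
      nlinarith
    have h3 : 0 ≤ (L * B0 + M * B1) * ‖n‖ * |f y| := by positivity
    nlinarith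

end IsChart

theorem fderiv_component {F : E3 → E3} {x : E3} (hF : DifferentiableAt ℝ F x) (j : Fin 3)
    (v : E3) : fderiv ℝ (fun y => F y j) x v = fderiv ℝ F x v j := by
  rw [(hasFDerivAt_pi'.1 hF.hasFDerivAt j).fderiv]
  rfl

theorem pd_component {F : E3 → E3} {x : E3} (hF : DifferentiableAt ℝ F x) (i j : Fin 3) :
    pd (fun y => F y j) i x = fderiv ℝ F x (Pi.single i 1) j := by
  rw [pd, fderiv_component hF]

theorem div3_eq_sum {F : E3 → E3} {x : E3} (hF : DifferentiableAt ℝ F x) :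
    div3 F x = ∑ i, fderiv ℝ F x (Pi.single i 1) i := by
  simp only [div3, pd_component hF]

theorem sum_mul_apply_single (T : E3 →L[ℝ] ℝ) (v : E3) :
    ∑ i, v i * T (Pi.single i 1) = T v := by
  conv_rhs => rw [← Finset.univ_sum_single v, map_sum]
  refine Finset.sum_congr rfl fun i _ => ?_
  have : Pi.single i (v i) = v i • (Pi.single i 1 : E3) := by
    rw [← Pi.single_smul]; simp
  rw [this, map_smul, smul_eq_mul]

theorem integrable_of_bounded_of_compactSupport {g : E3 → ℝ} (hm : AEStronglyMeasurable g volume)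
    (hc : HasCompactSupport g) {B : ℝ} (hB : ∀ x, ‖g x‖ ≤ B) : Integrable g := by
  rw [← integrableOn_iff_integrable_of_support_subset (subset_tsupport g)]
  exact Measure.integrableOn_of_bounded hc.isCompact.measure_lt_top.ne hm
    (Filter.Eventually.of_forall hB)

theorem integral_fderiv_apply_eq_zero {g : E3 → ℝ} (hg : Differentiable ℝ g)
    (hc : HasCompactSupport g) {B : ℝ} (hB : ∀ x, ‖fderiv ℝ g x‖ ≤ B) (v : E3) :
    Integrable (fun x => fderiv ℝ g x v) ∧ ∫ x, fderiv ℝ g x v = 0 := by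
  have hi : Integrable (fun x => fderiv ℝ g x v) := by
    refine integrable_of_bounded_of_compactSupport (B := B * ‖v‖)
      (measurable_fderiv_apply_const ℝ g v).aestronglyMeasurable (hc.fderiv_apply ℝ v) fun x => ?_
    exact (ContinuousLinearMap.le_opNorm _ _).trans
      (mul_le_mul_of_nonneg_right (hB x) (norm_nonneg _))
  refine ⟨hi, ?_⟩
  have := integral_bilinear_fderiv_right_eq_neg_left_of_integrable (μ := (volume : Measure E3))
    (f := fun _ : E3 => (1 : ℝ)) (g := g) (v := v) (B := ContinuousLinearMap.mul ℝ ℝ)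
    (by simp) (by simpa using hi)
    (by simpa using hg.continuous.integrable_of_hasCompactSupport hc)
    (fun x _ => by simp) (fun x _ => hg x)
  simpa using this

theorem integral_div3_eq_zero {G : E3 → E3} (hG : Differentiable ℝ G)
    (hc : HasCompactSupport G) {B : ℝ} (hB : ∀ x, ‖fderiv ℝ G x‖ ≤ B) :
    ∫ x, div3 G x = 0 := by
  have hcomp : ∀ i : Fin 3, ∀ x, fderiv ℝ (fun y => G y i) x (Pi.single i 1) =
      pd (fun y => G y i) i x := fun i x => rfl
  have key : ∀ i : Fin 3, Integrable (fun x => pd (fun y => G y i) i x) ∧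
      ∫ x, pd (fun y => G y i) i x = 0 := by
    intro i
    have hi : Differentiable ℝ (fun y => G y i) := fun x => (differentiableAt_pi.1 (hG x)) i
    refine integral_fderiv_apply_eq_zero hi ?_ (B := B) ?_ (Pi.single i 1)
    · exact hc.comp_left (g := fun v : E3 => v i) rfl
    · intro x
      refine ContinuousLinearMap.opNorm_le_bound _ ((norm_nonneg _).trans (hB x)) fun v => ?_
      rw [fderiv_component (hG x)]
      exact (norm_le_pi_norm _ i).trans ((ContinuousLinearMap.le_opNorm _ _).trans
        (mul_le_mul_of_nonneg_right (hB x) (norm_nonneg _)))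
  simp only [div3]
  rw [integral_finsetSum _ fun i _ => (key i).1]
  exact Finset.sum_eq_zero fun i _ => (key i).2

/-- Smooth cutoff equal to `0` on `(-∞, 1]` and to `1` on `[2, ∞)`. -/
def cutoff (s : ℝ) : ℝ := Real.smoothTransition (s - 1)

theorem cutoff_contDiff : ContDiff ℝ 2 cutoff :=
  Real.smoothTransition.contDiff.comp (contDiff_id.sub contDiff_const)

theorem cutoff_of_le {s : ℝ} (hs : s ≤ 1) : cutoff s = 0 :=
  Real.smoothTransition.zero_of_nonpos (by linarith)

theorem cutoff_of_ge {s : ℝ} (hs : 2 ≤ s) : cutoff s = 1 :=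
  Real.smoothTransition.one_of_one_le (by linarith)

theorem abs_cutoff_le (s : ℝ) : |cutoff s| ≤ 1 := by
  rw [cutoff, abs_of_nonneg (Real.smoothTransition.nonneg _)]
  exact Real.smoothTransition.le_one _

theorem deriv_cutoff_of_gt {s : ℝ} (hs : 2 < s) : deriv cutoff s = 0 := by
  have : cutoff =ᶠ[nhds s] fun _ => 1 := by
    filter_upwards [lt_mem_nhds hs] with t ht using cutoff_of_ge ht.le
  rw [this.deriv_eq]; simp

theorem deriv_cutoff_of_lt {s : ℝ} (hs : s < 1) : deriv cutoff s = 0 := by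
  have : cutoff =ᶠ[nhds s] fun _ => 0 := by
    filter_upwards [gt_mem_nhds hs] with t ht using cutoff_of_le ht.le
  rw [this.deriv_eq]; simp

theorem exists_abs_deriv_cutoff_le : ∃ C, 0 ≤ C ∧ ∀ s, |deriv cutoff s| ≤ C := by
  obtain ⟨C, hC⟩ := isCompact_Icc (a := (1 : ℝ)) (b := 2) |>.exists_bound_of_continuousOn
    (f := deriv cutoff) (cutoff_contDiff.continuous_deriv (by norm_num)).continuousOn
  refine ⟨max C 0, le_max_right _ _, fun s => ?_⟩
  rcases lt_or_ge s 1 with h1 | h1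
  · rw [deriv_cutoff_of_lt h1]; simp
  rcases lt_or_ge 2 s with h2 | h2
  · rw [deriv_cutoff_of_gt h2]; simp
  · exact (hC s ⟨h1, h2⟩).trans (le_max_left _ _)

namespace IsChart

variable {Ω : Set E3} {f : E3 → ℝ} {p : E3} {R M L : ℝ} {n : E3}

/-- Divergence theorem for localized fields tangential to the boundary. -/
theorem integral_div3 (h : IsChart Ω f p R M L n) (hΩ : IsOpen Ω) (hbd : Bornology.IsBounded Ω)
    {F : E3 → E3} {B0 B1 : ℝ}
    (hcont : ContinuousOn F (closure Ω)) (hdiff : ∀ x ∈ Ω, DifferentiableAt ℝ F x)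
    (hB0 : ∀ x ∈ Ω, ‖F x‖ ≤ B0) (hB1 : ∀ x ∈ Ω, ‖fderiv ℝ F x‖ ≤ B1)
    (supp : ∀ y ∉ Metric.closedBall p (2 * R), F y = 0)
    (bc : ∀ y ∈ frontier Ω, y ∈ Metric.ball p (4 * R) → fderiv ℝ f y (F y) = 0) :
    ∫ x in Ω, div3 F x = 0 := by
  classical
  have hR := h.pos
  have hM := h.M_nonneg
  obtain ⟨Ch, hCh, hh'⟩ := exists_abs_deriv_cutoff_le
  rcases Ω.eq_empty_or_nonempty with hemp | ⟨x0, hx0⟩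
  · simp [hemp]
  have hB0' : 0 ≤ B0 := (norm_nonneg _).trans (hB0 x0 hx0)
  have hB1' : 0 ≤ B1 := (norm_nonneg _).trans (hB1 x0 hx0)
  set Cf := (L * B0 + M * B1) * ‖n‖ + M * B0 * ‖n‖ / R with hCf
  have hL := h.L_nonneg
  have hCf0 : 0 ≤ Cf := by positivity
  have hsub : ∀ y ∈ Metric.closedBall p (2 * R), y ∈ Metric.ball p (4 * R) := fun y hy =>
    lt_of_le_of_lt (show dist y p ≤ 2 * R from hy) (by linarith)
  have hfd0 : ∀ y ∉ Metric.closedBall p (2 * R), F =ᶠ[nhds y] fun _ => 0 := by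
    intro y hy
    filter_upwards [Metric.isClosed_closedBall.isOpen_compl.mem_nhds hy] with z hz
      using supp z hz
  -- the truncated field and its derivative
  let η : ℝ → E3 → ℝ := fun ε y => cutoff (-f y / ε)
  let D : ℝ → E3 → E3 →L[ℝ] E3 := fun ε y => if y ∈ Ω then
    η ε y • fderiv ℝ F y + ((deriv cutoff (-f y / ε) * (-1 / ε)) • fderiv ℝ f y).smulRight (F y)
    else 0
  let G : ℝ → E3 → E3 := fun ε y => if y ∈ Ω then η ε y • F y else 0
  have hηd : ∀ ε y, HasFDerivAt (η ε) ((deriv cutoff (-f y / ε) * (-1 / ε)) • fderiv ℝ f y) y := by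
    intro ε y
    have h1 : HasFDerivAt (fun y => -f y / ε) ((-1 / ε) • fderiv ℝ f y) y := by
      have := ((h.differentiable y).hasFDerivAt.const_mul (-1 / ε))
      refine this.congr_of_eventuallyEq (Filter.Eventually.of_forall fun z => ?_)
      simp only; ring
    have h2 : HasDerivAt cutoff (deriv cutoff (-f y / ε)) (-f y / ε) :=
      (cutoff_contDiff.differentiable (by norm_num) _).hasDerivAt
    have := h2.comp_hasFDerivAt y h1
    rwa [smul_smul] at this
  have hGd : ∀ ε > 0, ∀ y, HasFDerivAt (G ε) (D ε y) y := by
    intro ε hε y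
    by_cases hy : y ∈ Ω
    · have h1 : HasFDerivAt (fun y => η ε y • F y) (D ε y) y := by
        simp only [D, if_pos hy]
        exact (hηd ε y).smul (hdiff y hy).hasFDerivAt
      refine h1.congr_of_eventuallyEq ?_
      filter_upwards [hΩ.mem_nhds hy] with z hz
      simp only [G, if_pos hz]
    · have h0 : G ε =ᶠ[nhds y] fun _ => 0 := by
        by_cases hyc : y ∈ closure Ω
        · by_cases hyb : y ∈ Metric.closedBall p (2 * R)
          · have hf0 := h.eq_zero hΩ (by rw [hΩ.frontier_eq]; exact ⟨hyc, hy⟩) (hsub y hyb)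
            have : ∀ᶠ z in nhds y, -f z / ε < 1 := by
              apply ContinuousAt.eventually_lt _ continuousAt_const
              · simp [hf0]
              · exact (h.smooth.continuous.neg.div_const ε).continuousAt
            filter_upwards [this] with z hz
            simp [G, η, cutoff_of_le hz.le]
          · filter_upwards [hfd0 y hyb] with z hz
            simp [G, hz]
        · filter_upwards [isClosed_closure.isOpen_compl.mem_nhds hyc] with z hz
          have : z ∉ Ω := fun hz' => hz (subset_closure hz')
          simp [G, this]
      simp only [D, if_neg hy]
      exact (hasFDerivAt_const 0 y).congr_of_eventuallyEq h0
  have hGc : ∀ ε, HasCompactSupport (G ε) := fun ε =>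
    HasCompactSupport.intro (isCompact_closedBall p (2 * R)) fun y hy => by
      simp [G, supp y hy]
  have hcoef : ∀ ε > 0, ∀ y, |deriv cutoff (-f y / ε) * (-1 / ε)| ≤ Ch / ε := by
    intro ε hε y
    rw [abs_mul, abs_div, abs_neg, abs_one, abs_of_pos hε, mul_one_div]
    exact div_le_div_of_nonneg_right (hh' _) hε.le
  have hDb : ∀ ε > 0, ∀ y, ‖fderiv ℝ (G ε) y‖ ≤ B1 + Ch / ε * M * B0 := by
    intro ε hε y
    rw [(hGd ε hε y).fderiv]
    by_cases hy : y ∈ Ω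
    · simp only [D, if_pos hy]
      by_cases hyb : y ∈ Metric.closedBall p (2 * R)
      · refine (norm_add_le _ _).trans (add_le_add ?_ ?_)
        · rw [norm_smul]
          calc _ ≤ 1 * B1 := mul_le_mul (abs_cutoff_le _) (hB1 y hy) (norm_nonneg _) zero_le_one
            _ = B1 := one_mul _
        · rw [ContinuousLinearMap.norm_smulRight_apply, norm_smul]
          have h1 := hcoef ε hε y
          have h2 := h.bound y (hsub y hyb)
          have h3 := hB0 y hy
          rw [Real.norm_eq_abs]
          gcongr
      · have h0 := hfd0 y hyb
        rw [supp y hyb, h0.fderiv_eq]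
        simp; positivity
    · simp only [D, if_neg hy, norm_zero]; positivity
  have hdivG : ∀ ε > 0, ∀ y, div3 (G ε) y = Ω.indicator (fun y => η ε y * div3 F y +
      deriv cutoff (-f y / ε) * (-1 / ε) * fderiv ℝ f y (F y)) y := by
    intro ε hε y
    rw [div3_eq_sum (hGd ε hε y).differentiableAt, (hGd ε hε y).fderiv]
    by_cases hy : y ∈ Ω
    · simp only [D, if_pos hy, indicator_of_mem hy]
      rw [div3_eq_sum (hdiff y hy), ← sum_mul_apply_single (fderiv ℝ f y) (F y), Finset.mul_sum,
        Finset.mul_sum, ← Finset.sum_add_distrib]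
      refine Finset.sum_congr rfl fun i _ => ?_
      simp; ring
    · simp [D, hy]
  have hint : ∀ ε > 0, ∫ y in Ω, (η ε y * div3 F y +
      deriv cutoff (-f y / ε) * (-1 / ε) * fderiv ℝ f y (F y)) = 0 := by
    intro ε hε
    rw [← integral_indicator hΩ.measurableSet,
      ← integral_div3_eq_zero (fun y => (hGd ε hε y).differentiableAt) (hGc ε) (hDb ε hε)]
    exact integral_congr_ae (Filter.Eventually.of_forall fun y => (hdivG ε hε y).symm)
  have hdivb : ∀ y ∈ Ω, |div3 F y| ≤ 3 * B1 := by
    intro y hy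
    rw [div3_eq_sum (hdiff y hy)]
    refine (Finset.abs_sum_le_sum_abs _ _).trans ?_
    have : ∀ i : Fin 3, |fderiv ℝ F y (Pi.single i 1) i| ≤ B1 := fun i => by
      refine (norm_le_pi_norm (fderiv ℝ F y (Pi.single i 1)) i).trans
        ((ContinuousLinearMap.le_opNorm _ _).trans ?_)
      rw [Pi.norm_single, norm_one, mul_one]
      exact hB1 y hy
    refine (Finset.sum_le_sum fun i _ => this i).trans ?_
    simp
  have hdiffOn : DifferentiableOn ℝ F Ω := fun x hx => (hdiff x hx).differentiableWithinAt
  have hdivm : Measurable (div3 F) := by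
    unfold div3 pd
    exact Finset.measurable_sum _ fun i _ => measurable_fderiv_apply_const ℝ _ _
  have hFm : AEStronglyMeasurable F (volume.restrict Ω) :=
    hdiffOn.continuousOn.aestronglyMeasurable hΩ.measurableSet
  have hvol : volume Ω < ∞ := hbd.measure_lt_top
  -- pass to the limit
  let ε : ℕ → ℝ := fun k => 1 / ((k : ℝ) + 1)
  have hε0 : ∀ k, 0 < ε k := fun k => by positivity
  have hεt : Filter.Tendsto ε Filter.atTop (nhds 0) := tendsto_one_div_add_atTop_nhds_zero_nat
  have hlim : Filter.Tendsto (fun k => ∫ y in Ω, (η (ε k) y * div3 F y +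
      deriv cutoff (-f y / ε k) * (-1 / ε k) * fderiv ℝ f y (F y))) Filter.atTop
      (nhds (∫ y in Ω, div3 F y)) := by
    refine tendsto_integral_of_dominated_convergence (fun _ => 3 * B1 + Ch * (2 * Cf)) ?_ ?_ ?_ ?_
    · intro k
      have hcη : Continuous (η (ε k)) :=
        cutoff_contDiff.continuous.comp (h.smooth.continuous.neg.div_const _)
      have hcd : Continuous fun y => deriv cutoff (-f y / ε k) :=
        (cutoff_contDiff.continuous_deriv (by norm_num)).comp
          (h.smooth.continuous.neg.div_const _)
      have hfF : AEStronglyMeasurable (fun y => fderiv ℝ f y (F y)) (volume.restrict Ω) :=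
        ((h.smooth.continuous_fderiv (by norm_num)).comp_continuousOn continuousOn_id |>.clm_apply
          hdiffOn.continuousOn).aestronglyMeasurable hΩ.measurableSet
      exact (hcη.aestronglyMeasurable.mul hdivm.aestronglyMeasurable).add
        ((hcd.aestronglyMeasurable.mul_const _).mul hfF)
    · exact integrableOn_const hvol.ne
    · intro k
      filter_upwards [self_mem_ae_restrict hΩ.measurableSet] with y hy
      refine (norm_add_le _ _).trans (add_le_add ?_ ?_)
      · rw [norm_mul]
        calc _ ≤ 1 * (3 * B1) :=
              mul_le_mul (abs_cutoff_le _) (hdivb y hy) (abs_nonneg _) zero_le_one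
          _ = _ := one_mul _
      · rcases lt_or_ge 2 (-f y / ε k) with h2 | h2
        · rw [deriv_cutoff_of_gt h2]; simp; positivity
        by_cases hyb : y ∈ Metric.closedBall p (2 * R)
        · have hfy := (h.mem_iff y (hsub y hyb)).1 hy
          have h3 := h.abs_fderiv_apply_le hΩ hcont hdiff hB0 hB1 bc hy hyb
          rw [abs_of_neg hfy] at h3
          rw [div_le_iff₀ (hε0 k)] at h2
          rw [norm_mul]
          calc _ ≤ Ch / ε k * (Cf * (2 * ε k)) := by
                refine mul_le_mul (hcoef _ (hε0 k) y) (h3.trans ?_) (norm_nonneg _)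
                  (div_nonneg hCh (hε0 k).le)
                exact mul_le_mul_of_nonneg_left h2 hCf0
            _ = _ := by
                have := (hε0 k).ne'
                field_simp
        · rw [supp y hyb]; simp; positivity
    · filter_upwards [self_mem_ae_restrict hΩ.measurableSet] with y hy
      by_cases hyb : y ∈ Metric.closedBall p (2 * R)
      · have hfy := (h.mem_iff y (hsub y hyb)).1 hy
        have hev : ∀ᶠ k in Filter.atTop, 2 < -f y / ε k := by
          filter_upwards [hεt.eventually_lt_const (show 0 < -f y / 2 by linarith)] with k hk
          rw [lt_div_iff₀ (hε0 k)]; linarith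
        refine tendsto_const_nhds.congr' ?_
        filter_upwards [hev] with k hk
        rw [deriv_cutoff_of_gt hk]
        simp [η, cutoff_of_ge hk.le]
      · have : div3 F y = 0 := by
          rw [div3_eq_sum (hdiff y hy), (hfd0 y hyb).fderiv_eq]
          simp
        rw [this, supp y hyb]
        simp
  have h0 : (fun k => ∫ y in Ω, (η (ε k) y * div3 F y +
      deriv cutoff (-f y / ε k) * (-1 / ε k) * fderiv ℝ f y (F y))) = fun _ => 0 :=
    funext fun k => hint _ (hε0 k)
  rw [h0] at hlim
  exact (tendsto_nhds_unique hlim tendsto_const_nhds)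

end IsChart

/-- The cross product as a continuous bilinear map. -/
def crossL : E3 →L[ℝ] E3 →L[ℝ] E3 :=
  LinearMap.toContinuousBilinearMap (LinearMap.mk₂ ℝ cross3
    (fun a b c => by ext i; fin_cases i <;> simp [cross3] <;> ring)
    (fun k a b => by ext i; fin_cases i <;> simp [cross3] <;> ring)
    (fun a b c => by ext i; fin_cases i <;> simp [cross3] <;> ring)
    (fun k a b => by ext i; fin_cases i <;> simp [cross3] <;> ring))

@[simp] theorem crossL_apply (a b : E3) : crossL a b = cross3 a b := rfl

/-- Regularity of a field up to the boundary, with explicit bounds. -/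
structure IsRegularField (Ω : Set E3) (u : E3 → E3) (B0 B1 : ℝ) : Prop where
  cont : ContinuousOn u (closure Ω)
  diff : ∀ x ∈ Ω, DifferentiableAt ℝ u x
  bound : ∀ x ∈ Ω, ‖u x‖ ≤ B0
  dbound : ∀ x ∈ Ω, ‖fderiv ℝ u x‖ ≤ B1

theorem HolderC1.exists_isRegularField {Ω : Set E3} {α : ℝ} {u : E3 → E3} (hΩ : IsOpen Ω)
    (hbd : Bornology.IsBounded Ω) (hα : 0 < α) (hu : HolderC1 α Ω u) :
    ∃ B0 B1, IsRegularField Ω u B0 B1 := by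
  obtain ⟨hc, C, hC⟩ := hu
  have hcomp : IsCompact (closure Ω) := hbd.isCompact_closure
  obtain ⟨B0, hB0⟩ := hcomp.exists_bound_of_continuousOn hc.continuousOn
  have hnh : ∀ x ∈ Ω, closure Ω ∈ nhds x := fun x hx =>
    Filter.mem_of_superset (hΩ.mem_nhds hx) subset_closure
  rcases Ω.eq_empty_or_nonempty with hemp | ⟨x0, hx0⟩
  · subst hemp
    exact ⟨0, 0, by simp, by simp, by simp, by simp⟩
  refine ⟨B0, |C| * (Metric.diam (closure Ω)) ^ α + ‖fderivWithin ℝ u (closure Ω) x0‖,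
    hc.continuousOn, fun x hx => ?_, fun x hx => hB0 x (subset_closure hx), fun x hx => ?_⟩
  · exact ((hc x (subset_closure hx)).contDiffAt (hnh x hx)).differentiableAt (by norm_num)
  · have h1 := hC x (subset_closure hx) x0 (subset_closure hx0)
    rw [← fderivWithin_of_mem_nhds (hnh x hx)]
    have h2 := norm_le_insert' (fderivWithin ℝ u (closure Ω) x) (fderivWithin ℝ u (closure Ω) x0)
    have h3 : ‖x - x0‖ ≤ Metric.diam (closure Ω) := by
      rw [← dist_eq_norm]
      exact Metric.dist_le_diam_of_mem hcomp.isBounded (subset_closure hx) (subset_closure hx0)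
    have h4 : C * ‖x - x0‖ ^ α ≤ |C| * (Metric.diam (closure Ω)) ^ α :=
      (mul_le_mul_of_nonneg_right (le_abs_self C) (by positivity)).trans
        (mul_le_mul_of_nonneg_left (Real.rpow_le_rpow (norm_nonneg _) h3 hα.le) (abs_nonneg _))
    linarith

theorem dot3_smul_left (a b : E3) (k : ℝ) : dot3 (k • a) b = k * dot3 a b := by
  simp [dot3, Fin.sum_univ_three]; ring

theorem dot3_comm (a b : E3) : dot3 a b = dot3 b a := by
  simp [dot3, mul_comm]

theorem fderiv_eq_dot3 (f : E3 → ℝ) (y v : E3) : fderiv ℝ f y v = dot3 (grad3 f y) v := by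
  rw [← sum_mul_apply_single]
  simp [dot3, grad3, pd, mul_comm]

theorem dot3_single (i : Fin 3) (a : E3) : dot3 (Pi.single i 1) a = a i := by
  fin_cases i <;> simp [dot3, Fin.sum_univ_three]

theorem IsChart.exists_grad_eq {Ω : Set E3} {f : E3 → ℝ} {p : E3} {R M L : ℝ} {n : E3}
    (h : IsChart Ω f p R M L n) (hΩ : IsOpen Ω) {ν : E3 → E3} (hν : IsOutwardNormal Ω ν) {y : E3}
    (hy : y ∈ frontier Ω) (hyb : y ∈ Metric.ball p (4 * R)) :
    ∃ c : ℝ, grad3 f y = c • ν y := by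
  obtain ⟨hν1, hν2⟩ := hν y hy
  have hf0 := h.eq_zero hΩ hy hyb
  have step1 : ∀ v : E3, fderiv ℝ f y v < 0 → dot3 v (ν y) ≤ 0 := by
    intro v hv
    have hline : ∀ t : ℝ, HasDerivAt (fun t : ℝ => y + t • v) v t := fun t => by
      simpa using ((hasDerivAt_id t).smul_const v).const_add y
    have hd : HasDerivAt (fun t : ℝ => f (y + t • v)) (fderiv ℝ f y v) 0 := by
      have h1 := (h.differentiable (y + (0 : ℝ) • v)).hasFDerivAt.comp_hasDerivAt 0 (hline 0)
      simp only [zero_smul, add_zero] at h1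
      exact h1
    have hev1 : ∀ᶠ t in nhdsWithin (0 : ℝ) (Ioi 0), f (y + t • v) < 0 := by
      have h1 := (hasDerivAt_iff_tendsto_slope.1 hd).eventually_lt_const hv
      have h2 := h1.filter_mono (nhdsWithin_mono (0 : ℝ) (fun t (ht : 0 < t) => ht.ne'))
      filter_upwards [h2, self_mem_nhdsWithin] with t ht ht0
      rw [slope_def_field] at ht
      simp only [zero_smul, add_zero, hf0, sub_zero] at ht
      exact (div_neg_iff.1 ht).resolve_left (fun hh => absurd hh.2 (not_lt.2 (le_of_lt ht0))) |>.1
    have hev2 : ∀ᶠ t in nhdsWithin (0 : ℝ) (Ioi 0), y + t • v ∈ Metric.ball p (4 * R) := by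
      have hc : ContinuousAt (fun t : ℝ => y + t • v) 0 := by fun_prop
      have : ∀ᶠ t in nhds (0 : ℝ), y + t • v ∈ Metric.ball p (4 * R) :=
        hc.eventually_mem (Metric.isOpen_ball.mem_nhds (by simpa using hyb))
      exact this.filter_mono nhdsWithin_le_nhds
    obtain ⟨t0, ht0, hsub⟩ := (mem_nhdsGT_iff_exists_Ioc_subset).1 (hev1.and hev2)
    have ht0' : (0 : ℝ) < t0 := ht0
    have hmem : ∀ t, 0 < t → t ≤ t0 → y + t • v ∈ Ω := fun t h1 h2 =>
      (h.mem_iff _ (hsub ⟨h1, h2⟩).2).2 (hsub ⟨h1, h2⟩).1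
    have heq : (fun t : ℝ => y + (min t t0) • v) =ᶠ[nhds 0] fun t => y + t • v := by
      filter_upwards [gt_mem_nhds ht0'] with t ht
      rw [min_eq_left ht.le]
    have hder := (hline 0).congr_of_eventuallyEq heq
    have := hν2 (fun t => y + (min t t0) • v) (by simp [ht0'.le]) hder.differentiableAt (by
      intro t ht
      rcases ht.eq_or_lt with h0 | h0
      · rw [← h0, min_eq_left ht0'.le]; simpa using hy.1
      · exact subset_closure (hmem _ (lt_min h0 ht0') (min_le_right _ _)))
    rwa [hder.deriv] at this
  have hadd : ∀ a b c : E3, dot3 (a + b) c = dot3 a c + dot3 b c := fun a b c => by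
    simp [dot3, add_mul, Finset.sum_add_distrib]
  have hn := h.one_le y hyb
  have step2 : ∀ v : E3, fderiv ℝ f y v ≤ 0 → dot3 v (ν y) ≤ 0 := by
    intro v hv
    have h1 : ∀ t : ℝ, 0 < t → dot3 v (ν y) - t * dot3 n (ν y) ≤ 0 := by
      intro t ht
      have := step1 (v + (-t) • n) (by
        rw [map_add, map_smul, smul_eq_mul]; nlinarith)
      rw [hadd, dot3_smul_left] at this
      linarith
    have ht : Filter.Tendsto (fun t : ℝ => dot3 v (ν y) - t * dot3 n (ν y))
        (nhdsWithin 0 (Ioi 0)) (nhds (dot3 v (ν y) - 0 * dot3 n (ν y))) :=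
      (Continuous.tendsto (by fun_prop) 0).mono_left nhdsWithin_le_nhds
    have := le_of_tendsto ht (by filter_upwards [self_mem_nhdsWithin] with t ht using h1 t ht)
    linarith
  have step3 : ∀ v : E3, fderiv ℝ f y v = 0 → dot3 v (ν y) = 0 := by
    intro v hv
    refine le_antisymm (step2 v hv.le) ?_
    have := step2 ((-1 : ℝ) • v) (by rw [map_smul, hv]; simp)
    rw [dot3_smul_left] at this
    linarith
  have step4 : ∀ i, ν y i * fderiv ℝ f y n = grad3 f y i * dot3 n (ν y) := by
    intro i
    have := step3 (fderiv ℝ f y n • Pi.single i 1 + (-(grad3 f y i)) • n) (by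
      rw [map_add, map_smul, map_smul]; simp [grad3, pd]; ring)
    rw [hadd, dot3_smul_left, dot3_smul_left, dot3_single] at this
    linarith
  have hne : dot3 n (ν y) ≠ 0 := by
    intro h0
    have : ν y = 0 := by
      ext i
      have := step4 i
      rw [h0, mul_zero] at this
      exact (mul_eq_zero.1 this).resolve_right (by linarith)
    rw [this] at hν1
    simp at hν1
  refine ⟨fderiv ℝ f y n / dot3 n (ν y), ?_⟩
  ext i
  have := step4 i
  simp only [Pi.smul_apply, smul_eq_mul]
  field_simp
  linarith

theorem exists_forall_norm_le_of_contDiff {E F : Type*} [NormedAddCommGroup E] [NormedSpace ℝ E]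
    [NormedAddCommGroup F] [NormedSpace ℝ F]
    {g : E → F} (hg : ContDiff ℝ 1 g) (hc : HasCompactSupport g) :
    ∃ C, 0 ≤ C ∧ ∀ x, ‖g x‖ ≤ C ∧ ‖fderiv ℝ g x‖ ≤ C := by
  obtain ⟨C1, h1⟩ := hg.continuous.bounded_above_of_compact_support hc
  obtain ⟨C2, h2⟩ := (hg.continuous_fderiv (by norm_num)).bounded_above_of_compact_support
    (hc.fderiv ℝ)
  exact ⟨max 0 (max C1 C2), le_max_left _ _, fun x =>
    ⟨(h1 x).trans (by simp), (h2 x).trans (by simp)⟩⟩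

theorem div3_neg_smul_add_cross {φ : E3 → ℝ} {A u : E3 → E3} {x : E3}
    (hφ : DifferentiableAt ℝ φ x) (hA : DifferentiableAt ℝ A x) (hu : DifferentiableAt ℝ u x) :
    HasFDerivAt (fun y => -(φ y • u y) + crossL (A y) (u y))
      (-(φ x • fderiv ℝ u x + (fderiv ℝ φ x).smulRight (u x)) +
        (crossL.precompR E3 (A x) (fderiv ℝ u x) + crossL.precompL E3 (fderiv ℝ A x) (u x))) x ∧
    div3 (fun y => -(φ y • u y) + crossL (A y) (u y)) x =
      dot3 (u x) (curl3 A x - grad3 φ x) - (φ x * div3 u x + dot3 (A x) (curl3 u x)) := by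
  have h1 : HasFDerivAt (fun y => -(φ y • u y) + crossL (A y) (u y)) _ x :=
    (hφ.hasFDerivAt.smul hu.hasFDerivAt).neg.add
    (crossL.hasFDerivAt_of_bilinear hA.hasFDerivAt hu.hasFDerivAt)
  refine ⟨h1, ?_⟩
  rw [div3_eq_sum h1.differentiableAt, h1.fderiv, div3_eq_sum hu]
  simp only [dot3, Fin.sum_univ_three]
  simp [cross3, curl3, grad3, pd]
  simp only [fderiv_component hu, fderiv_component hA]
  ring

theorem abs_dot3_le (a b : E3) : |dot3 a b| ≤ 3 * (‖a‖ * ‖b‖) := by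
  rw [dot3]
  refine (Finset.abs_sum_le_sum_abs _ _).trans ?_
  refine (Finset.sum_le_sum (g := fun _ => ‖a‖ * ‖b‖) fun i _ => ?_).trans (by simp)
  rw [abs_mul]
  exact mul_le_mul (norm_le_pi_norm a i) (norm_le_pi_norm b i) (abs_nonneg _) (norm_nonneg _)

theorem fderiv_apply_single_le {u : E3 → E3} {x : E3} (i j : Fin 3) :
    |fderiv ℝ u x (Pi.single i 1) j| ≤ ‖fderiv ℝ u x‖ := by
  refine (norm_le_pi_norm (fderiv ℝ u x (Pi.single i 1)) j).trans
    ((ContinuousLinearMap.le_opNorm _ _).trans ?_)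
  rw [Pi.norm_single, norm_one, mul_one]

theorem abs_div3_le {u : E3 → E3} {x : E3} (hu : DifferentiableAt ℝ u x) :
    |div3 u x| ≤ 3 * ‖fderiv ℝ u x‖ := by
  rw [div3_eq_sum hu]
  refine (Finset.abs_sum_le_sum_abs _ _).trans ?_
  refine (Finset.sum_le_sum fun i _ => fderiv_apply_single_le i i).trans ?_
  simp

theorem norm_curl3_le {u : E3 → E3} {x : E3} (hu : DifferentiableAt ℝ u x) :
    ‖curl3 u x‖ ≤ 2 * ‖fderiv ℝ u x‖ := by
  refine (pi_norm_le_iff_of_nonneg (by positivity)).2 fun i => ?_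
  have h : ∀ i j k l : Fin 3, ‖fderiv ℝ u x (Pi.single i 1) j - fderiv ℝ u x (Pi.single k 1) l‖ ≤
      2 * ‖fderiv ℝ u x‖ := fun i j k l => by
    have h1 := fderiv_apply_single_le (u := u) (x := x) i j
    have h2 := fderiv_apply_single_le (u := u) (x := x) k l
    exact (norm_sub_le _ _).trans (by simp only [Real.norm_eq_abs]; linarith)
  fin_cases i <;> simp only [curl3, pd_component hu] <;> exact h _ _ _ _

theorem measurable_div3 (u : E3 → E3) : Measurable (div3 u) := by
  unfold div3 pd
  exact Finset.measurable_sum _ fun i _ => measurable_fderiv_apply_const ℝ _ _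

theorem measurable_curl3 (u : E3 → E3) : Measurable (curl3 u) := by
  refine measurable_pi_iff.2 fun i => ?_
  have h : ∀ j k, Measurable fun x => pd (fun y => u y k) j x := fun j k =>
    measurable_fderiv_apply_const ℝ _ _
  fin_cases i <;> exact (h _ _).sub (h _ _)

/-- Green's identity for localized test fields. -/
theorem IsChart.green {Ω : Set E3} {f : E3 → ℝ} {p : E3} {R M L : ℝ} {n : E3}
    (h : IsChart Ω f p R M L n) (hΩ : IsOpen Ω) (hbd : Bornology.IsBounded Ω)
    {u : E3 → E3} {B0 B1 : ℝ} (hu : IsRegularField Ω u B0 B1)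
    {φ : E3 → ℝ} {A : E3 → E3} (hφ : ContDiff ℝ 1 φ) (hA : ContDiff ℝ 1 A)
    (hφs : ∀ y ∉ Metric.closedBall p (2 * R), φ y = 0)
    (hAs : ∀ y ∉ Metric.closedBall p (2 * R), A y = 0)
    (bc : ∀ y ∈ frontier Ω, y ∈ Metric.ball p (4 * R) →
      φ y * dot3 (grad3 f y) (u y) = 0 ∧ dot3 (grad3 f y) (cross3 (A y) (u y)) = 0) :
    ∫ y in Ω, dot3 (u y) (curl3 A y - grad3 φ y) =
      ∫ y in Ω, (φ y * div3 u y + dot3 (A y) (curl3 u y)) := by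
  obtain ⟨Cφ, hCφ, hφb⟩ := exists_forall_norm_le_of_contDiff hφ
    (HasCompactSupport.intro (isCompact_closedBall p (2 * R)) hφs)
  obtain ⟨CA, hCA, hAb⟩ := exists_forall_norm_le_of_contDiff hA
    (HasCompactSupport.intro (isCompact_closedBall p (2 * R)) hAs)
  rcases Ω.eq_empty_or_nonempty with hemp | ⟨x0, hx0⟩
  · simp [hemp]
  have hB0 : 0 ≤ B0 := (norm_nonneg _).trans (hu.bound x0 hx0)
  have hB1 : 0 ≤ B1 := (norm_nonneg _).trans (hu.dbound x0 hx0)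
  have hφd : Differentiable ℝ φ := hφ.differentiable (by norm_num)
  have hAd : Differentiable ℝ A := hA.differentiable (by norm_num)
  set F : E3 → E3 := fun y => -(φ y • u y) + crossL (A y) (u y) with hF
  have hFd := fun x (hx : x ∈ Ω) => div3_neg_smul_add_cross (hφd x) (hAd x) (hu.diff x hx)
  have hcross : ∀ a b : E3, ‖crossL a b‖ ≤ ‖crossL‖ * ‖a‖ * ‖b‖ := fun a b =>
    crossL.le_opNorm₂ a b
  have hdiv0 : ∫ y in Ω, div3 F y = 0 := by
    refine h.integral_div3 hΩ hbd (B0 := Cφ * B0 + ‖crossL‖ * CA * B0)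
      (B1 := (Cφ * B1 + Cφ * B0) + (‖crossL‖ * CA * B1 + ‖crossL‖ * CA * B0))
      ?_ (fun x hx => (hFd x hx).1.differentiableAt) ?_ ?_ ?_ ?_
    · refine ((hφ.continuous.continuousOn.smul hu.cont).neg).add ?_
      exact (crossL.continuous.comp hA.continuous).continuousOn.clm_apply hu.cont
    · intro x hx
      have h1 := hu.bound x hx
      have h2 := (hφb x).1
      have h3 := (hAb x).1
      refine (norm_add_le _ _).trans (add_le_add ?_ ?_)
      · rw [norm_neg, norm_smul]; gcongr
      · refine (hcross _ _).trans ?_; gcongr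
    · intro x hx
      rw [(hFd x hx).1.fderiv]
      have h1 := hu.bound x hx
      have h2 := (hφb x).1
      have h3 := (hAb x).1
      have h4 := hu.dbound x hx
      have h5 := (hφb x).2
      have h6 := (hAb x).2
      refine (norm_add_le _ _).trans (add_le_add ?_ ?_)
      · rw [norm_neg]
        refine (norm_add_le _ _).trans (add_le_add ?_ ?_)
        · rw [norm_smul]; gcongr
        · rw [ContinuousLinearMap.norm_smulRight_apply]; gcongr
      · refine (norm_add_le _ _).trans (add_le_add ?_ ?_)
        · refine (ContinuousLinearMap.le_opNorm₂ _ _ _).trans ?_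
          gcongr
          exact crossL.norm_precompR_le E3
        · refine (ContinuousLinearMap.le_opNorm₂ _ _ _).trans ?_
          gcongr
          exact crossL.norm_precompL_le E3
    · intro y hy
      simp only [hF, hφs y hy, hAs y hy, map_zero, zero_smul, neg_zero, zero_apply, add_zero]
    · intro y hy hyb
      obtain ⟨h1, h2⟩ := bc y hy hyb
      rw [hF]
      simp only [map_add, map_neg, map_smul, smul_eq_mul, crossL_apply]
      rw [fderiv_eq_dot3, fderiv_eq_dot3, h1, h2]
      simp
  have : IsFiniteMeasure (volume.restrict Ω) := ⟨by simpa using hbd.measure_lt_top⟩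
  have hdOn : ContinuousOn u Ω := hu.cont.mono subset_closure
  have hum : AEStronglyMeasurable u (volume.restrict Ω) :=
    hdOn.aestronglyMeasurable hΩ.measurableSet
  have hdotm : ∀ {a b : E3 → E3}, AEStronglyMeasurable a (volume.restrict Ω) →
      AEStronglyMeasurable b (volume.restrict Ω) →
      AEStronglyMeasurable (fun y => dot3 (a y) (b y)) (volume.restrict Ω) := by
    intro a b ha hb
    have hc : Continuous fun q : E3 × E3 => dot3 q.1 q.2 := by unfold dot3; fun_prop
    exact hc.comp_aestronglyMeasurable (ha.prodMk hb)
  have hi1 : IntegrableOn (fun y => φ y * div3 u y + dot3 (A y) (curl3 u y)) Ω := by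
    refine Integrable.of_bound ?_ (Cφ * (3 * B1) + 3 * (CA * (2 * B1))) ?_
    · exact (hφ.continuous.aestronglyMeasurable.mul
        (measurable_div3 u).aestronglyMeasurable).add
        (hdotm hA.continuous.aestronglyMeasurable (measurable_curl3 u).aestronglyMeasurable)
    · filter_upwards [self_mem_ae_restrict hΩ.measurableSet] with y hy
      have h4 := hu.dbound y hy
      refine (norm_add_le _ _).trans (add_le_add ?_ ?_)
      · rw [norm_mul]
        exact mul_le_mul (hφb y).1 ((abs_div3_le (hu.diff y hy)).trans (by gcongr))
          (norm_nonneg _) hCφ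
      · refine (abs_dot3_le _ _).trans ?_
        gcongr
        · exact (hAb y).1
        · exact (norm_curl3_le (hu.diff y hy)).trans (by gcongr)
  have hi2 : IntegrableOn (fun y => dot3 (u y) (curl3 A y - grad3 φ y)) Ω := by
    refine Integrable.of_bound ?_ (3 * (B0 * (2 * CA + Cφ))) ?_
    · refine hdotm hum ((measurable_curl3 A).aestronglyMeasurable.sub ?_)
      exact (measurable_pi_iff.2 fun i =>
        measurable_fderiv_apply_const ℝ _ _ : Measurable (grad3 φ)).aestronglyMeasurable
    · filter_upwards [self_mem_ae_restrict hΩ.measurableSet] with y hy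
      refine (abs_dot3_le _ _).trans ?_
      gcongr
      · exact hu.bound y hy
      · refine (norm_sub_le _ _).trans (add_le_add ?_ ?_)
        · exact (norm_curl3_le (hAd y)).trans (mul_le_mul_of_nonneg_left (hAb y).2 (by norm_num))
        · refine (pi_norm_le_iff_of_nonneg hCφ).2 fun i => ?_
          refine (ContinuousLinearMap.le_opNorm _ _).trans ?_
          rw [Pi.norm_single, norm_one, mul_one]
          exact (hφb y).2
  have : ∫ y in Ω, div3 F y = ∫ y in Ω, (dot3 (u y) (curl3 A y - grad3 φ y) -
      (φ y * div3 u y + dot3 (A y) (curl3 u y))) :=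
    setIntegral_congr_fun hΩ.measurableSet fun y hy => (hFd y hy).2
  rw [this, integral_sub hi2 hi1] at hdiv0
  linarith

/-- The dot product as a continuous bilinear map. -/
def dotL : E3 →L[ℝ] E3 →L[ℝ] ℝ :=
  LinearMap.toContinuousBilinearMap (LinearMap.mk₂ ℝ dot3
    (fun a b c => by simp [dot3, add_mul, Finset.sum_add_distrib])
    (fun k a b => by simp [dot3, Finset.mul_sum, mul_assoc])
    (fun a b c => by simp [dot3, mul_add, Finset.sum_add_distrib])
    (fun k a b => by simp [dot3, Finset.mul_sum, mul_left_comm]))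

@[simp] theorem dotL_apply (a b : E3) : dotL a b = dot3 a b := rfl

theorem norm_sq_le_dot3 (z : E3) : ‖z‖ ^ 2 ≤ dot3 z z := by
  have h : ∀ i, z i ^ 2 ≤ dot3 z z := fun i => by
    rw [dot3, sq]
    exact Finset.single_le_sum (f := fun i => z i * z i) (fun i _ => mul_self_nonneg _)
      (Finset.mem_univ i)
  have h0 : 0 ≤ dot3 z z := (sq_nonneg _).trans (h 0)
  have : ‖z‖ ≤ Real.sqrt (dot3 z z) := by
    refine (pi_norm_le_iff_of_nonneg (Real.sqrt_nonneg _)).2 fun i => ?_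
    exact Real.abs_le_sqrt (h i)
  calc ‖z‖ ^ 2 ≤ Real.sqrt (dot3 z z) ^ 2 := by gcongr
    _ = _ := Real.sq_sqrt h0

theorem dot3_self_nonneg (z : E3) : 0 ≤ dot3 z z := (sq_nonneg _).trans (norm_sq_le_dot3 z)

theorem norm_dotL_le (z : E3) : ‖dotL z‖ ≤ 3 * ‖z‖ :=
  ContinuousLinearMap.opNorm_le_bound _ (by positivity) fun v => by
    rw [mul_assoc]; exact abs_dot3_le z v

/-- Regularized Euclidean norm. -/
def reg (δ : ℝ) (z : E3) : ℝ := Real.sqrt (dot3 z z + δ ^ 2)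

theorem reg_sq (δ : ℝ) (z : E3) : reg δ z ^ 2 = dot3 z z + δ ^ 2 :=
  Real.sq_sqrt (add_nonneg (dot3_self_nonneg z) (sq_nonneg δ))

theorem reg_pos {δ : ℝ} (hδ : 0 < δ) (z : E3) : 0 < reg δ z :=
  Real.sqrt_pos.2 (by have := dot3_self_nonneg z; positivity)

theorem norm_le_reg {δ : ℝ} (hδ : 0 < δ) (z : E3) : ‖z‖ ≤ reg δ z := by
  rw [← abs_of_nonneg (norm_nonneg z), ← abs_of_pos (reg_pos hδ z), ← sq_le_sq, reg_sq]
  have := norm_sq_le_dot3 z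
  nlinarith [sq_nonneg δ]

theorem continuous_dot3_self : ContDiff ℝ 2 fun z : E3 => dot3 z z := by
  unfold dot3; fun_prop

theorem contDiff_reg {δ : ℝ} (hδ : 0 < δ) : ContDiff ℝ 2 (reg δ) :=
  (continuous_dot3_self.add contDiff_const).sqrt fun z =>
    (by have := dot3_self_nonneg z; positivity : 0 < dot3 z z + δ ^ 2).ne'

theorem hasFDerivAt_reg {δ : ℝ} (hδ : 0 < δ) (z : E3) :
    HasFDerivAt (reg δ) ((reg δ z)⁻¹ • dotL z) z := by
  have h1 : HasFDerivAt (fun z : E3 => dotL z z) _ z :=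
    dotL.hasFDerivAt_of_bilinear (hasFDerivAt_id z) (hasFDerivAt_id z)
  have h2 := (h1.add_const (δ ^ 2)).sqrt (by
    have := dot3_self_nonneg z; simp only [dotL_apply]; positivity)
  refine h2.congr_fderiv ?_
  ext v
  change 1 / (2 * reg δ z) * (dot3 z v + dot3 v z) = (reg δ z)⁻¹ * dot3 z v
  rw [dot3_comm v z]
  have := (reg_pos hδ z).ne'
  field_simp
  ring

/-- Regularized Newtonian gradient kernel `z / |z|³`. -/
def kern (δ : ℝ) (z : E3) : E3 := (reg δ z ^ 3)⁻¹ • z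

/-- Derivative of `kern`. -/
def kernD (δ : ℝ) (z : E3) : E3 →L[ℝ] E3 :=
  (reg δ z ^ 3)⁻¹ • ContinuousLinearMap.id ℝ E3 -
    (3 * (reg δ z ^ 5)⁻¹) • (dotL z).smulRight z

theorem kernD_apply (δ : ℝ) (z v : E3) :
    kernD δ z v = (reg δ z ^ 3)⁻¹ • v - (3 * (reg δ z ^ 5)⁻¹ * dot3 z v) • z := by
  simp [kernD, smul_smul]

theorem contDiff_kern {δ : ℝ} (hδ : 0 < δ) : ContDiff ℝ 2 (kern δ) :=
  (((contDiff_reg hδ).pow 3).inv fun z => (pow_pos (reg_pos hδ z) 3).ne').smul contDiff_id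

theorem hasFDerivAt_kern {δ : ℝ} (hδ : 0 < δ) (z : E3) :
    HasFDerivAt (kern δ) (kernD δ z) z := by
  have hr := reg_pos hδ z
  have h0 : HasDerivAt (fun t : ℝ => (t ^ 3)⁻¹) _ (reg δ z) :=
    (hasDerivAt_pow 3 (reg δ z)).inv (pow_pos hr 3).ne'
  have h1 := h0.comp_hasFDerivAt z (hasFDerivAt_reg hδ z)
  have h2 := h1.smul (hasFDerivAt_id z)
  refine h2.congr_fderiv ?_
  ext v i
  simp [kernD_apply]
  field_simp
  ring

theorem norm_kern_le {δ : ℝ} (hδ : 0 < δ) (z : E3) : ‖kern δ z‖ ≤ (reg δ z ^ 2)⁻¹ := by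
  have hr := reg_pos hδ z
  rw [kern, norm_smul, norm_inv, norm_pow, Real.norm_eq_abs, abs_of_pos hr]
  calc _ ≤ (reg δ z ^ 3)⁻¹ * reg δ z :=
        mul_le_mul_of_nonneg_left (norm_le_reg hδ z) (by positivity)
    _ = _ := by field_simp

theorem norm_kernD_le {δ : ℝ} (hδ : 0 < δ) (z : E3) : ‖kernD δ z‖ ≤ 10 * (reg δ z ^ 3)⁻¹ := by
  have hr := reg_pos hδ z
  have hz := norm_le_reg hδ z
  refine (norm_sub_le _ _).trans ?_
  rw [norm_smul, norm_smul, ContinuousLinearMap.norm_smulRight_apply, Real.norm_of_nonneg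
    (by positivity), Real.norm_of_nonneg (by positivity)]
  calc _ ≤ (reg δ z ^ 3)⁻¹ * 1 + 3 * (reg δ z ^ 5)⁻¹ * (3 * reg δ z * reg δ z) := by
        gcongr
        · exact ContinuousLinearMap.norm_id_le
        · exact (norm_dotL_le z).trans (by gcongr)
    _ = _ := by field_simp; norm_num

/-- The curl of a linear map. -/
def curlOp (T : E3 →L[ℝ] E3) : E3 :=
  ![T (Pi.single 1 1) 2 - T (Pi.single 2 1) 1, T (Pi.single 2 1) 0 - T (Pi.single 0 1) 2,
    T (Pi.single 0 1) 1 - T (Pi.single 1 1) 0]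

/-- The gradient of a linear functional. -/
def gradOp (T : E3 →L[ℝ] ℝ) : E3 := fun i => T (Pi.single i 1)

theorem curl3_eq_curlOp {u : E3 → E3} {x : E3} (hu : DifferentiableAt ℝ u x) :
    curl3 u x = curlOp (fderiv ℝ u x) := by
  simp only [curl3, pd_component hu, curlOp]

theorem curlOp_add (S T : E3 →L[ℝ] E3) : curlOp (S + T) = curlOp S + curlOp T := by
  ext i; fin_cases i <;> simp [curlOp] <;> ring

theorem curlOp_neg (T : E3 →L[ℝ] E3) : curlOp (-T) = -curlOp T := by
  ext i; fin_cases i <;> simp [curlOp] <;> ring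

theorem curlOp_smul (c : ℝ) (T : E3 →L[ℝ] E3) : curlOp (c • T) = c • curlOp T := by
  ext i; fin_cases i <;> simp [curlOp] <;> ring

theorem gradOp_add (S T : E3 →L[ℝ] ℝ) : gradOp (S + T) = gradOp S + gradOp T := by
  ext i; simp [gradOp]

theorem gradOp_neg (T : E3 →L[ℝ] ℝ) : gradOp (-T) = -gradOp T := by
  ext i; simp [gradOp]

theorem gradOp_smul (c : ℝ) (T : E3 →L[ℝ] ℝ) : gradOp (c • T) = c • gradOp T := by
  ext i; simp [gradOp]

theorem norm_gradOp_le (T : E3 →L[ℝ] ℝ) : ‖gradOp T‖ ≤ ‖T‖ := by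
  refine (pi_norm_le_iff_of_nonneg (norm_nonneg _)).2 fun i => ?_
  refine (T.le_opNorm _).trans ?_
  rw [Pi.norm_single, norm_one, mul_one]

theorem norm_curlOp_le (T : E3 →L[ℝ] E3) : ‖curlOp T‖ ≤ 2 * ‖T‖ := by
  have := norm_curl3_le (u := T) (x := 0) T.differentiableAt
  rwa [curl3_eq_curlOp T.differentiableAt, T.fderiv] at this

/-- `curl (g × a) = (a · ∇) g - (div g) a` for the regularized kernel. -/
theorem curlOp_cross_kernD {δ : ℝ} (hδ : 0 < δ) (z a : E3) :
    curlOp ((crossL.flip a).comp (kernD δ z)) =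
      kernD δ z a - (3 * δ ^ 2 * (reg δ z ^ 5)⁻¹) • a := by
  have hr := (reg_pos hδ z).ne'
  have h2 : δ ^ 2 = reg δ z ^ 2 - dot3 z z := by rw [reg_sq]; ring
  rw [h2, dot3]
  ext i
  fin_cases i <;>
    simp [curlOp, kernD_apply, cross3, dot3, Fin.sum_univ_three] <;> field_simp <;> ring

theorem gradOp_dot_kernD (δ : ℝ) (z a : E3) :
    gradOp ((dotL a).comp (kernD δ z)) = kernD δ z a := by
  ext i
  fin_cases i <;> simp [gradOp, kernD_apply, dot3, Fin.sum_univ_three] <;> ring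

/-- `gradOp` as a continuous linear map. -/
def gradL : (E3 →L[ℝ] ℝ) →L[ℝ] E3 :=
  LinearMap.toContinuousLinearMap
    { toFun := gradOp, map_add' := gradOp_add, map_smul' := gradOp_smul }

@[simp] theorem gradL_apply (T : E3 →L[ℝ] ℝ) : gradL T = gradOp T := rfl

/-- Straightening map `y ↦ y - x + (f y - f x - Df x (y - x)) w + k`. -/
def srcZ (f : E3 → ℝ) (x w k y : E3) : E3 :=
  (y - x) + (f y - f x - fderiv ℝ f x (y - x)) • w + k

/-- Scalar potential of a source. -/
def srcPhi (δ : ℝ) (f : E3 → ℝ) (x w k a y : E3) : ℝ := -dotL a (kern δ (srcZ f x w k y))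

/-- Untransformed vector potential of a source. -/
def srcV (δ : ℝ) (f : E3 → ℝ) (x w k a y : E3) : E3 := crossL.flip a (kern δ (srcZ f x w k y))

/-- Vector potential of a source. -/
def srcA (δ : ℝ) (f : E3 → ℝ) (x w k a y : E3) : E3 :=
  -(srcV δ f x w k a y + dotL w (srcV δ f x w k a y) • gradL (fderiv ℝ f y - fderiv ℝ f x))

theorem contDiff_srcZ {f : E3 → ℝ} (hf : ContDiff ℝ 2 f) (x w k : E3) :
    ContDiff ℝ 2 (srcZ f x w k) := by
  unfold srcZ
  have h : ContDiff ℝ 2 (fun y => f y - f x - fderiv ℝ f x (y - x)) :=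
    (hf.sub contDiff_const).sub ((fderiv ℝ f x).contDiff.comp (by fun_prop))
  have h' : ContDiff ℝ 2 (fun y => (f y - f x - fderiv ℝ f x (y - x)) • w) :=
    h.smul contDiff_const
  exact ((contDiff_id.sub contDiff_const).add h').add contDiff_const

theorem hasFDerivAt_srcZ {f : E3 → ℝ} (hf : ContDiff ℝ 2 f) (x w k y : E3) :
    HasFDerivAt (srcZ f x w k)
      (ContinuousLinearMap.id ℝ E3 + (fderiv ℝ f y - fderiv ℝ f x).smulRight w) y := by
  have h1 : HasFDerivAt (fun y => y - x) (ContinuousLinearMap.id ℝ E3) y :=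
    (hasFDerivAt_id y).sub_const x
  have h2 : HasFDerivAt (fun y => f y - f x - fderiv ℝ f x (y - x))
      (fderiv ℝ f y - (fderiv ℝ f x).comp (ContinuousLinearMap.id ℝ E3)) y :=
    (((hf.differentiable (by norm_num)) y).hasFDerivAt.sub_const (f x)).sub
      ((fderiv ℝ f x).hasFDerivAt.comp y h1)
  exact (h1.add (h2.smul_const w)).add_const k

theorem contDiff_fderiv_one {f : E3 → ℝ} (hf : ContDiff ℝ 2 f) :
    ContDiff ℝ 1 (fderiv ℝ f) :=
  hf.fderiv_right (by norm_num)

theorem curlOp_gradL_fderiv_fderiv {f : E3 → ℝ} (hf : ContDiff ℝ 2 f) (y : E3) :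
    curlOp (gradL.comp (fderiv ℝ (fderiv ℝ f) y)) = 0 := by
  have h := (hf.contDiffAt (x := y)).isSymmSndFDerivAt (by simp)
  ext i
  fin_cases i <;> simp [curlOp, gradOp] <;> rw [h.eq] <;> ring

theorem contDiff_srcPhi {f : E3 → ℝ} (hf : ContDiff ℝ 2 f) {δ : ℝ} (hδ : 0 < δ) (x w k a : E3) :
    ContDiff ℝ 1 (srcPhi δ f x w k a) :=
  (((dotL a).contDiff.comp ((contDiff_kern hδ).comp (contDiff_srcZ hf x w k))).neg).of_le
    (by norm_num)

theorem contDiff_srcV {f : E3 → ℝ} (hf : ContDiff ℝ 2 f) {δ : ℝ} (hδ : 0 < δ) (x w k a : E3) :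
    ContDiff ℝ 1 (srcV δ f x w k a) :=
  ((crossL.flip a).contDiff.comp ((contDiff_kern hδ).comp (contDiff_srcZ hf x w k))).of_le
    (by norm_num)

theorem contDiff_srcA {f : E3 → ℝ} (hf : ContDiff ℝ 2 f) {δ : ℝ} (hδ : 0 < δ) (x w k a : E3) :
    ContDiff ℝ 1 (srcA δ f x w k a) :=
  ((contDiff_srcV hf hδ x w k a).add (((dotL w).contDiff.comp (contDiff_srcV hf hδ x w k a)).smul
    (gradL.contDiff.comp ((contDiff_fderiv_one hf).sub contDiff_const)))).neg

set_option maxHeartbeats 1000000 in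
theorem exists_source_estimates {L W D A0 : ℝ} (hL : 0 ≤ L) (hW : 0 ≤ W) (hD : 0 ≤ D)
    (hA0 : 0 ≤ A0) : ∃ C, 0 ≤ C ∧ ∀ (f : E3 → ℝ) (δ : ℝ) (x w k a y : E3) (r : ℝ),
    ContDiff ℝ 2 f → 0 < δ → 0 < r → r ≤ D → r / 2 ≤ reg δ (srcZ f x w k y) → ‖w‖ ≤ W → ‖a‖ ≤ A0 →
    ‖fderiv ℝ f y - fderiv ℝ f x‖ ≤ L * r → ‖fderiv ℝ (fderiv ℝ f) y‖ ≤ L →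
    |srcPhi δ f x w k a y| ≤ C * (r ^ 2)⁻¹ ∧ ‖srcA δ f x w k a y‖ ≤ C * (r ^ 2)⁻¹ ∧
    ‖fderiv ℝ (srcPhi δ f x w k a) y‖ ≤ C * (r ^ 3)⁻¹ ∧
    ‖fderiv ℝ (srcA δ f x w k a) y‖ ≤ C * (r ^ 3)⁻¹ ∧
    ‖curlOp (fderiv ℝ (srcA δ f x w k a) y) - gradOp (fderiv ℝ (srcPhi δ f x w k a) y) -
      (3 * δ ^ 2 * (reg δ (srcZ f x w k y) ^ 5)⁻¹) • a‖ ≤ C * (r ^ 2)⁻¹ := by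
  obtain ⟨T0, hT0⟩ : ∃ T0 : ℝ, T0 = 1 + L * D * W := ⟨_, rfl⟩
  obtain ⟨cP, hcP⟩ : ∃ cP : ℝ, cP = ‖dotL‖ * A0 * 4 := ⟨_, rfl⟩
  obtain ⟨cV, hcV⟩ : ∃ cV : ℝ, cV = ‖crossL‖ * A0 * 4 := ⟨_, rfl⟩
  obtain ⟨cA, hcA⟩ : ∃ cA : ℝ, cA = cV + ‖dotL‖ * W * cV * (L * D) := ⟨_, rfl⟩
  obtain ⟨dP, hdP⟩ : ∃ dP : ℝ, dP = ‖dotL‖ * A0 * (80 * T0) := ⟨_, rfl⟩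
  obtain ⟨dV, hdV⟩ : ∃ dV : ℝ, dV = ‖crossL‖ * A0 * (80 * T0) := ⟨_, rfl⟩
  obtain ⟨dA, hdA⟩ : ∃ dA : ℝ, dA = dV + (‖dotL‖ * W * cV * D * L + ‖dotL‖ * W * dV * (L * D)) := ⟨_, rfl⟩
  obtain ⟨e1, he1⟩ : ∃ e1 : ℝ, e1 = ‖dotL‖ * A0 * (80 * (L * W)) := ⟨_, rfl⟩
  obtain ⟨e2, he2⟩ : ∃ e2 : ℝ, e2 = 2 * (‖crossL‖ * A0 * (80 * (L * W))) := ⟨_, rfl⟩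
  obtain ⟨e3, he3⟩ : ∃ e3 : ℝ, e3 = 2 * (‖dotL‖ * W * dV * L) := ⟨_, rfl⟩
  have p1 : 0 ≤ T0 := by rw [hT0]; positivity
  have p2 : 0 ≤ cP := by rw [hcP]; positivity
  have p3 : 0 ≤ cV := by rw [hcV]; positivity
  have p4 : 0 ≤ cA := by rw [hcA]; positivity
  have p5 : 0 ≤ dP := by rw [hdP]; positivity
  have p6 : 0 ≤ dV := by rw [hdV]; positivity
  have p7 : 0 ≤ dA := by rw [hdA]; positivity
  have p8 : 0 ≤ e1 := by rw [he1]; positivity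
  have p9 : 0 ≤ e2 := by rw [he2]; positivity
  have p10 : 0 ≤ e3 := by rw [he3]; positivity
  obtain ⟨C, hC⟩ : ∃ C : ℝ, C = cP + cA + dP + dA + (e1 + e2 + e3) := ⟨_, rfl⟩
  refine ⟨C, by rw [hC]; positivity, ?_⟩
  intro f δ x w k a y r hf hδ hr hrD hreg hw ha hβ hB
  set z := srcZ f x w k y with hz
  set β := fderiv ℝ f y - fderiv ℝ f x with hβdef
  set B := fderiv ℝ (fderiv ℝ f) y with hBdef
  have hrp := reg_pos hδ z
  have hg : ‖kern δ z‖ ≤ 4 * (r ^ 2)⁻¹ := by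
    refine (norm_kern_le hδ z).trans ?_
    calc (reg δ z ^ 2)⁻¹ ≤ ((r / 2) ^ 2)⁻¹ := by gcongr
      _ = _ := by field_simp; norm_num
  have hH : ‖kernD δ z‖ ≤ 80 * (r ^ 3)⁻¹ := by
    refine (norm_kernD_le hδ z).trans ?_
    calc 10 * (reg δ z ^ 3)⁻¹ ≤ 10 * ((r / 2) ^ 3)⁻¹ := by gcongr
      _ = _ := by field_simp; norm_num
  set S : E3 →L[ℝ] E3 := β.smulRight w with hS
  have hSn : ‖S‖ ≤ L * r * W := by
    rw [hS, ContinuousLinearMap.norm_smulRight_apply]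
    gcongr
  set T : E3 →L[ℝ] E3 := ContinuousLinearMap.id ℝ E3 + S with hT
  have hTn : ‖T‖ ≤ T0 := by
    rw [hT0]
    refine (norm_add_le _ _).trans (add_le_add ContinuousLinearMap.norm_id_le (hSn.trans ?_))
    gcongr
  have hZ : HasFDerivAt (srcZ f x w k) T y := hasFDerivAt_srcZ hf x w k y
  have hK := (hasFDerivAt_kern hδ z).comp y hZ
  have hda : ‖dotL a‖ ≤ ‖dotL‖ * A0 := (dotL.le_opNorm a).trans (by gcongr)
  have hdw : ‖dotL w‖ ≤ ‖dotL‖ * W := (dotL.le_opNorm w).trans (by gcongr)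
  have hca : ‖crossL.flip a‖ ≤ ‖crossL‖ * A0 := by
    refine (crossL.flip.le_opNorm a).trans ?_
    rw [ContinuousLinearMap.opNorm_flip]
    gcongr
  have hHT : ‖(kernD δ z).comp T‖ ≤ 80 * (r ^ 3)⁻¹ * T0 :=
    (ContinuousLinearMap.opNorm_comp_le _ _).trans (by gcongr)
  have hHS : ‖(kernD δ z).comp S‖ ≤ 80 * (r ^ 3)⁻¹ * (L * r * W) :=
    (ContinuousLinearMap.opNorm_comp_le _ _).trans (by gcongr)
  -- derivatives
  set P' := (dotL a).comp ((kernD δ z).comp T) with hP'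
  set V' := (crossL.flip a).comp ((kernD δ z).comp T) with hV'
  have hPhi : HasFDerivAt (srcPhi δ f x w k a) (-P') y :=
    ((dotL a).hasFDerivAt.comp y hK).neg
  have hV : HasFDerivAt (srcV δ f x w k a) V' y := (crossL.flip a).hasFDerivAt.comp y hK
  have hGr : HasFDerivAt (fun y => gradL (fderiv ℝ f y - fderiv ℝ f x)) (gradL.comp B) y :=
    gradL.hasFDerivAt.comp y ((((contDiff_fderiv_one hf).differentiable
      (by norm_num)) y).hasFDerivAt.sub_const _)
  set v := srcV δ f x w k a y with hv
  have hA : HasFDerivAt (srcA δ f x w k a)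
      (-(V' + (dotL w v • gradL.comp B + ((dotL w).comp V').smulRight (gradL β)))) y :=
    (hV.add (((dotL w).hasFDerivAt.comp y hV).smul hGr)).neg
  -- sizes
  have hvn : ‖v‖ ≤ cV * (r ^ 2)⁻¹ := by
    refine ((crossL.flip a).le_opNorm _).trans ?_
    calc _ ≤ ‖crossL‖ * A0 * (4 * (r ^ 2)⁻¹) := by gcongr
      _ = _ := by rw [hcV]; ring
  have hwv : ‖dotL w v‖ ≤ ‖dotL‖ * W * (cV * (r ^ 2)⁻¹) :=
    ((dotL w).le_opNorm _).trans (by gcongr)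
  have hgβ : ‖gradL β‖ ≤ L * r := (norm_gradOp_le β).trans hβ
  have hgB : ‖gradL.comp B‖ ≤ L := by
    refine ContinuousLinearMap.opNorm_le_bound _ hL fun u => ?_
    refine (norm_gradOp_le _).trans ((B.le_opNorm u).trans (by gcongr))
  have hP'n : ‖P'‖ ≤ dP * (r ^ 3)⁻¹ := by
    refine (ContinuousLinearMap.opNorm_comp_le _ _).trans ?_
    calc _ ≤ ‖dotL‖ * A0 * (80 * (r ^ 3)⁻¹ * T0) := by gcongr
      _ = _ := by rw [hdP]; ring
  have hV'n : ‖V'‖ ≤ dV * (r ^ 3)⁻¹ := by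
    refine (ContinuousLinearMap.opNorm_comp_le _ _).trans ?_
    calc _ ≤ ‖crossL‖ * A0 * (80 * (r ^ 3)⁻¹ * T0) := by gcongr
      _ = _ := by rw [hdV]; ring
  have hwV' : ‖(dotL w).comp V'‖ ≤ ‖dotL‖ * W * (dV * (r ^ 3)⁻¹) :=
    (ContinuousLinearMap.opNorm_comp_le _ _).trans (by gcongr)
  have hr2 : 0 ≤ (r ^ 2)⁻¹ := by positivity
  have hr3 : 0 ≤ (r ^ 3)⁻¹ := by positivity
  have hr23 : (r ^ 2)⁻¹ = r * (r ^ 3)⁻¹ := by field_simp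
  have hr23' : (r ^ 2)⁻¹ ≤ D * (r ^ 3)⁻¹ := by rw [hr23]; gcongr
  have hlast : ‖((dotL w).comp V').smulRight (gradL β)‖ ≤
      ‖dotL‖ * W * (dV * (r ^ 3)⁻¹) * (L * r) := by
    rw [ContinuousLinearMap.norm_smulRight_apply]
    exact mul_le_mul hwV' hgβ (norm_nonneg _) (by positivity)
  refine ⟨?_, ?_, ?_, ?_, ?_⟩
  · have : |srcPhi δ f x w k a y| ≤ cP * (r ^ 2)⁻¹ := by
      rw [srcPhi, abs_neg]
      refine ((dotL a).le_opNorm _).trans ?_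
      calc _ ≤ ‖dotL‖ * A0 * (4 * (r ^ 2)⁻¹) := by gcongr
        _ = _ := by rw [hcP]; ring
    refine this.trans (mul_le_mul_of_nonneg_right ?_ hr2)
    rw [hC]; linarith
  · have : ‖srcA δ f x w k a y‖ ≤ cA * (r ^ 2)⁻¹ := by
      rw [srcA, norm_neg]
      refine (norm_add_le _ _).trans ?_
      rw [norm_smul]
      calc _ ≤ cV * (r ^ 2)⁻¹ + ‖dotL‖ * W * (cV * (r ^ 2)⁻¹) * (L * D) := by
            refine add_le_add hvn (mul_le_mul hwv (hgβ.trans ?_) (norm_nonneg _) (by positivity))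
            gcongr
        _ = _ := by rw [hcA]; ring
    refine this.trans (mul_le_mul_of_nonneg_right ?_ hr2)
    rw [hC]; linarith
  · rw [hPhi.fderiv, norm_neg]
    refine hP'n.trans (mul_le_mul_of_nonneg_right ?_ hr3)
    rw [hC]; linarith
  · have : ‖fderiv ℝ (srcA δ f x w k a) y‖ ≤ dA * (r ^ 3)⁻¹ := by
      rw [hA.fderiv, norm_neg]
      refine (norm_add_le _ _).trans ?_
      calc _ ≤ dV * (r ^ 3)⁻¹ + (‖dotL‖ * W * (cV * (D * (r ^ 3)⁻¹)) * L +
            ‖dotL‖ * W * (dV * (r ^ 3)⁻¹) * (L * D)) := by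
            refine add_le_add hV'n ((norm_add_le _ _).trans (add_le_add ?_ (hlast.trans ?_)))
            · rw [norm_smul]
              refine mul_le_mul (hwv.trans ?_) hgB (norm_nonneg _) (by positivity)
              gcongr
            · gcongr
        _ = _ := by rw [hdA]; ring
    refine this.trans (mul_le_mul_of_nonneg_right ?_ hr3)
    rw [hC]; linarith
  · rw [hA.fderiv, hPhi.fderiv]
    have hV'split : V' = (crossL.flip a).comp (kernD δ z) +
        (crossL.flip a).comp ((kernD δ z).comp S) := by
      rw [hV', hT]; ext u; simp
    have hP'split : P' = (dotL a).comp (kernD δ z) + (dotL a).comp ((kernD δ z).comp S) := by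
      rw [hP', hT]; ext u; simp
    have hid : curlOp (-(V' + (dotL w v • gradL.comp B +
        ((dotL w).comp V').smulRight (gradL β)))) - gradOp (-P') -
        (3 * δ ^ 2 * (reg δ z ^ 5)⁻¹) • a =
        gradOp ((dotL a).comp ((kernD δ z).comp S)) -
          curlOp ((crossL.flip a).comp ((kernD δ z).comp S)) -
          curlOp (((dotL w).comp V').smulRight (gradL β)) := by
      rw [curlOp_neg, curlOp_add, curlOp_add, curlOp_smul, curlOp_gradL_fderiv_fderiv hf,
        gradOp_neg]
      nth_rewrite 1 [hV'split]
      rw [hP'split, curlOp_add, gradOp_add, curlOp_cross_kernD hδ, gradOp_dot_kernD]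
      module
    rw [hid]
    have b1 : ‖gradOp ((dotL a).comp ((kernD δ z).comp S))‖ ≤ e1 * (r ^ 2)⁻¹ := by
      refine (norm_gradOp_le _).trans ((ContinuousLinearMap.opNorm_comp_le _ _).trans ?_)
      calc _ ≤ ‖dotL‖ * A0 * (80 * (r ^ 3)⁻¹ * (L * r * W)) := by gcongr
        _ = _ := by rw [he1, hr23]; ring
    have b2 : ‖curlOp ((crossL.flip a).comp ((kernD δ z).comp S))‖ ≤ e2 * (r ^ 2)⁻¹ := by
      refine (norm_curlOp_le _).trans ?_
      calc _ ≤ 2 * (‖crossL‖ * A0 * (80 * (r ^ 3)⁻¹ * (L * r * W))) := by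
            gcongr
            exact (ContinuousLinearMap.opNorm_comp_le _ _).trans (by gcongr)
        _ = _ := by rw [he2, hr23]; ring
    have b3 : ‖curlOp (((dotL w).comp V').smulRight (gradL β))‖ ≤ e3 * (r ^ 2)⁻¹ := by
      refine (norm_curlOp_le _).trans ?_
      calc _ ≤ 2 * (‖dotL‖ * W * (dV * (r ^ 3)⁻¹) * (L * r)) := by gcongr
        _ = _ := by rw [he3, hr23]; ring
    calc _ ≤ e1 * (r ^ 2)⁻¹ + e2 * (r ^ 2)⁻¹ + e3 * (r ^ 2)⁻¹ :=
          (norm_sub_le _ _).trans (add_le_add ((norm_sub_le _ _).trans (add_le_add b1 b2)) b3)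
      _ = (e1 + e2 + e3) * (r ^ 2)⁻¹ := by ring
      _ ≤ _ := mul_le_mul_of_nonneg_right (by rw [hC]; linarith) hr2

/-- The gradient of `f` at `x` divided by its squared Euclidean length. -/
def chartW (f : E3 → ℝ) (x : E3) : E3 := (dot3 (grad3 f x) (grad3 f x))⁻¹ • grad3 f x

/-- Reflection across the plane orthogonal to the gradient of `f` at `x`. -/
def chartS (f : E3 → ℝ) (x a : E3) : E3 := a - (2 * dot3 (grad3 f x) a) • chartW f x

/-- Displacement of the image source. -/
def chartK (f : E3 → ℝ) (x : E3) : E3 := (2 * f x) • chartW f x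

theorem dot3_add_left (a b c : E3) : dot3 (a + b) c = dot3 a c + dot3 b c := by
  simp [dot3, Fin.sum_univ_three]; ring

theorem dot3_add_right (a b c : E3) : dot3 a (b + c) = dot3 a b + dot3 a c := by
  simp [dot3, Fin.sum_univ_three]; ring

theorem dot3_smul_right (a b : E3) (k : ℝ) : dot3 a (k • b) = k * dot3 a b := by
  simp [dot3, Fin.sum_univ_three]; ring

theorem dot3_sub_right (a b c : E3) : dot3 a (b - c) = dot3 a b - dot3 a c := by
  simp [dot3, Fin.sum_univ_three]; ring

theorem dot3_sub_left (a b c : E3) : dot3 (a - b) c = dot3 a c - dot3 b c := by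
  simp [dot3, Fin.sum_univ_three]; ring

section
variable {f : E3 → ℝ} {x : E3}

theorem dot3_grad3_chartW (hm : 0 < dot3 (grad3 f x) (grad3 f x)) :
    dot3 (grad3 f x) (chartW f x) = 1 := by
  rw [chartW, dot3_smul_right, inv_mul_cancel₀ hm.ne']

theorem dot3_chartW (a : E3) :
    dot3 (chartW f x) a = (dot3 (grad3 f x) (grad3 f x))⁻¹ * dot3 (grad3 f x) a := by
  rw [chartW, dot3_smul_left]

theorem dot3_chartS_chartS (hm : 0 < dot3 (grad3 f x) (grad3 f x)) (a b : E3) :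
    dot3 (chartS f x a) (chartS f x b) = dot3 a b := by
  have h1 := dot3_grad3_chartW hm
  simp only [chartS, dot3_sub_left, dot3_sub_right, dot3_smul_left, dot3_smul_right, dot3_chartW,
    h1, dot3_comm a (chartW f x)]
  ring

theorem cross3_chartS_chartS (hm : 0 < dot3 (grad3 f x) (grad3 f x)) (a b : E3) :
    cross3 (chartS f x a) (chartS f x b) = -chartS f x (cross3 a b) := by
  have hd := inv_mul_cancel₀ hm.ne'
  simp only [chartS, chartW]
  generalize grad3 f x = G at *
  generalize (dot3 G G)⁻¹ = d at *
  simp only [dot3, Fin.sum_univ_three] at hd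
  funext i
  simp only [cross3, dot3, Fin.sum_univ_three, Pi.neg_apply, Pi.sub_apply, Pi.smul_apply,
    smul_eq_mul]
  fin_cases i
  · simp only [Fin.zero_eta, Matrix.cons_val]
    linear_combination (-2 * (a 1 * b 2 - a 2 * b 1)) * hd
  · simp only [Fin.mk_one, Matrix.cons_val]
    linear_combination (-2 * (a 2 * b 0 - a 0 * b 2)) * hd
  · simp only [Fin.reduceFinMk, Matrix.cons_val]
    linear_combination (-2 * (a 0 * b 1 - a 1 * b 0)) * hd

theorem dot3_grad3_srcZ_zero (hm : 0 < dot3 (grad3 f x) (grad3 f x)) (y : E3) :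
    dot3 (grad3 f x) (srcZ f x (chartW f x) 0 y) = f y - f x := by
  rw [srcZ, add_zero, dot3_add_right, dot3_smul_right, dot3_grad3_chartW hm, fderiv_eq_dot3]
  ring

theorem srcZ_chartK (y : E3) :
    srcZ f x (chartW f x) (chartK f x) y = srcZ f x (chartW f x) 0 y + (2 * f x) • chartW f x := by
  simp [srcZ, chartK]

theorem srcZ_chartK_eq_chartS (hm : 0 < dot3 (grad3 f x) (grad3 f x)) {y : E3} (hy : f y = 0) :
    srcZ f x (chartW f x) (chartK f x) y = chartS f x (srcZ f x (chartW f x) 0 y) := by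
  rw [srcZ_chartK, chartS, dot3_grad3_srcZ_zero hm, hy]
  module

theorem dot3_grad3_srcZ_chartK (hm : 0 < dot3 (grad3 f x) (grad3 f x)) (y : E3) :
    dot3 (grad3 f x) (srcZ f x (chartW f x) (chartK f x) y) = f y + f x := by
  rw [srcZ_chartK, dot3_add_right, dot3_smul_right, dot3_grad3_chartW hm, dot3_grad3_srcZ_zero hm]
  ring

theorem dot3_srcZ_chartK (hm : 0 < dot3 (grad3 f x) (grad3 f x)) (y : E3) :
    dot3 (srcZ f x (chartW f x) (chartK f x) y) (srcZ f x (chartW f x) (chartK f x) y) =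
      dot3 (srcZ f x (chartW f x) 0 y) (srcZ f x (chartW f x) 0 y) +
        4 * (dot3 (grad3 f x) (grad3 f x))⁻¹ * (f x * f y) := by
  rw [srcZ_chartK]
  have h := dot3_grad3_srcZ_zero hm y
  generalize srcZ f x (chartW f x) 0 y = z at *
  simp only [dot3_add_left, dot3_add_right, dot3_smul_left, dot3_smul_right, dot3_chartW,
    dot3_grad3_chartW hm, dot3_comm z (chartW f x), h]
  ring

theorem reg_srcZ_le_reg_srcZ_chartK (hm : 0 < dot3 (grad3 f x) (grad3 f x)) (δ : ℝ) {y : E3}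
    (hy : 0 ≤ f x * f y) :
    reg δ (srcZ f x (chartW f x) 0 y) ≤ reg δ (srcZ f x (chartW f x) (chartK f x) y) := by
  unfold reg
  refine Real.sqrt_le_sqrt ?_
  rw [dot3_srcZ_chartK hm]
  have : 0 ≤ 4 * (dot3 (grad3 f x) (grad3 f x))⁻¹ * (f x * f y) := by positivity
  linarith

end

namespace IsChart

variable {Ω : Set E3} {f : E3 → ℝ} {p : E3} {R M L : ℝ} {n : E3} {x : E3}

theorem one_le_norm_grad (h : IsChart Ω f p R M L n) (hx : x ∈ Metric.ball p (4 * R)) :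
    1 ≤ ‖grad3 f x‖ * (3 * ‖n‖) := by
  have h1 := h.one_le x hx
  rw [fderiv_eq_dot3] at h1
  have := (le_abs_self _).trans (abs_dot3_le (grad3 f x) n)
  linarith

theorem norm_grad_pos (h : IsChart Ω f p R M L n) (hx : x ∈ Metric.ball p (4 * R)) :
    0 < ‖grad3 f x‖ := by
  by_contra h0
  have := h.one_le_norm_grad hx
  rw [le_antisymm (not_lt.1 h0) (norm_nonneg _), zero_mul] at this
  linarith

theorem dot3_grad_pos (h : IsChart Ω f p R M L n) (hx : x ∈ Metric.ball p (4 * R)) :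
    0 < dot3 (grad3 f x) (grad3 f x) :=
  lt_of_lt_of_le (pow_pos (h.norm_grad_pos hx) 2) (norm_sq_le_dot3 _)

theorem norm_grad_mul_norm_chartW_le (h : IsChart Ω f p R M L n)
    (hx : x ∈ Metric.ball p (4 * R)) : ‖grad3 f x‖ * ‖chartW f x‖ ≤ 1 := by
  have hm := h.dot3_grad_pos hx
  rw [chartW, norm_smul, norm_inv, Real.norm_eq_abs, abs_of_pos hm]
  have := norm_sq_le_dot3 (grad3 f x)
  rw [← mul_assoc, mul_comm, ← mul_assoc, ← pow_two, ← div_eq_mul_inv]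
  exact div_le_one_of_le₀ this hm.le

theorem norm_chartW_le (h : IsChart Ω f p R M L n)
    (hx : x ∈ Metric.ball p (4 * R)) : ‖chartW f x‖ ≤ 3 * ‖n‖ := by
  have h1 := h.norm_grad_mul_norm_chartW_le hx
  have h2 := h.one_le_norm_grad hx
  have h3 := h.norm_grad_pos hx
  nlinarith

theorem norm_chartS_le (h : IsChart Ω f p R M L n)
    (hx : x ∈ Metric.ball p (4 * R)) (a : E3) : ‖chartS f x a‖ ≤ 7 * ‖a‖ := by
  rw [chartS]
  refine (norm_sub_le _ _).trans ?_
  rw [norm_smul, norm_mul, Real.norm_eq_abs, Real.norm_eq_abs, abs_of_pos (by norm_num : (0:ℝ) < 2)]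
  have h1 := h.norm_grad_mul_norm_chartW_le hx
  have h2 := abs_dot3_le (grad3 f x) a
  have h3 : |dot3 (grad3 f x) a| * ‖chartW f x‖ ≤ 3 * ‖a‖ := by
    calc _ ≤ 3 * (‖grad3 f x‖ * ‖a‖) * ‖chartW f x‖ := by gcongr
      _ = 3 * ‖a‖ * (‖grad3 f x‖ * ‖chartW f x‖) := by ring
      _ ≤ 3 * ‖a‖ * 1 := by gcongr
      _ = _ := by ring
  linarith

theorem abs_taylor_le (h : IsChart Ω f p R M L n) (hx : x ∈ Metric.ball p (4 * R)) {y : E3}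
    (hy : y ∈ Metric.ball p (4 * R)) :
    |f y - f x - fderiv ℝ f x (y - x)| ≤ L * ‖y - x‖ * ‖y - x‖ := by
  have hseg : segment ℝ x y ⊆ Metric.ball p (4 * R) := (convex_ball p (4 * R)).segment_subset hx hy
  refine (convex_segment x y).norm_image_sub_le_of_norm_hasFDerivWithin_le'
    (fun z _ => (h.differentiable z).hasFDerivAt.hasFDerivWithinAt) (fun z hz => ?_)
    (left_mem_segment ℝ x y) (right_mem_segment ℝ x y)
  refine (h.lip z (hseg hz) x hx).trans ?_
  have : ‖z - x‖ ≤ ‖y - x‖ := by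
    obtain ⟨t, ht, rfl⟩ := (segment_eq_image' ℝ x y ▸ hz)
    rw [add_sub_cancel_left, norm_smul, Real.norm_eq_abs, abs_of_nonneg ht.1]
    exact mul_le_of_le_one_left (norm_nonneg _) ht.2
  have := h.L_nonneg
  gcongr

theorem norm_srcZ_sub_le (h : IsChart Ω f p R M L n) (hs : 20 * L * ‖n‖ * R ≤ 1)
    (hx : x ∈ Metric.ball p R) {y : E3} (hy : y ∈ Metric.closedBall p (2 * R)) :
    ‖srcZ f x (chartW f x) 0 y - (y - x)‖ ≤ ‖y - x‖ / 2 := by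
  have hR := h.pos
  have hx4 : x ∈ Metric.ball p (4 * R) := Metric.ball_subset_ball (by linarith) hx
  have hy4 : y ∈ Metric.ball p (4 * R) :=
    lt_of_le_of_lt (Metric.mem_closedBall.1 hy) (by linarith)
  have hyx : ‖y - x‖ ≤ 3 * R := by
    rw [← dist_eq_norm]
    have := dist_triangle_right y x p
    have h1 : dist x p < R := hx
    have h2 : dist y p ≤ 2 * R := hy
    linarith
  rw [srcZ, add_zero, add_sub_cancel_left, norm_smul]
  have hL := h.L_nonneg
  calc _ ≤ L * ‖y - x‖ * ‖y - x‖ * (3 * ‖n‖) := by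
        gcongr
        · exact h.abs_taylor_le hx4 hy4
        · exact h.norm_chartW_le hx4
    _ ≤ L * (3 * R) * ‖y - x‖ * (3 * ‖n‖) := by gcongr
    _ = (9 / 20) * (20 * L * ‖n‖ * R) * ‖y - x‖ := by ring
    _ ≤ (9 / 20) * 1 * ‖y - x‖ := by gcongr
    _ ≤ _ := by linarith [norm_nonneg (y - x)]

theorem half_le_norm_srcZ (h : IsChart Ω f p R M L n) (hs : 20 * L * ‖n‖ * R ≤ 1)
    (hx : x ∈ Metric.ball p R) {y : E3} (hy : y ∈ Metric.closedBall p (2 * R)) :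
    ‖y - x‖ / 2 ≤ ‖srcZ f x (chartW f x) 0 y‖ := by
  have h1 := h.norm_srcZ_sub_le hs hx hy
  have h2 := norm_sub_norm_le (y - x) (srcZ f x (chartW f x) 0 y)
  rw [norm_sub_rev (y - x) (srcZ f x _ 0 y)] at h2
  linarith

theorem norm_fderiv_fderiv_le (h : IsChart Ω f p R M L n) (hx : x ∈ Metric.ball p (4 * R)) :
    ‖fderiv ℝ (fderiv ℝ f) x‖ ≤ L :=
  norm_fderiv_le_of_lip' ℝ h.L_nonneg
    (Filter.mem_of_superset (Metric.isOpen_ball.mem_nhds hx) fun y hy => h.lip y hy x hx)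

end IsChart

theorem cutoff_estimates {χ φ : E3 → ℝ} {A : E3 → E3} {y E : E3} {r D C Cχ : ℝ}
    (hχ : DifferentiableAt ℝ χ y) (hφ : DifferentiableAt ℝ φ y) (hA : DifferentiableAt ℝ A y)
    (hr : 0 < r) (hrD : r ≤ D) (hC : 0 ≤ C) (hCχ : 0 ≤ Cχ) (h0 : ‖χ y‖ ≤ Cχ)
    (h1 : ‖fderiv ℝ χ y‖ ≤ Cχ) (hφ0 : |φ y| ≤ C * (r ^ 2)⁻¹) (hA0 : ‖A y‖ ≤ C * (r ^ 2)⁻¹)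
    (hφ1 : ‖fderiv ℝ φ y‖ ≤ C * (r ^ 3)⁻¹) (hA1 : ‖fderiv ℝ A y‖ ≤ C * (r ^ 3)⁻¹)
    (hE : ‖curlOp (fderiv ℝ A y) - gradOp (fderiv ℝ φ y) - E‖ ≤ C * (r ^ 2)⁻¹) :
    |χ y * φ y| ≤ Cχ * C * (4 + D) * (r ^ 2)⁻¹ ∧
    ‖χ y • A y‖ ≤ Cχ * C * (4 + D) * (r ^ 2)⁻¹ ∧
    ‖fderiv ℝ (fun y => χ y * φ y) y‖ ≤ Cχ * C * (4 + D) * (r ^ 3)⁻¹ ∧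
    ‖fderiv ℝ (fun y => χ y • A y) y‖ ≤ Cχ * C * (4 + D) * (r ^ 3)⁻¹ ∧
    ‖curl3 (fun y => χ y • A y) y - grad3 (fun y => χ y * φ y) y - χ y • E‖ ≤
      Cχ * C * (4 + D) * (r ^ 2)⁻¹ := by
  have hD : 0 ≤ D := hr.le.trans hrD
  have hr2 : 0 ≤ (r ^ 2)⁻¹ := by positivity
  have hr3 : 0 ≤ (r ^ 3)⁻¹ := by positivity
  have hr23 : (r ^ 2)⁻¹ ≤ D * (r ^ 3)⁻¹ := by
    have : (r ^ 2)⁻¹ = r * (r ^ 3)⁻¹ := by field_simp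
    rw [this]; gcongr
  have hCC : 0 ≤ Cχ * C := mul_nonneg hCχ hC
  have hP : HasFDerivAt (fun y => χ y * φ y) (χ y • fderiv ℝ φ y + φ y • fderiv ℝ χ y) y :=
    hχ.hasFDerivAt.mul hφ.hasFDerivAt
  have hQ : HasFDerivAt (fun y => χ y • A y)
      (χ y • fderiv ℝ A y + (fderiv ℝ χ y).smulRight (A y)) y :=
    hχ.hasFDerivAt.smul hA.hasFDerivAt
  have b1 : ‖φ y • fderiv ℝ χ y‖ ≤ Cχ * C * (r ^ 2)⁻¹ := by
    rw [norm_smul]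
    calc _ ≤ C * (r ^ 2)⁻¹ * Cχ := by gcongr; exact hφ0
      _ = _ := by ring
  have b2 : ‖(fderiv ℝ χ y).smulRight (A y)‖ ≤ Cχ * C * (r ^ 2)⁻¹ := by
    rw [ContinuousLinearMap.norm_smulRight_apply]
    calc _ ≤ Cχ * (C * (r ^ 2)⁻¹) := by gcongr
      _ = _ := by ring
  have b3 : ‖χ y • fderiv ℝ φ y‖ ≤ Cχ * C * (r ^ 3)⁻¹ := by
    rw [norm_smul]
    calc _ ≤ Cχ * (C * (r ^ 3)⁻¹) := by gcongr
      _ = _ := by ring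
  have b4 : ‖χ y • fderiv ℝ A y‖ ≤ Cχ * C * (r ^ 3)⁻¹ := by
    rw [norm_smul]
    calc _ ≤ Cχ * (C * (r ^ 3)⁻¹) := by gcongr
      _ = _ := by ring
  have g2 : ∀ {t : ℝ}, 0 ≤ t → Cχ * C * t ≤ Cχ * C * (4 + D) * t := fun ht => by
    nlinarith [mul_nonneg hCC ht, mul_nonneg (mul_nonneg hCC hD) ht]
  have g3 : Cχ * C * (r ^ 3)⁻¹ + Cχ * C * (r ^ 2)⁻¹ ≤ Cχ * C * (4 + D) * (r ^ 3)⁻¹ := by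
    nlinarith [mul_nonneg hCC hr3, mul_le_mul_of_nonneg_left hr23 hCC]
  refine ⟨?_, ?_, ?_, ?_, ?_⟩
  · rw [abs_mul]
    calc _ ≤ Cχ * (C * (r ^ 2)⁻¹) := by gcongr; exact h0
      _ = Cχ * C * (r ^ 2)⁻¹ := by ring
      _ ≤ _ := g2 hr2
  · rw [norm_smul]
    calc _ ≤ Cχ * (C * (r ^ 2)⁻¹) := by gcongr
      _ = Cχ * C * (r ^ 2)⁻¹ := by ring
      _ ≤ _ := g2 hr2
  · rw [hP.fderiv]
    exact (norm_add_le _ _).trans ((add_le_add b3 b1).trans g3)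
  · rw [hQ.fderiv]
    exact (norm_add_le _ _).trans ((add_le_add b4 b2).trans g3)
  · have hid : curl3 (fun y => χ y • A y) y - grad3 (fun y => χ y * φ y) y - χ y • E =
        χ y • (curlOp (fderiv ℝ A y) - gradOp (fderiv ℝ φ y) - E) +
          curlOp ((fderiv ℝ χ y).smulRight (A y)) - gradOp (φ y • fderiv ℝ χ y) := by
      rw [curl3_eq_curlOp hQ.differentiableAt, show grad3 (fun y => χ y * φ y) y =
        gradOp (fderiv ℝ (fun y => χ y * φ y) y) from rfl, hP.fderiv, hQ.fderiv, curlOp_add,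
        gradOp_add, curlOp_smul, gradOp_smul]
      module
    rw [hid]
    have b5 : ‖χ y • (curlOp (fderiv ℝ A y) - gradOp (fderiv ℝ φ y) - E)‖ ≤
        Cχ * C * (r ^ 2)⁻¹ := by
      rw [norm_smul]
      calc _ ≤ Cχ * (C * (r ^ 2)⁻¹) := by gcongr
        _ = _ := by ring
    have b6 := (norm_curlOp_le ((fderiv ℝ χ y).smulRight (A y))).trans
      (mul_le_mul_of_nonneg_left b2 (by norm_num))
    have b7 := (norm_gradOp_le (φ y • fderiv ℝ χ y)).trans b1
    refine (norm_sub_le _ _).trans ((add_le_add ((norm_add_le _ _).trans (add_le_add b5 b6))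
      b7).trans ?_)
    nlinarith [mul_nonneg hCC hr2, mul_nonneg (mul_nonneg hCC hD) hr2]

/-- The smooth approximate identity generated by the regularised kernel. -/
def rho (δ : ℝ) (z : E3) : ℝ := 3 * δ ^ 2 * (reg δ z ^ 5)⁻¹

/-- Localised scalar potential: source and image source. -/
def potPhi (χ : E3 → ℝ) (δ : ℝ) (f : E3 → ℝ) (x : E3) (s : ℝ) (e y : E3) : ℝ :=
  χ y * (srcPhi δ f x (chartW f x) 0 e y +
    srcPhi δ f x (chartW f x) (chartK f x) (s • chartS f x e) y)

/-- Localised vector potential: source and image source. -/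
def potA (χ : E3 → ℝ) (δ : ℝ) (f : E3 → ℝ) (x : E3) (s : ℝ) (e y : E3) : E3 :=
  χ y • (srcA δ f x (chartW f x) 0 e y +
    srcA δ f x (chartW f x) (chartK f x) (s • chartS f x e) y)

section
variable {Ω : Set E3} {f : E3 → ℝ} {p : E3} {R M L : ℝ} {n : E3} {x : E3}

theorem contDiff_potPhi (hf : ContDiff ℝ 2 f) {χ : E3 → ℝ} (hχ : ContDiff ℝ 1 χ) {δ : ℝ}
    (hδ : 0 < δ) (x : E3) (s : ℝ) (e : E3) : ContDiff ℝ 1 (potPhi χ δ f x s e) :=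
  hχ.mul ((contDiff_srcPhi hf hδ _ _ _ _).add (contDiff_srcPhi hf hδ _ _ _ _))

theorem contDiff_potA (hf : ContDiff ℝ 2 f) {χ : E3 → ℝ} (hχ : ContDiff ℝ 1 χ) {δ : ℝ}
    (hδ : 0 < δ) (x : E3) (s : ℝ) (e : E3) : ContDiff ℝ 1 (potA χ δ f x s e) :=
  hχ.smul ((contDiff_srcA hf hδ _ _ _ _).add (contDiff_srcA hf hδ _ _ _ _))

theorem IsChart.exists_potential_estimates (h : IsChart Ω f p R M L n)
    (hs : 20 * L * ‖n‖ * R ≤ 1) {χ : E3 → ℝ} (hχ : ContDiff ℝ 1 χ)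
    (hχs : ∀ y ∉ Metric.closedBall p (2 * R), χ y = 0) {Cχ : ℝ} (hCχ : 0 ≤ Cχ)
    (hχb : ∀ y, ‖χ y‖ ≤ Cχ ∧ ‖fderiv ℝ χ y‖ ≤ Cχ) :
    ∃ C, 0 ≤ C ∧ ∀ x ∈ Metric.ball p R ∩ Ω, ∀ e : E3, ‖e‖ ≤ 1 → ∀ δ, 0 < δ → ∀ s : ℝ, |s| ≤ 1 →
      ∀ y ∈ Ω, y ≠ x →
      |potPhi χ δ f x s e y| ≤ C * (‖y - x‖ ^ 2)⁻¹ ∧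
      ‖potA χ δ f x s e y‖ ≤ C * (‖y - x‖ ^ 2)⁻¹ ∧
      ‖fderiv ℝ (potPhi χ δ f x s e) y‖ ≤ C * (‖y - x‖ ^ 3)⁻¹ ∧
      ‖fderiv ℝ (potA χ δ f x s e) y‖ ≤ C * (‖y - x‖ ^ 3)⁻¹ ∧
      ‖curl3 (potA χ δ f x s e) y - grad3 (potPhi χ δ f x s e) y -
        χ y • (rho δ (srcZ f x (chartW f x) 0 y) • e +
          rho δ (srcZ f x (chartW f x) (chartK f x) y) • (s • chartS f x e))‖ ≤
        C * (‖y - x‖ ^ 2)⁻¹ := by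
  have hR := h.pos
  obtain ⟨C0, hC0, hE⟩ := exists_source_estimates (W := 3 * ‖n‖) (D := 3 * R) (A0 := 7)
    h.L_nonneg (by positivity) (by positivity) (by norm_num)
  refine ⟨Cχ * (2 * C0) * (4 + 3 * R), by positivity, ?_⟩
  intro x hx e he δ hδ s hs1 y hy hyx
  have hr : 0 < ‖y - x‖ := norm_pos_iff.2 (sub_ne_zero.2 hyx)
  by_cases hyb : y ∈ Metric.closedBall p (2 * R)
  · have hx4 : x ∈ Metric.ball p (4 * R) := Metric.ball_subset_ball (by linarith) hx.1
    have hy4 : y ∈ Metric.ball p (4 * R) :=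
      lt_of_le_of_lt (Metric.mem_closedBall.1 hyb) (by linarith)
    have hrD : ‖y - x‖ ≤ 3 * R := by
      rw [← dist_eq_norm]
      have := dist_triangle_right y x p
      have h1 : dist x p < R := hx.1
      have h2 : dist y p ≤ 2 * R := hyb
      linarith
    have hm := h.dot3_grad_pos hx4
    have hfx := (h.mem_iff x hx4).1 hx.2
    have hfy := (h.mem_iff y hy4).1 hy
    have hreg : ‖y - x‖ / 2 ≤ reg δ (srcZ f x (chartW f x) 0 y) :=
      (h.half_le_norm_srcZ hs hx.1 hyb).trans (norm_le_reg hδ _)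
    have hreg' := hreg.trans (reg_srcZ_le_reg_srcZ_chartK hm δ
      (mul_nonneg_of_nonpos_of_nonpos hfx.le hfy.le))
    have hS : ‖s • chartS f x e‖ ≤ 7 := by
      rw [norm_smul, Real.norm_eq_abs]
      have := h.norm_chartS_le hx4 e
      nlinarith [norm_nonneg (chartS f x e), abs_nonneg s]
    obtain ⟨a1, a2, a3, a4, a5⟩ := hE f δ x (chartW f x) 0 e y _ h.smooth hδ hr hrD hreg
      (h.norm_chartW_le hx4) (he.trans (by norm_num)) (h.lip y hy4 x hx4)
      (h.norm_fderiv_fderiv_le hy4)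
    obtain ⟨b1, b2, b3, b4, b5⟩ := hE f δ x (chartW f x) (chartK f x) (s • chartS f x e) y _
      h.smooth hδ hr hrD hreg' (h.norm_chartW_le hx4) hS (h.lip y hy4 x hx4)
      (h.norm_fderiv_fderiv_le hy4)
    have dP := fun k a => (contDiff_srcPhi h.smooth hδ x (chartW f x) k a).differentiable
      (by norm_num) y
    have dA := fun k a => (contDiff_srcA h.smooth hδ x (chartW f x) k a).differentiable
      (by norm_num) y
    have eP := fderiv_add (dP 0 e) (dP (chartK f x) (s • chartS f x e))
    have eA := fderiv_add (dA 0 e) (dA (chartK f x) (s • chartS f x e))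
    refine cutoff_estimates (hχ.differentiable (by norm_num) y)
      ((dP 0 e).add (dP (chartK f x) (s • chartS f x e)))
      ((dA 0 e).add (dA (chartK f x) (s • chartS f x e))) hr hrD (by positivity) hCχ (hχb y).1
      (hχb y).2 ?_ ?_ ?_ ?_ ?_
    · exact (abs_add_le _ _).trans ((add_le_add a1 b1).trans_eq (by ring))
    · exact (norm_add_le _ _).trans ((add_le_add a2 b2).trans_eq (by ring))
    · rw [eP]; exact (norm_add_le _ _).trans ((add_le_add a3 b3).trans_eq (by ring))
    · rw [eA]; exact (norm_add_le _ _).trans ((add_le_add a4 b4).trans_eq (by ring))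
    · rw [eP, eA, curlOp_add, gradOp_add]
      refine le_trans (le_of_eq ?_) ((norm_add_le _ _).trans ((add_le_add a5 b5).trans_eq
        (by ring : _ = 2 * C0 * (‖y - x‖ ^ 2)⁻¹)))
      congr 1
      simp only [rho]
      module
  · have hev : ∀ᶠ z in nhds y, z ∉ Metric.closedBall p (2 * R) :=
      Metric.isClosed_closedBall.isOpen_compl.mem_nhds hyb
    have zP : potPhi χ δ f x s e =ᶠ[nhds y] fun _ => 0 := by
      filter_upwards [hev] with z hz
      rw [potPhi, hχs z hz, zero_mul]
    have zA : potA χ δ f x s e =ᶠ[nhds y] fun _ => 0 := by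
      filter_upwards [hev] with z hz
      rw [potA, hχs z hz, zero_smul]
    have fP : fderiv ℝ (potPhi χ δ f x s e) y = 0 := by rw [zP.fderiv_eq]; simp
    have fA : fderiv ℝ (potA χ δ f x s e) y = 0 := by rw [zA.fderiv_eq]; simp
    have gP : grad3 (potPhi χ δ f x s e) y = 0 := by
      funext i; simp [grad3, pd, fP]
    have cA : curl3 (potA χ δ f x s e) y = 0 := by
      rw [curl3_eq_curlOp ((contDiff_potA h.smooth hχ hδ x s e).differentiable (by norm_num) y), fA]
      funext i; fin_cases i <;> simp [curlOp]
    rw [fP, fA, gP, cA, zP.eq_of_nhds, zA.eq_of_nhds, hχs y hyb]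
    simp only [abs_zero, norm_zero, sub_zero, zero_smul]
    refine ⟨?_, ?_, ?_, ?_, ?_⟩ <;> positivity

/-- The potentials satisfy the boundary conditions required by Green's identity. -/
theorem IsChart.potential_boundary (h : IsChart Ω f p R M L n) (hΩ : IsOpen Ω) {ν u : E3 → E3}
    (hν : IsOutwardNormal Ω ν) {s : ℝ}
    (hbc : (s = 1 ∧ ∀ y ∈ frontier Ω, dot3 (ν y) (u y) = 0) ∨
      (s = -1 ∧ ∀ y ∈ frontier Ω, cross3 (ν y) (u y) = 0))
    (hx : x ∈ Metric.ball p (4 * R)) (χ : E3 → ℝ) (δ : ℝ) (e : E3) :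
    ∀ y ∈ frontier Ω, y ∈ Metric.ball p (4 * R) →
      potPhi χ δ f x s e y * dot3 (grad3 f y) (u y) = 0 ∧
        dot3 (grad3 f y) (cross3 (potA χ δ f x s e y) (u y)) = 0 := by
  intro y hy hyb
  have hm := h.dot3_grad_pos hx
  have hfy := h.eq_zero hΩ hy hyb
  obtain ⟨c, hc⟩ := h.exists_grad_eq hΩ hν hy hyb
  have hz := srcZ_chartK_eq_chartS hm hfy
  have hreg : reg δ (chartS f x (srcZ f x (chartW f x) 0 y)) =
      reg δ (srcZ f x (chartW f x) 0 y) := by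
    rw [reg, reg, dot3_chartS_chartS hm]
  rcases hbc with ⟨rfl, hb⟩ | ⟨rfl, hb⟩
  · have hgu : dot3 (grad3 f y) (u y) = 0 := by rw [hc, dot3_smul_left, hb y hy, mul_zero]
    refine ⟨by rw [hgu, mul_zero], ?_⟩
    have hV : srcV δ f x (chartW f x) 0 e y +
        srcV δ f x (chartW f x) (chartK f x) ((1 : ℝ) • chartS f x e) y =
        ((reg δ (srcZ f x (chartW f x) 0 y) ^ 3)⁻¹ *
          (2 * dot3 (grad3 f x) (cross3 (srcZ f x (chartW f x) 0 y) e))) • chartW f x := by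
      have h1 : cross3 (chartS f x (srcZ f x (chartW f x) 0 y)) (chartS f x e) = _ :=
        cross3_chartS_chartS hm _ _
      simp only [srcV, kern, hz, hreg, one_smul, map_smul, ContinuousLinearMap.flip_apply,
        crossL_apply]
      simp only [← crossL_apply] at h1 ⊢
      rw [h1, chartS]
      module
    have hA : ∃ t : ℝ, potA χ δ f x 1 e y = t • grad3 f y := by
      set t := (reg δ (srcZ f x (chartW f x) 0 y) ^ 3)⁻¹ *
          (2 * dot3 (grad3 f x) (cross3 (srcZ f x (chartW f x) 0 y) e))
      have hg : gradL (fderiv ℝ f y - fderiv ℝ f x) = grad3 f y - grad3 f x := by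
        rw [map_sub]; rfl
      refine ⟨-(χ y * (t * (dot3 (grad3 f x) (grad3 f x))⁻¹)), ?_⟩
      have h2 : dotL (chartW f x) (srcV δ f x (chartW f x) 0 e y) +
          dotL (chartW f x) (srcV δ f x (chartW f x) (chartK f x) ((1 : ℝ) • chartS f x e) y) =
          t * (dot3 (grad3 f x) (grad3 f x))⁻¹ := by
        rw [← map_add, hV, map_smul, dotL_apply, dot3_chartW, dot3_grad3_chartW hm]
        simp
      have h3 : potA χ δ f x 1 e y = -(χ y • ((srcV δ f x (chartW f x) 0 e y +
          srcV δ f x (chartW f x) (chartK f x) ((1 : ℝ) • chartS f x e) y) +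
          (dotL (chartW f x) (srcV δ f x (chartW f x) 0 e y) +
          dotL (chartW f x) (srcV δ f x (chartW f x) (chartK f x)
            ((1 : ℝ) • chartS f x e) y)) • (grad3 f y - grad3 f x))) := by
        simp only [potA, srcA, hg]
        module
      rw [h3, h2, hV, chartW]
      module
    obtain ⟨t, ht⟩ := hA
    rw [ht]
    simp [dot3, cross3, Fin.sum_univ_three]
    ring
  · have hgu : cross3 (grad3 f y) (u y) = 0 := by
      rw [hc, ← crossL_apply, map_smul, smul_apply, crossL_apply, hb y hy,
        smul_zero]
    constructor
    · have : potPhi χ δ f x (-1) e y = 0 := by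
        have h1 : dot3 (-chartS f x e) (chartS f x (srcZ f x (chartW f x) 0 y)) =
            -dot3 e (srcZ f x (chartW f x) 0 y) := by
          rw [← dot3_chartS_chartS hm e, ← neg_one_smul ℝ (chartS f x e), dot3_smul_left]
          ring
        simp only [potPhi, srcPhi, kern, hz, hreg, neg_smul, one_smul, dotL_apply,
          dot3_smul_right, h1]
        ring
      rw [this, zero_mul]
    · generalize potA χ δ f x (-1) e y = a
      have h1 : dot3 (grad3 f y) (cross3 a (u y)) = -dot3 a (cross3 (grad3 f y) (u y)) := by
        simp [dot3, cross3, Fin.sum_univ_three]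
        ring
      rw [h1, hgu]
      simp [dot3]

end

theorem cube_eq_closedBall (c : E3) {r : ℝ} (hr : 0 < r) :
    {x : E3 | ∀ i, |x i - c i| ≤ r} = Metric.closedBall c r := by
  ext x
  simp [dist_pi_le_iff hr.le, Real.dist_eq]

theorem volume_closedBall_toReal (c : E3) {r : ℝ} (hr : 0 < r) :
    (volume (Metric.closedBall c r)).toReal = (2 * r) ^ 3 := by
  rw [Real.volume_pi_closedBall c hr.le, ENNReal.toReal_ofReal (by positivity)]
  simp

/-- The three quantitative properties of an atom on the cube of centre `c` and radius `r`. -/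
structure IsBallAtom (θ : ℝ) (c : E3) (r : ℝ) (a : E3 → ℝ) : Prop where
  meas : Measurable a
  supp : ∀ x ∉ Metric.closedBall c r, a x = 0
  bdd : ∀ᵐ x ∂(volume : Measure E3), |a x| ≤ ((2 * r) ^ 3)⁻¹
  cancel : |∫ x in Metric.closedBall c r, a x| ≤ (2 * r) ^ θ

namespace IsBallAtom

variable {θ : ℝ} {c : E3} {r : ℝ} {a : E3 → ℝ}

theorem integrableOn (ha : IsBallAtom θ c r a) : IntegrableOn a (Metric.closedBall c r) := by
  have : IsFiniteMeasure (volume.restrict (Metric.closedBall c r)) :=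
    isFiniteMeasure_restrict.2 measure_closedBall_lt_top.ne
  exact Integrable.of_bound ha.meas.aestronglyMeasurable _ (ae_restrict_of_ae ha.bdd)

theorem integrable (ha : IsBallAtom θ c r a) : Integrable a :=
  (integrableOn_iff_integrable_of_support_subset
    (fun x hx => by_contra fun h => hx (ha.supp x h))).1 ha.integrableOn

/-- Testing an atom against a function of size `C * t` costs at most `C * t`. -/
theorem abs_setIntegral_mul_le (ha : IsBallAtom θ c r a) (hr : 0 < r) {g : E3 → ℝ} {B : ℝ}
    (hg : ∀ y ∈ Metric.closedBall c r, |g y| ≤ B) :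
    |∫ y in Metric.closedBall c r, g y * a y| ≤ B := by
  have hB : 0 ≤ B := (abs_nonneg _).trans (hg c (Metric.mem_closedBall_self hr.le))
  have hn := norm_setIntegral_le_of_norm_le_const_ae' (μ := volume) (f := fun y => g y * a y)
    (C := B * ((2 * r) ^ 3)⁻¹) (s := Metric.closedBall c r) measure_closedBall_lt_top ?_
  · refine hn.trans_eq ?_
    rw [Measure.real, volume_closedBall_toReal c hr, mul_assoc, inv_mul_cancel₀ (by positivity),
      mul_one]
  · filter_upwards [ha.bdd] with y hy hyb
    rw [norm_mul, Real.norm_eq_abs, Real.norm_eq_abs]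
    exact mul_le_mul (hg y hyb) hy (abs_nonneg _) hB

end IsBallAtom

theorem IsHAtom.exists_isBallAtom {μ₀ θ : ℝ} {Q : Set E3} {a : E3 → ℝ} (h : IsHAtom μ₀ Q a)
    (hθ : 0 < θ) (hθμ : θ ≤ 3 * μ₀) :
    ∃ c r, 0 < r ∧ Q = Metric.closedBall c r ∧ IsBallAtom θ c r a := by
  obtain ⟨c, r, hr, hQ⟩ := h.cube
  rw [cube_eq_closedBall c hr] at hQ
  subst hQ
  have hv := volume_closedBall_toReal c hr
  have hb := h.bdd
  rw [hv] at hb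
  refine ⟨c, r, hr, rfl, h.meas, h.supp, hb, ?_⟩
  rcases lt_or_ge (2 * r) 1 with h1 | h1
  · obtain ⟨μ, hμ, hc⟩ := h.cancel
    rw [hv] at hc
    refine (hc (pow_lt_one₀ (by positivity) h1 (by norm_num))).trans ?_
    rw [← Real.rpow_natCast, ← Real.rpow_mul (by positivity)]
    refine Real.rpow_le_rpow_of_exponent_ge (by positivity) h1.le ?_
    push_cast
    linarith
  · refine le_trans ?_ (Real.one_le_rpow h1 hθ.le)
    have hn := norm_setIntegral_le_of_norm_le_const_ae' (μ := volume) (f := a)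
      (C := ((2 * r) ^ 3)⁻¹) (s := Metric.closedBall c r) measure_closedBall_lt_top
      (by filter_upwards [hb] with y hy _ using hy)
    refine hn.trans_eq ?_
    rw [Measure.real, hv, inv_mul_cancel₀ (by positivity)]

/-- Testing atoms against functions with the decay of the gradient of the Newtonian kernel. -/
theorem exists_abs_integral_atom_le {θ D : ℝ} (hθ : 0 < θ) (hθ1 : θ < 1) (hD : 0 ≤ D) :
    ∃ K, 0 ≤ K ∧ ∀ (c : E3) (r : ℝ) (a : E3 → ℝ) (x : E3) (ψ : E3 → ℝ) (C : ℝ),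
      IsBallAtom θ c r a → 0 < r → 0 ≤ C → ‖x - c‖ ≤ D → ContDiff ℝ 1 ψ →
      (∀ y ∈ Metric.closedBall c r, y ≠ x →
        |ψ y| ≤ C * (‖y - x‖ ^ 2)⁻¹ ∧ ‖fderiv ℝ ψ y‖ ≤ C * (‖y - x‖ ^ 3)⁻¹) →
      |∫ y in Metric.closedBall c r, ψ y * a y| ≤ C * K * atomProfile θ r ‖x - c‖ := by
  obtain ⟨C1, hC1, hball⟩ := lintegral_ball_norm_rpow_le (s := 2) (by norm_num)
  refine ⟨27 * C1 + (64 + 16 * (1 + D)), by positivity, ?_⟩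
  intro c r a x ψ C ha hr hC hxD hψ hb
  set ρ := ‖x - c‖ with hρ
  have hρ0 : 0 ≤ ρ := norm_nonneg _
  have hP := atomProfile_nonneg (θ := θ) hr hρ0
  rcases le_or_gt ρ (2 * r) with hnear | hfar
  · have key : |∫ y in Metric.closedBall c r, ψ y * a y| ≤ C * C1 * (r ^ 2)⁻¹ := by
      have h1 : ‖∫ y in Metric.closedBall c r, ψ y * a y‖ₑ ≤
          ENNReal.ofReal (C * C1 * (r ^ 2)⁻¹) := by
        refine (enorm_integral_le_lintegral_enorm _).trans ?_
        calc ∫⁻ y in Metric.closedBall c r, ‖ψ y * a y‖ₑ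
            ≤ ∫⁻ y in Metric.closedBall c r, ENNReal.ofReal (C * ((2 * r) ^ 3)⁻¹) *
                ENNReal.ofReal (‖y - x‖ ^ (-2 : ℝ)) := by
              refine lintegral_mono_ae ?_
              have hne : ∀ᵐ y ∂(volume : Measure E3), y ≠ x := by
                simp [ae_iff]
              filter_upwards [ae_restrict_of_ae ha.bdd, ae_restrict_of_ae hne,
                ae_restrict_mem measurableSet_closedBall] with y hy hyx hyb
              rw [← ENNReal.ofReal_mul (by positivity), ← ofReal_norm]
              refine ENNReal.ofReal_le_ofReal ?_
              rw [norm_mul, Real.rpow_neg (norm_nonneg _), Real.rpow_ofNat]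
              calc _ ≤ C * (‖y - x‖ ^ 2)⁻¹ * ((2 * r) ^ 3)⁻¹ :=
                    mul_le_mul (hb y hyb hyx).1 hy (abs_nonneg _) (by positivity)
                _ = _ := by ring
          _ ≤ ∫⁻ y in Metric.ball x (4 * r), ENNReal.ofReal (C * ((2 * r) ^ 3)⁻¹) *
                ENNReal.ofReal (‖y - x‖ ^ (-2 : ℝ)) := by
              refine lintegral_mono_set fun y hy => ?_
              have h1 : dist y c ≤ r := hy
              have h2 := dist_triangle_right y x c
              rw [dist_eq_norm x c] at h2
              rw [Metric.mem_ball]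
              linarith
          _ = ENNReal.ofReal (C * ((2 * r) ^ 3)⁻¹) *
                ∫⁻ y in Metric.ball x (4 * r), ENNReal.ofReal (‖y - x‖ ^ (-2 : ℝ)) :=
              lintegral_const_mul' _ _ ENNReal.ofReal_ne_top
          _ ≤ ENNReal.ofReal (C * ((2 * r) ^ 3)⁻¹) *
                ENNReal.ofReal (C1 * (4 * r) ^ (3 - 2 : ℝ)) := by
              gcongr
              exact hball x (4 * r) (by positivity)
          _ ≤ _ := by
              rw [← ENNReal.ofReal_mul (by positivity)]
              refine ENNReal.ofReal_le_ofReal ?_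
              norm_num
              have : C * ((2 * r) ^ 3)⁻¹ * (C1 * (4 * r)) = C * C1 * (r ^ 2)⁻¹ / 2 := by
                field_simp; norm_num
              rw [this]
              have : 0 ≤ C * C1 * (r ^ 2)⁻¹ := by positivity
              linarith
      rwa [← ofReal_norm, ENNReal.ofReal_le_ofReal_iff (by positivity)] at h1
    have hprof : (r ^ 2)⁻¹ ≤ 27 * atomProfile θ r ρ := by
      have h1 : (3 * r) ^ (-(2 + θ)) ≤ (r + ρ) ^ (-(2 + θ)) :=
        Real.rpow_le_rpow_of_nonpos (by positivity) (by linarith) (by linarith)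
      have h2 : (3 : ℝ) ^ (-3 : ℝ) ≤ (3 : ℝ) ^ (-(2 + θ)) :=
        Real.rpow_le_rpow_of_exponent_le (by norm_num) (by linarith)
      rw [Real.mul_rpow (by norm_num) hr.le] at h1
      have h3 : r ^ θ * r ^ (-(2 + θ)) = (r ^ 2)⁻¹ := by
        rw [← Real.rpow_add hr, ← Real.rpow_ofNat, ← Real.rpow_neg hr.le]
        congr 1; ring
      have h4 : (3 : ℝ) ^ (-3 : ℝ) = 1 / 27 := by
        rw [Real.rpow_neg (by norm_num), Real.rpow_ofNat]; norm_num
      rw [h4] at h2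
      rw [atomProfile]
      calc (r ^ 2)⁻¹ = 27 * (r ^ θ * (1 / 27 * r ^ (-(2 + θ)))) := by rw [← h3]; ring
        _ ≤ 27 * (r ^ θ * (3 ^ (-(2 + θ)) * r ^ (-(2 + θ)))) := by gcongr
        _ ≤ _ := by gcongr
    calc _ ≤ C * C1 * (r ^ 2)⁻¹ := key
      _ ≤ C * C1 * (27 * atomProfile θ r ρ) := by gcongr
      _ = C * (27 * C1 + 0) * atomProfile θ r ρ := by ring
      _ ≤ _ := by gcongr; positivity
  · have hρ1 : 0 < ρ := by linarith
    have hdist : ∀ y ∈ Metric.closedBall c r, ρ / 2 ≤ ‖y - x‖ := fun y hy => by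
      have h1 : dist y c ≤ r := hy
      have h2 := dist_triangle_left x c y
      rw [dist_eq_norm x c, dist_eq_norm y x] at h2
      linarith
    have hne : ∀ y ∈ Metric.closedBall c r, y ≠ x := fun y hy hyx => by
      have := hdist y hy
      rw [hyx, sub_self, norm_zero] at this
      linarith
    have hder : ∀ y ∈ Metric.closedBall c r, ‖fderiv ℝ ψ y‖ ≤ C * (8 * (ρ ^ 3)⁻¹) := fun y hy => by
      refine (hb y hy (hne y hy)).2.trans ?_
      gcongr
      calc (‖y - x‖ ^ 3)⁻¹ ≤ ((ρ / 2) ^ 3)⁻¹ := by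
            have := hdist y hy
            gcongr
        _ = _ := by field_simp; norm_num
    have hdiff : ∀ y ∈ Metric.closedBall c r, |ψ y - ψ c| ≤ C * (8 * (ρ ^ 3)⁻¹) * r := fun y hy => by
      refine ((convex_closedBall c r).norm_image_sub_le_of_norm_fderiv_le
        (fun z _ => hψ.differentiable (by norm_num) z) hder
        (Metric.mem_closedBall_self hr.le) hy).trans ?_
      have : ‖y - c‖ ≤ r := by rw [← dist_eq_norm]; exact hy
      gcongr
    have hψc : |ψ c| ≤ C * (ρ ^ 2)⁻¹ := by
      have := (hb c (Metric.mem_closedBall_self hr.le) (hne c (Metric.mem_closedBall_self hr.le))).1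
      rwa [norm_sub_rev] at this
    have hint : IntegrableOn (fun y => (ψ y - ψ c) * a y) (Metric.closedBall c r) := by
      refine Integrable.bdd_mul (c := C * (8 * (ρ ^ 3)⁻¹) * r) ha.integrableOn
        (hψ.continuous.sub continuous_const).aestronglyMeasurable ?_
      filter_upwards [ae_restrict_mem measurableSet_closedBall] with y hy using hdiff y hy
    have hsplit : ∫ y in Metric.closedBall c r, ψ y * a y =
        (∫ y in Metric.closedBall c r, (ψ y - ψ c) * a y) +
          ψ c * ∫ y in Metric.closedBall c r, a y := by
      rw [← integral_const_mul, ← integral_add hint (ha.integrableOn.const_mul _)]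
      congr 1
      funext y
      ring
    have key : |∫ y in Metric.closedBall c r, ψ y * a y| ≤
        C * (8 * (r * (ρ ^ 3)⁻¹)) + C * ((ρ ^ 2)⁻¹ * (2 * r) ^ θ) := by
      rw [hsplit]
      refine (abs_add_le _ _).trans (add_le_add ?_ ?_)
      · exact (ha.abs_setIntegral_mul_le hr hdiff).trans_eq (by ring)
      · rw [abs_mul]
        calc _ ≤ C * (ρ ^ 2)⁻¹ * (2 * r) ^ θ :=
              mul_le_mul hψc ha.cancel (abs_nonneg _) (by positivity)
          _ = _ := by ring
    have hprof : r ^ θ * ρ ^ (-(2 + θ)) ≤ 8 * atomProfile θ r ρ := by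
      have h1 : (2 * ρ) ^ (-(2 + θ)) ≤ (r + ρ) ^ (-(2 + θ)) :=
        Real.rpow_le_rpow_of_nonpos (by positivity) (by linarith) (by linarith)
      have h2 : (2 : ℝ) ^ (-3 : ℝ) ≤ (2 : ℝ) ^ (-(2 + θ)) :=
        Real.rpow_le_rpow_of_exponent_le (by norm_num) (by linarith)
      rw [Real.mul_rpow (by norm_num) hρ0] at h1
      have h4 : (2 : ℝ) ^ (-3 : ℝ) = 1 / 8 := by
        rw [Real.rpow_neg (by norm_num), Real.rpow_ofNat]; norm_num
      rw [h4] at h2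
      rw [atomProfile]
      calc r ^ θ * ρ ^ (-(2 + θ)) = 8 * (r ^ θ * (1 / 8 * ρ ^ (-(2 + θ)))) := by ring
        _ ≤ 8 * (r ^ θ * (2 ^ (-(2 + θ)) * ρ ^ (-(2 + θ)))) := by gcongr
        _ ≤ _ := by gcongr
    have hρpow : ∀ t : ℝ, ρ ^ t * ρ ^ (-(2 + t)) = (ρ ^ 2)⁻¹ := fun t => by
      rw [← Real.rpow_add hρ1, ← Real.rpow_ofNat, ← Real.rpow_neg hρ0]
      congr 1; ring
    have t1 : r * (ρ ^ 3)⁻¹ ≤ r ^ θ * ρ ^ (-(2 + θ)) := by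
      have h1 : r ^ (1 - θ) ≤ ρ ^ (1 - θ) :=
        Real.rpow_le_rpow hr.le (by linarith) (by linarith)
      have h2 : r = r ^ θ * r ^ (1 - θ) := by
        rw [← Real.rpow_add hr]; norm_num
      have h3 : ρ ^ (1 - θ) * (ρ ^ 3)⁻¹ = ρ ^ (-(2 + θ)) := by
        rw [← Real.rpow_ofNat, ← Real.rpow_neg hρ0, ← Real.rpow_add hρ1]
        congr 1; ring
      calc r * (ρ ^ 3)⁻¹ = r ^ θ * r ^ (1 - θ) * (ρ ^ 3)⁻¹ := by rw [← h2]
        _ ≤ r ^ θ * ρ ^ (1 - θ) * (ρ ^ 3)⁻¹ := by gcongr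
        _ = _ := by rw [mul_assoc, h3]
    have t2 : (ρ ^ 2)⁻¹ * (2 * r) ^ θ ≤ 2 * (1 + D) * (r ^ θ * ρ ^ (-(2 + θ))) := by
      have h1 : ρ ^ θ ≤ 1 + D := by
        calc ρ ^ θ ≤ (1 + D) ^ θ := Real.rpow_le_rpow hρ0 (by linarith) hθ.le
          _ ≤ (1 + D) ^ (1 : ℝ) := Real.rpow_le_rpow_of_exponent_le (by linarith) hθ1.le
          _ = _ := Real.rpow_one _
      have h2 : (2 : ℝ) ^ θ ≤ 2 := by
        calc (2 : ℝ) ^ θ ≤ 2 ^ (1 : ℝ) :=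
              Real.rpow_le_rpow_of_exponent_le (by norm_num) hθ1.le
          _ = _ := Real.rpow_one _
      rw [← hρpow θ, Real.mul_rpow (by norm_num) hr.le]
      have h3 : 0 ≤ ρ ^ (-(2 + θ)) := by positivity
      calc _ = 2 ^ θ * ρ ^ θ * (r ^ θ * ρ ^ (-(2 + θ))) := by ring
        _ ≤ _ := by gcongr
    calc _ ≤ _ := key
      _ ≤ C * (8 * (r ^ θ * ρ ^ (-(2 + θ)))) +
          C * (2 * (1 + D) * (r ^ θ * ρ ^ (-(2 + θ)))) := by gcongr
      _ = C * (8 + 2 * (1 + D)) * (r ^ θ * ρ ^ (-(2 + θ))) := by ring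
      _ ≤ C * (8 + 2 * (1 + D)) * (8 * atomProfile θ r ρ) := by gcongr
      _ = C * (0 + (64 + 16 * (1 + D))) * atomProfile θ r ρ := by ring
      _ ≤ _ := by gcongr; positivity

/-- An atomic decomposition of `F` on `Ω` with explicit centres and radii. -/
structure IsBallDecomp (Ω : Set E3) (θ : ℝ) (F : E3 → ℝ) (lam : ℕ → ℝ) (a : ℕ → E3 → ℝ)
    (c : ℕ → E3) (r : ℕ → ℝ) : Prop where
  pos : ∀ k, 0 < r k
  sub : ∀ k, Metric.closedBall (c k) (r k) ⊆ Ω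
  atom : ∀ k, IsBallAtom θ (c k) (r k) (a k)
  summable : Summable fun k => |lam k|
  eq : ∀ x ∈ Ω, F x = ∑' k, lam k * a k x

theorem IsHardyDecomp.exists_isBallDecomp {Ω : Set E3} {μ₀ θ : ℝ} {F : E3 → ℝ} {lam : ℕ → ℝ}
    {a : ℕ → E3 → ℝ} {Q : ℕ → Set E3} (h : IsHardyDecomp Ω μ₀ F lam a Q) (hθ : 0 < θ)
    (hθμ : θ ≤ 3 * μ₀) : ∃ c r, IsBallDecomp Ω θ F lam a c r := by
  choose c r hr hQ ha using fun k => (h.1 k).1.exists_isBallAtom hθ hθμ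
  exact ⟨c, r, hr, fun k => hQ k ▸ (h.1 k).2, ha, h.2.1, h.2.2⟩

theorem exists_integral_mul_le_of_isBallDecomp {Ω : Set E3} (hΩ : MeasurableSet Ω)
    (hbd : Bornology.IsBounded Ω) {θ : ℝ} (hθ : 0 < θ) (hθ1 : θ < 1) :
    ∃ K, 0 ≤ K ∧ ∀ (F : E3 → ℝ) (lam : ℕ → ℝ) (a : ℕ → E3 → ℝ) (c : ℕ → E3) (r : ℕ → ℝ)
      (x : E3) (ψ : E3 → ℝ) (C : ℝ), IsBallDecomp Ω θ F lam a c r → x ∈ Ω → 0 ≤ C →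
      ContDiff ℝ 1 ψ → (∀ y ∈ Ω, y ≠ x →
        |ψ y| ≤ C * (‖y - x‖ ^ 2)⁻¹ ∧ ‖fderiv ℝ ψ y‖ ≤ C * (‖y - x‖ ^ 3)⁻¹) →
      ENNReal.ofReal |∫ y in Ω, ψ y * F y| ≤ ENNReal.ofReal (C * K) *
        ∑' k, ENNReal.ofReal |lam k| * ENNReal.ofReal (atomProfile θ (r k) ‖x - c k‖) := by
  obtain ⟨D, hD⟩ := hbd.exists_norm_le
  obtain ⟨K, hK, hKb⟩ := exists_abs_integral_atom_le (D := 2 * max D 0) hθ hθ1 (by positivity)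
  refine ⟨K, hK, ?_⟩
  intro F lam a c r x ψ C hF hx hC hψ hb
  have hzero : ∀ (k : ℕ) (g : E3 → ℝ → ℝ), (∀ y, g y 0 = 0) → ∫ y in Ω, g y (a k y) =
      ∫ y in Metric.closedBall (c k) (r k), g y (a k y) := fun k g hg =>
    setIntegral_eq_of_subset_of_forall_sdiff_eq_zero hΩ (hF.sub k) fun y hy => by
      rw [(hF.atom k).supp y hy.2, hg]
  obtain ⟨B, hB⟩ := hbd.isCompact_closure.exists_bound_of_continuousOn hψ.continuous.continuousOn
  have hBΩ : ∀ y ∈ Ω, |ψ y| ≤ B := fun y hy => hB y (subset_closure hy)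
  have hB0 : 0 ≤ B := (abs_nonneg _).trans (hBΩ x hx)
  have hint : ∀ k, IntegrableOn (fun y => ψ y * (lam k * a k y)) Ω := fun k => by
    refine Integrable.bdd_mul (c := B) ((hF.atom k).integrable.integrableOn.const_mul _)
      hψ.continuous.aestronglyMeasurable ?_
    filter_upwards [ae_restrict_mem hΩ] with y hy using hBΩ y hy
  have hnorm : ∀ k, ∫ y in Ω, ‖ψ y * (lam k * a k y)‖ ≤ B * |lam k| := fun k => by
    rw [hzero k (fun y t => ‖ψ y * (lam k * t)‖) (by simp)]
    refine (le_abs_self _).trans ?_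
    have hr := hF.pos k
    have hn := norm_setIntegral_le_of_norm_le_const_ae' (μ := volume)
      (f := fun y => ‖ψ y * (lam k * a k y)‖) (C := B * |lam k| * ((2 * r k) ^ 3)⁻¹)
      (s := Metric.closedBall (c k) (r k)) measure_closedBall_lt_top ?_
    · refine hn.trans_eq ?_
      rw [Measure.real, volume_closedBall_toReal _ hr, mul_assoc, inv_mul_cancel₀ (by positivity),
        mul_one]
    · filter_upwards [(hF.atom k).bdd] with y hy hyb
      rw [norm_norm, norm_mul, norm_mul, ← mul_assoc]
      exact mul_le_mul (mul_le_mul (hBΩ y (hF.sub k hyb)) le_rfl (norm_nonneg _) hB0) hy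
        (abs_nonneg _) (by positivity)
  have hsum := hasSum_integral_of_summable_integral_norm (μ := volume.restrict Ω) hint
    (Summable.of_nonneg_of_le (fun k => by positivity) hnorm (hF.summable.mul_left B))
  have heq : ∫ y in Ω, ψ y * F y = ∫ y in Ω, ∑' k, ψ y * (lam k * a k y) :=
    setIntegral_congr_fun hΩ fun y hy => by
      rw [hF.eq y hy, tsum_mul_left]
  have hterm : ∀ k, |∫ y in Ω, ψ y * (lam k * a k y)| ≤
      C * K * (|lam k| * atomProfile θ (r k) ‖x - c k‖) := fun k => by
    rw [hzero k (fun y t => ψ y * (lam k * t)) (by simp)]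
    have h1 : ∀ y, ψ y * (lam k * a k y) = lam k * (ψ y * a k y) := fun y => by ring
    simp_rw [h1]
    rw [integral_const_mul, abs_mul]
    have hc : c k ∈ Ω := hF.sub k (Metric.mem_closedBall_self (hF.pos k).le)
    have hxc : ‖x - c k‖ ≤ 2 * max D 0 := by
      have := norm_sub_le x (c k)
      have h2 := hD x hx
      have h3 := hD (c k) hc
      have := le_max_left D 0
      linarith
    have := hKb (c k) (r k) (a k) x ψ C (hF.atom k) (hF.pos k) hC hxc hψ
      fun y hy => hb y (hF.sub k hy)
    calc _ ≤ |lam k| * (C * K * atomProfile θ (r k) ‖x - c k‖) := by gcongr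
      _ = _ := by ring
  rw [heq, ← Real.norm_eq_abs, ofReal_norm, ← hsum.tsum_eq, ← ENNReal.tsum_mul_left]
  refine enorm_tsum_le_tsum_enorm.trans (ENNReal.tsum_le_tsum fun k => ?_)
  rw [← ofReal_norm, ← ENNReal.ofReal_mul (abs_nonneg _), ← ENNReal.ofReal_mul (by positivity)]
  exact ENNReal.ofReal_le_ofReal (hterm k)

theorem reg_smul {δ : ℝ} (hδ : 0 < δ) (z : E3) : reg δ (δ • z) = δ * reg 1 z := by
  rw [reg, reg, dot3_smul_left, dot3_smul_right,
    show δ * (δ * dot3 z z) + δ ^ 2 = δ ^ 2 * (dot3 z z + 1 ^ 2) by ring,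
    Real.sqrt_mul (by positivity), Real.sqrt_sq hδ.le]

theorem rho_smul {δ : ℝ} (hδ : 0 < δ) (z : E3) : rho δ (δ • z) = (δ ^ 3)⁻¹ * rho 1 z := by
  have := reg_pos one_pos z
  rw [rho, rho, reg_smul hδ]
  field_simp

theorem rho_pos {δ : ℝ} (hδ : 0 < δ) (z : E3) : 0 < rho δ z := by
  have := reg_pos hδ z
  rw [rho]
  positivity

theorem rho_le_of_le_reg {δ b : ℝ} (hb : 0 < b) {z : E3} (h : b ≤ reg δ z) :
    rho δ z ≤ 3 * δ ^ 2 * (b ^ 5)⁻¹ := by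
  rw [rho]
  gcongr

theorem continuous_rho {δ : ℝ} (hδ : 0 < δ) : Continuous (rho δ) := by
  unfold rho
  exact continuous_const.mul (((contDiff_reg hδ).continuous.pow 5).inv₀
    fun z => (pow_pos (reg_pos hδ z) 5).ne')

theorem rho_one_le {w z : E3} (h : ‖w‖ / 2 ≤ ‖z‖) :
    rho 1 z ≤ 3 * 4 ^ 5 * (1 + ‖w‖) ^ (-5 : ℝ) := by
  have h1 : 1 ≤ reg 1 z := by
    rw [← one_pow 2, reg, Real.le_sqrt (by norm_num) (by have := dot3_self_nonneg z; positivity)]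
    have := dot3_self_nonneg z
    linarith
  have h2 := norm_le_reg one_pos z
  have h3 : (1 + ‖w‖) / 4 ≤ reg 1 z := by linarith [norm_nonneg w]
  have hw : 0 < 1 + ‖w‖ := by positivity
  refine (rho_le_of_le_reg (by positivity) h3).trans_eq ?_
  rw [Real.rpow_neg hw.le, Real.rpow_ofNat]
  field_simp

theorem integrable_one_add_norm_five :
    Integrable fun w : E3 => 3 * 4 ^ 5 * (1 + ‖w‖) ^ (-5 : ℝ) :=
  (integrable_one_add_norm (by simp; norm_num)).const_mul _

theorem integrable_rho_one : Integrable (rho 1) := by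
  refine integrable_one_add_norm_five.mono' (continuous_rho one_pos).aestronglyMeasurable
    (Filter.Eventually.of_forall fun w => ?_)
  rw [Real.norm_eq_abs, abs_of_pos (rho_pos one_pos w)]
  exact rho_one_le (by linarith [norm_nonneg w])

theorem integral_rho_one_pos : 0 < ∫ w, rho 1 w := by
  rw [integral_pos_iff_support_of_nonneg (fun w => (rho_pos one_pos w).le) integrable_rho_one]
  have : Function.support (rho 1) = univ := by
    ext w; simp [(rho_pos one_pos w).ne']
  rw [this]
  simp

/-- `rho δ ∘ Z` is an approximate identity at a nondegenerate zero `x` of `Z`. -/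
theorem tendsto_integral_mul_rho {H : E3 → ℝ} (hH : Measurable H) {B : ℝ}
    (hB : ∀ y, |H y| ≤ B) {x : E3} (hc : ContinuousAt H x) {Z : E3 → E3} (hZ : Continuous Z)
    (hZx : Z x = 0) (hZd : HasFDerivAt Z (ContinuousLinearMap.id ℝ E3) x)
    (hZl : ∀ y, H y ≠ 0 → ‖y - x‖ / 2 ≤ ‖Z y‖) :
    Filter.Tendsto (fun δ => ∫ y, H y * rho δ (Z y)) (nhdsWithin 0 (Ioi 0))
      (nhds (H x * ∫ w, rho 1 w)) := by
  have hB0 : 0 ≤ B := (abs_nonneg _).trans (hB x)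
  have hscale : ∀ δ : ℝ, 0 < δ → ∫ y, H y * rho δ (Z y) =
      ∫ w, H (x + δ • w) * rho 1 (δ⁻¹ • Z (x + δ • w)) := fun δ hδ => by
    have h1 : ∀ w, H (x + δ • w) * rho 1 (δ⁻¹ • Z (x + δ • w)) =
        δ ^ 3 * (H (x + δ • w) * rho δ (Z (x + δ • w))) := fun w => by
      have h2 := rho_smul hδ (δ⁻¹ • Z (x + δ • w))
      rw [smul_inv_smul₀ hδ.ne'] at h2
      rw [h2]
      field_simp
    simp_rw [h1]
    rw [integral_const_mul, Measure.integral_comp_smul volume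
      (fun v => H (x + v) * rho δ (Z (x + v))) δ,
      integral_add_left_eq_self (fun v => H v * rho δ (Z v)) x]
    simp [abs_of_pos hδ]
    field_simp
  have hev : (fun δ => ∫ w, H (x + δ • w) * rho 1 (δ⁻¹ • Z (x + δ • w)))
      =ᶠ[nhdsWithin 0 (Ioi 0)] fun δ => ∫ y, H y * rho δ (Z y) := by
    filter_upwards [self_mem_nhdsWithin] with δ hδ using (hscale δ hδ).symm
  refine Filter.Tendsto.congr' hev ?_
  rw [← integral_const_mul]
  refine tendsto_integral_filter_of_dominated_convergence
    (fun w => B * (3 * 4 ^ 5 * (1 + ‖w‖) ^ (-5 : ℝ))) ?_ ?_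
    (integrable_one_add_norm_five.const_mul B) ?_
  · refine Filter.Eventually.of_forall fun δ => ?_
    have hline : Continuous fun w : E3 => x + δ • w := by fun_prop
    refine ((hH.comp hline.measurable).mul ?_).aestronglyMeasurable
    exact ((continuous_rho one_pos).comp ((hZ.comp hline).const_smul δ⁻¹)).measurable
  · filter_upwards [self_mem_nhdsWithin] with δ hδ
    have hδ' : 0 < δ := hδ
    refine Filter.Eventually.of_forall fun w => ?_
    rw [norm_mul, Real.norm_eq_abs, Real.norm_eq_abs, abs_of_pos (rho_pos one_pos _)]
    by_cases h0 : H (x + δ • w) = 0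
    · rw [h0, abs_zero, zero_mul]
      positivity
    · refine mul_le_mul (hB _) (rho_one_le ?_) (rho_pos one_pos _).le hB0
      have h1 := hZl _ h0
      rw [add_sub_cancel_left, norm_smul, Real.norm_eq_abs, abs_of_pos hδ'] at h1
      rw [norm_smul, norm_inv, Real.norm_eq_abs, abs_of_pos hδ']
      calc ‖w‖ / 2 = δ⁻¹ * (δ * ‖w‖ / 2) := by field_simp
        _ ≤ _ := by gcongr
  · refine Filter.Eventually.of_forall fun w => ?_
    have hw : Filter.Tendsto (fun δ : ℝ => x + δ • w) (nhdsWithin 0 (Ioi 0)) (nhds x) := by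
      have h1 : ContinuousAt (fun δ : ℝ => x + δ • w) 0 := by fun_prop
      have h2 := h1.tendsto.mono_left (nhdsWithin_le_nhds (s := Ioi 0))
      rwa [zero_smul, add_zero] at h2
    have hz := (hZd.hasLineDerivAt w).tendsto_slope_zero_right
    simp only [hZx, sub_zero, ContinuousLinearMap.id_apply] at hz
    exact (hc.tendsto.comp hw).mul (((continuous_rho one_pos).tendsto w).comp hz)

theorem IsRegularField.integrableOn_dot3 {Ω : Set E3} (hbd : Bornology.IsBounded Ω)
    {u : E3 → E3} {B0 B1 : ℝ} (hu : IsRegularField Ω u B0 B1) {g : E3 → E3} (hg : Continuous g) :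
    IntegrableOn (fun y => dot3 (u y) (g y)) Ω := by
  have hc : Continuous fun q : E3 × E3 => dot3 q.1 q.2 := by unfold dot3; fun_prop
  have h1 : ContinuousOn (fun y => dot3 (u y) (g y)) (closure Ω) :=
    hc.comp_continuousOn (hu.cont.prodMk hg.continuousOn)
  exact (h1.integrableOn_compact hbd.isCompact_closure).mono_set subset_closure

theorem integrableOn_mul_of_abs_le {Ω : Set E3} (hΩ : MeasurableSet Ω)
    (hbd : Bornology.IsBounded Ω) {g F : E3 → ℝ} (hg : Continuous g) (hF : Measurable F) {B : ℝ}
    (hB : ∀ y ∈ Ω, |F y| ≤ B) : IntegrableOn (fun y => g y * F y) Ω := by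
  obtain ⟨D, hD⟩ := hbd.isCompact_closure.exists_bound_of_continuousOn hg.continuousOn
  have : IsFiniteMeasure (volume.restrict Ω) := ⟨by simpa using hbd.measure_lt_top⟩
  refine Integrable.bdd_mul (c := D) ?_ hg.aestronglyMeasurable ?_
  · refine Integrable.of_bound hF.aestronglyMeasurable B ?_
    filter_upwards [ae_restrict_mem hΩ] with y hy using hB y hy
  · filter_upwards [ae_restrict_mem hΩ] with y hy using hD y (subset_closure hy)

namespace IsChart
variable {Ω : Set E3} {f : E3 → ℝ} {p : E3} {R M L : ℝ} {n : E3}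

/-- The mollified source concentrates at `x`. -/
theorem tendsto_integral_source (h : IsChart Ω f p R M L n) (hs : 20 * L * ‖n‖ * R ≤ 1)
    (hΩ : IsOpen Ω) {u : E3 → E3} {B0 B1 : ℝ} (hu : IsRegularField Ω u B0 B1)
    {χ : E3 → ℝ} (hχ : Continuous χ) (hχs : ∀ y ∉ Metric.closedBall p (2 * R), χ y = 0)
    {Cχ : ℝ} (hχb : ∀ y, ‖χ y‖ ≤ Cχ) {x : E3} (hx : x ∈ Metric.ball p R ∩ Ω) (hχx : χ x = 1)
    (e : E3) :
    Filter.Tendsto (fun δ => ∫ y in Ω, dot3 (u y) (χ y • rho δ (srcZ f x (chartW f x) 0 y) • e))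
      (nhdsWithin 0 (Ioi 0)) (nhds (dot3 (u x) e * ∫ w, rho 1 w)) := by
  have hd : ContinuousOn (fun y => χ y * dot3 (u y) e) Ω := by
    have hc : Continuous fun q : E3 => dot3 q e := by unfold dot3; fun_prop
    exact hχ.continuousOn.mul (hc.comp_continuousOn (hu.cont.mono subset_closure))
  have hCχ : 0 ≤ Cχ := (norm_nonneg _).trans (hχb x)
  have hB0 : 0 ≤ B0 := (norm_nonneg _).trans (hu.bound x hx.2)
  have key := tendsto_integral_mul_rho (H := Ω.indicator fun y => χ y * dot3 (u y) e)
    (B := Cχ * (3 * (B0 * ‖e‖))) (x := x) (Z := srcZ f x (chartW f x) 0) ?_ ?_ ?_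
    (contDiff_srcZ h.smooth x _ _).continuous (by simp [srcZ]) ?_ ?_
  · rw [indicator_of_mem hx.2, hχx, one_mul] at key
    refine key.congr fun δ => ?_
    rw [← integral_indicator hΩ.measurableSet]
    refine integral_congr_ae (Filter.Eventually.of_forall fun y => ?_)
    by_cases hy : y ∈ Ω
    · simp only [indicator_of_mem hy, dot3_smul_right]; ring
    · simp only [indicator_of_notMem hy, zero_mul]
  · classical
    rw [← piecewise_eq_indicator]
    exact hd.measurable_piecewise continuousOn_const hΩ.measurableSet
  · intro y
    by_cases hy : y ∈ Ω
    · rw [indicator_of_mem hy, abs_mul]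
      refine mul_le_mul (hχb y) ((abs_dot3_le _ _).trans ?_) (abs_nonneg _) hCχ
      have := hu.bound y hy
      gcongr
    · rw [indicator_of_notMem hy, abs_zero]; positivity
  · refine (hd.continuousAt (hΩ.mem_nhds hx.2)).congr ?_
    filter_upwards [hΩ.mem_nhds hx.2] with y hy
    rw [indicator_of_mem hy]
  · have h1 := hasFDerivAt_srcZ h.smooth x (chartW f x) 0 x
    have h2 : ContinuousLinearMap.id ℝ E3 +
        (fderiv ℝ f x - fderiv ℝ f x).smulRight (chartW f x) = ContinuousLinearMap.id ℝ E3 := by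
      ext; simp
    rwa [h2] at h1
  · intro y hy
    refine h.half_le_norm_srcZ hs hx.1 ?_
    by_contra hyb
    apply hy
    simp [indicator, hχs y hyb]

/-- The image source has no mass inside `Ω` in the limit. -/
theorem tendsto_integral_image (h : IsChart Ω f p R M L n)
    (hbd : Bornology.IsBounded Ω) {u : E3 → E3} {B0 B1 : ℝ}
    (hu : IsRegularField Ω u B0 B1)
    {χ : E3 → ℝ} (hχs : ∀ y ∉ Metric.closedBall p (2 * R), χ y = 0)
    {Cχ : ℝ} (hχb : ∀ y, ‖χ y‖ ≤ Cχ) {x : E3} (hx : x ∈ Metric.ball p R ∩ Ω) (e : E3) :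
    Filter.Tendsto (fun δ => ∫ y in Ω,
      dot3 (u y) (χ y • rho δ (srcZ f x (chartW f x) (chartK f x) y) • e))
      (nhdsWithin 0 (Ioi 0)) (nhds 0) := by
  have hR := h.pos
  have hx4 : x ∈ Metric.ball p (4 * R) := Metric.ball_subset_ball (by linarith) hx.1
  have hCχ : 0 ≤ Cχ := (norm_nonneg _).trans (hχb x)
  have hB0 : 0 ≤ B0 := (norm_nonneg _).trans (hu.bound x hx.2)
  have hm := h.dot3_grad_pos hx4
  have hG := h.norm_grad_pos hx4
  have hfx : f x < 0 := (h.mem_iff x hx4).1 hx.2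
  set b : ℝ := -f x / (3 * ‖grad3 f x‖) with hb
  have hb0 : 0 < b := div_pos (by linarith) (by positivity)
  have hbound : ∀ δ : ℝ, 0 < δ → ‖∫ y in Ω,
      dot3 (u y) (χ y • rho δ (srcZ f x (chartW f x) (chartK f x) y) • e)‖ ≤
      3 * (B0 * (Cχ * (3 * δ ^ 2 * (b ^ 5)⁻¹ * ‖e‖))) * volume.real Ω := fun δ hδ => by
    refine norm_setIntegral_le_of_norm_le_const hbd.measure_lt_top fun y hy => ?_
    refine (abs_dot3_le _ _).trans ?_
    have hP := rho_pos hδ (srcZ f x (chartW f x) (chartK f x) y)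
    rw [norm_smul, norm_smul, Real.norm_eq_abs (rho _ _), abs_of_pos hP]
    by_cases hyb : y ∈ Metric.closedBall p (2 * R)
    · have hfy : f y < 0 := (h.mem_iff y (Metric.closedBall_subset_ball (by linarith) hyb)).1 hy
      have h1 := abs_dot3_le (grad3 f x) (srcZ f x (chartW f x) (chartK f x) y)
      rw [dot3_grad3_srcZ_chartK hm, abs_of_neg (by linarith)] at h1
      have h2 : b ≤ ‖srcZ f x (chartW f x) (chartK f x) y‖ := by
        rw [hb, div_le_iff₀ (by positivity)]; linarith
      have h3 := rho_le_of_le_reg hb0 (h2.trans (norm_le_reg hδ _))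
      have := hu.bound y hy
      have := hχb y
      gcongr
    · rw [hχs y hyb]; simp; positivity
  refine squeeze_zero_norm' (a := fun δ : ℝ =>
    3 * (B0 * (Cχ * (3 * δ ^ 2 * (b ^ 5)⁻¹ * ‖e‖))) * volume.real Ω) ?_ ?_
  · filter_upwards [self_mem_nhdsWithin] with δ hδ using hbound δ hδ
  · refine Filter.Tendsto.mono_left ?_ nhdsWithin_le_nhds
    refine Continuous.tendsto' (by fun_prop) _ _ (by simp)

end IsChart

/-- Divergence and curl components of a field as one family. -/
def divCurl (u : E3 → E3) : Option (Fin 3) → E3 → ℝ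
  | none => div3 u
  | some i => fun y => curl3 u y i

theorem measurable_divCurl (u : E3 → E3) (o : Option (Fin 3)) : Measurable (divCurl u o) := by
  cases o with
  | none => exact measurable_div3 u
  | some i => exact (measurable_pi_apply i).comp (measurable_curl3 u)

theorem IsRegularField.abs_divCurl_le {Ω : Set E3} {u : E3 → E3} {B0 B1 : ℝ}
    (hu : IsRegularField Ω u B0 B1) (o : Option (Fin 3)) {y : E3} (hy : y ∈ Ω) :
    |divCurl u o y| ≤ 3 * B1 := by
  have h1 := hu.dbound y hy
  have h0 := norm_nonneg (fderiv ℝ u y)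
  cases o with
  | none => exact (abs_div3_le (hu.diff y hy)).trans (by linarith)
  | some i =>
    exact (norm_le_pi_norm (curl3 u y) i).trans ((norm_curl3_le (hu.diff y hy)).trans (by linarith))

/-- The test functions dual to `divCurl`. -/
def testPair (φ : E3 → ℝ) (A : E3 → E3) : Option (Fin 3) → E3 → ℝ
  | none => φ
  | some i => fun y => A y i

theorem sum_testPair_mul_divCurl (φ : E3 → ℝ) (A u : E3 → E3) (y : E3) :
    ∑ o, testPair φ A o y * divCurl u o y = φ y * div3 u y + dot3 (A y) (curl3 u y) := by
  rw [Fintype.sum_option]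
  rfl

theorem contDiff_testPair {φ : E3 → ℝ} {A : E3 → E3} (hφ : ContDiff ℝ 1 φ) (hA : ContDiff ℝ 1 A)
    (o : Option (Fin 3)) : ContDiff ℝ 1 (testPair φ A o) := by
  cases o with
  | none => exact hφ
  | some i => exact contDiff_pi.1 hA i

theorem norm_fderiv_apply_le {A : E3 → E3} {y : E3} (hA : DifferentiableAt ℝ A y) (i : Fin 3) :
    ‖fderiv ℝ (fun y => A y i) y‖ ≤ ‖fderiv ℝ A y‖ := by
  refine ContinuousLinearMap.opNorm_le_bound _ (norm_nonneg _) fun v => ?_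
  rw [fderiv_component hA]
  exact (norm_le_pi_norm (fderiv ℝ A y v) i).trans (ContinuousLinearMap.le_opNorm _ _)

theorem ofReal_abs_integral_pairing_le {Ω : Set E3} (hΩ : MeasurableSet Ω)
    (hbd : Bornology.IsBounded Ω) {θ : ℝ} (hθ : 0 < θ) (hθ1 : θ < 1) :
    ∃ K, 0 ≤ K ∧ ∀ (u : E3 → E3) (B0 B1 : ℝ) (lam : Option (Fin 3) → ℕ → ℝ)
      (a : Option (Fin 3) → ℕ → E3 → ℝ) (c : Option (Fin 3) → ℕ → E3)
      (r : Option (Fin 3) → ℕ → ℝ) (x : E3) (φ : E3 → ℝ) (A : E3 → E3) (C : ℝ),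
      IsRegularField Ω u B0 B1 →
      (∀ o, IsBallDecomp Ω θ (divCurl u o) (lam o) (a o) (c o) (r o)) → x ∈ Ω → 0 ≤ C →
      ContDiff ℝ 1 φ → ContDiff ℝ 1 A →
      (∀ y ∈ Ω, y ≠ x → |φ y| ≤ C * (‖y - x‖ ^ 2)⁻¹ ∧ ‖A y‖ ≤ C * (‖y - x‖ ^ 2)⁻¹ ∧
        ‖fderiv ℝ φ y‖ ≤ C * (‖y - x‖ ^ 3)⁻¹ ∧ ‖fderiv ℝ A y‖ ≤ C * (‖y - x‖ ^ 3)⁻¹) →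
      ENNReal.ofReal |∫ y in Ω, (φ y * div3 u y + dot3 (A y) (curl3 u y))| ≤
        ENNReal.ofReal (C * K) * ∑' j : Option (Fin 3) × ℕ, ENNReal.ofReal |lam j.1 j.2| *
          ENNReal.ofReal (atomProfile θ (r j.1 j.2) ‖x - c j.1 j.2‖) := by
  obtain ⟨K, hK, hKb⟩ := exists_integral_mul_le_of_isBallDecomp hΩ hbd hθ hθ1
  refine ⟨K, hK, ?_⟩
  intro u B0 B1 lam a c r x φ A C hu hdec hx hC hφ hA hb
  simp_rw [← sum_testPair_mul_divCurl]
  rw [integral_finsetSum _ fun o _ => integrableOn_mul_of_abs_le hΩ hbd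
    (contDiff_testPair hφ hA o).continuous (measurable_divCurl u o) fun y hy =>
      hu.abs_divCurl_le o hy]
  refine (ENNReal.ofReal_le_ofReal (Finset.abs_sum_le_sum_abs _ _)).trans ?_
  rw [ENNReal.ofReal_sum_of_nonneg fun o _ => abs_nonneg _]
  rw [ENNReal.tsum_prod (f := fun o k => ENNReal.ofReal |lam o k| *
          ENNReal.ofReal (atomProfile θ (r o k) ‖x - c o k‖)), tsum_fintype, Finset.mul_sum]
  refine Finset.sum_le_sum fun o _ => ?_
  refine hKb _ _ _ _ _ x _ C (hdec o) hx hC (contDiff_testPair hφ hA o) fun y hy hyx => ?_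
  obtain ⟨h1, h2, h3, h4⟩ := hb y hy hyx
  cases o with
  | none => exact ⟨h1, h3⟩
  | some i => exact ⟨(norm_le_pi_norm (A y) i).trans h2,
      (norm_fderiv_apply_le (hA.differentiable (by norm_num) y) i).trans h4⟩

theorem exists_norm_apply_eq_norm (v : E3) : ∃ i, ‖v i‖ = ‖v‖ := by
  by_contra! hne
  have hlt : ∀ i, ‖v i‖ < ‖v‖ := fun i => lt_of_le_of_ne (norm_le_pi_norm v i) (hne i)
  exact lt_irrefl _ ((pi_norm_lt_iff ((norm_nonneg _).trans_lt (hlt 0))).2 hlt)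

theorem continuous_grad3 {φ : E3 → ℝ} (hφ : ContDiff ℝ 1 φ) : Continuous (grad3 φ) :=
  continuous_pi fun i => (hφ.continuous_fderiv (by norm_num)).clm_apply continuous_const

theorem continuous_curl3 {A : E3 → E3} (hA : ContDiff ℝ 1 A) : Continuous (curl3 A) := by
  have hd := hA.differentiable (by norm_num)
  have h : ∀ j k, Continuous fun x => pd (fun y => A y k) j x := fun j k =>
    ((contDiff_pi.1 hA k).continuous_fderiv (by norm_num)).clm_apply continuous_const
  refine continuous_pi fun i => ?_
  fin_cases i <;> exact (h _ _).sub (h _ _)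

/-- Integrating an error term that is controlled by the kernel `|y - x|⁻²`. -/
theorem ofReal_abs_integral_dot3_le {Ω : Set E3} (hΩ : MeasurableSet Ω) {u E : E3 → E3} {x : E3}
    {C : ℝ} (hC : 0 ≤ C) (hE : ∀ y ∈ Ω, y ≠ x → ‖E y‖ ≤ C * (‖y - x‖ ^ 2)⁻¹) :
    ENNReal.ofReal |∫ y in Ω, dot3 (u y) (E y)| ≤ ENNReal.ofReal (3 * C) *
      ∫⁻ y in Ω, ENNReal.ofReal (‖y - x‖ ^ (-2 : ℝ)) * ENNReal.ofReal ‖u y‖ := by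
  rw [← Real.norm_eq_abs, ofReal_norm, ← lintegral_const_mul' _ _ ENNReal.ofReal_ne_top]
  refine (enorm_integral_le_lintegral_enorm _).trans (lintegral_mono_ae ?_)
  have hne : ∀ᵐ y ∂(volume : Measure E3), y ≠ x := by
    simp [ae_iff]
  filter_upwards [ae_restrict_mem hΩ, ae_restrict_of_ae hne] with y hy hyx
  have hpos : 0 < ‖y - x‖ := norm_pos_iff.2 (sub_ne_zero.2 hyx)
  rw [← ENNReal.ofReal_mul (by positivity), ← ENNReal.ofReal_mul (by positivity), ← ofReal_norm,
    Real.norm_eq_abs]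
  refine ENNReal.ofReal_le_ofReal ((abs_dot3_le _ _).trans ?_)
  have h1 := hE y hy hyx
  have h2 : ‖y - x‖ ^ (-2 : ℝ) = (‖y - x‖ ^ 2)⁻¹ := by
    rw [Real.rpow_neg hpos.le]; norm_cast
  rw [h2]
  calc 3 * (‖u y‖ * ‖E y‖) ≤ 3 * (‖u y‖ * (C * (‖y - x‖ ^ 2)⁻¹)) := by gcongr
    _ = _ := by ring

/-- Pointwise representation bound on a chart. -/
theorem IsChart.exists_pointwise_bound {Ω : Set E3} {f : E3 → ℝ} {p : E3} {R M L : ℝ} {n : E3}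
    (h : IsChart Ω f p R M L n) (hs : 20 * L * ‖n‖ * R ≤ 1) (hΩ : IsOpen Ω)
    (hbd : Bornology.IsBounded Ω) {ν : E3 → E3} (hν : IsOutwardNormal Ω ν) {θ : ℝ} (hθ : 0 < θ)
    (hθ1 : θ < 1) :
    ∃ K, 0 < K ∧ ∀ (u : E3 → E3) (B0 B1 : ℝ) (lam : Option (Fin 3) → ℕ → ℝ)
      (a : Option (Fin 3) → ℕ → E3 → ℝ) (c : Option (Fin 3) → ℕ → E3)
      (r : Option (Fin 3) → ℕ → ℝ), IsRegularField Ω u B0 B1 →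
      (∀ o, IsBallDecomp Ω θ (divCurl u o) (lam o) (a o) (c o) (r o)) →
      ((∀ y ∈ frontier Ω, dot3 (ν y) (u y) = 0) ∨ (∀ y ∈ frontier Ω, cross3 (ν y) (u y) = 0)) →
      ∀ x ∈ Metric.ball p R ∩ Ω, ENNReal.ofReal ‖u x‖ ≤ ENNReal.ofReal K *
        (∑' j : Option (Fin 3) × ℕ, ENNReal.ofReal |lam j.1 j.2| *
          ENNReal.ofReal (atomProfile θ (r j.1 j.2) ‖x - c j.1 j.2‖) +
        ∫⁻ y in Ω, ENNReal.ofReal (‖y - x‖ ^ (-2 : ℝ)) * ENNReal.ofReal ‖u y‖) := by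
  have hR := h.pos
  let bump : ContDiffBump p := ⟨R, 2 * R, hR, by linarith⟩
  have hχ : ContDiff ℝ 1 bump := bump.contDiff
  have hχs : ∀ y ∉ Metric.closedBall p (2 * R), bump y = 0 := fun y hy =>
    bump.zero_of_le_dist (not_le.1 hy).le
  obtain ⟨Cχ, hCχ, hχb⟩ := exists_forall_norm_le_of_contDiff hχ bump.hasCompactSupport
  obtain ⟨C, hC, hCb⟩ := h.exists_potential_estimates hs hχ hχs hCχ hχb
  obtain ⟨K, hK, hKb⟩ := ofReal_abs_integral_pairing_le hΩ.measurableSet hbd hθ hθ1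
  have hc0 := integral_rho_one_pos
  set c0 := ∫ w, rho 1 w
  refine ⟨(C * K + 3 * C + 1) / c0, by positivity, ?_⟩
  intro u B0 B1 lam a c r hu hdec hbc x hx
  obtain ⟨s, hs1, hbc'⟩ : ∃ s : ℝ, |s| ≤ 1 ∧
      ((s = 1 ∧ ∀ y ∈ frontier Ω, dot3 (ν y) (u y) = 0) ∨
        (s = -1 ∧ ∀ y ∈ frontier Ω, cross3 (ν y) (u y) = 0)) := by
    rcases hbc with hb | hb
    · exact ⟨1, by simp, Or.inl ⟨rfl, hb⟩⟩
    · exact ⟨-1, by simp, Or.inr ⟨rfl, hb⟩⟩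
  obtain ⟨i, hi⟩ := exists_norm_apply_eq_norm (u x)
  set e : E3 := Pi.single i 1
  have he : ‖e‖ ≤ 1 := by rw [Pi.norm_single, norm_one]
  have hue : dot3 (u x) e = u x i := by rw [dot3_comm, dot3_single]
  have hx4 : x ∈ Metric.ball p (4 * R) := Metric.ball_subset_ball (by linarith) hx.1
  set S := ∑' j : Option (Fin 3) × ℕ, ENNReal.ofReal |lam j.1 j.2| *
    ENNReal.ofReal (atomProfile θ (r j.1 j.2) ‖x - c j.1 j.2‖)
  set I := ∫⁻ y in Ω, ENNReal.ofReal (‖y - x‖ ^ (-2 : ℝ)) * ENNReal.ofReal ‖u y‖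
  have hfin : ∀ δ : ℝ, 0 < δ → ENNReal.ofReal |(∫ y in Ω, dot3 (u y)
      (bump y • rho δ (srcZ f x (chartW f x) 0 y) • e)) + ∫ y in Ω, dot3 (u y)
      (bump y • rho δ (srcZ f x (chartW f x) (chartK f x) y) • (s • chartS f x e))| ≤
      ENNReal.ofReal (C * K) * S + ENNReal.ofReal (3 * C) * I := fun δ hδ => by
    have hP := contDiff_potPhi h.smooth hχ hδ x s e
    have hA := contDiff_potA h.smooth hχ hδ x s e
    have hest := hCb x hx e he δ hδ s hs1
    have hgreen := h.green hΩ hbd hu hP hA (fun y hy => by rw [potPhi, hχs y hy, zero_mul])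
      (fun y hy => by rw [potA, hχs y hy, zero_smul])
      (h.potential_boundary hΩ hν hbc' hx4 bump δ e)
    have hpair := hKb u B0 B1 lam a c r x _ _ C hu hdec hx.2 hC hP hA fun y hy hyx =>
      ⟨(hest y hy hyx).1, (hest y hy hyx).2.1, (hest y hy hyx).2.2.1, (hest y hy hyx).2.2.2.1⟩
    rw [← hgreen] at hpair
    have hρ : ∀ k : E3, Continuous fun y => rho δ (srcZ f x (chartW f x) k y) := fun k =>
      (continuous_rho hδ).comp (contDiff_srcZ h.smooth x _ _).continuous
    have hi1 := hu.integrableOn_dot3 hbd (g := fun y =>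
      bump y • rho δ (srcZ f x (chartW f x) 0 y) • e)
      (hχ.continuous.smul ((hρ 0).smul continuous_const))
    have hi2 := hu.integrableOn_dot3 hbd (g := fun y =>
      bump y • rho δ (srcZ f x (chartW f x) (chartK f x) y) • (s • chartS f x e))
      (hχ.continuous.smul ((hρ _).smul continuous_const))
    have hi3 := hu.integrableOn_dot3 hbd (g := fun y => curl3 (potA bump δ f x s e) y -
      grad3 (potPhi bump δ f x s e) y) ((continuous_curl3 hA).sub (continuous_grad3 hP))
    have herr := ofReal_abs_integral_dot3_le hΩ.measurableSet (u := u) hC fun y hy hyx =>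
      (hest y hy hyx).2.2.2.2
    have hsplit : (∫ y in Ω, dot3 (u y) (bump y • rho δ (srcZ f x (chartW f x) 0 y) • e)) +
        ∫ y in Ω, dot3 (u y)
          (bump y • rho δ (srcZ f x (chartW f x) (chartK f x) y) • (s • chartS f x e)) =
        (∫ y in Ω, dot3 (u y) (curl3 (potA bump δ f x s e) y - grad3 (potPhi bump δ f x s e) y)) -
        ∫ y in Ω, dot3 (u y) (curl3 (potA bump δ f x s e) y - grad3 (potPhi bump δ f x s e) y -
          bump y • (rho δ (srcZ f x (chartW f x) 0 y) • e +
            rho δ (srcZ f x (chartW f x) (chartK f x) y) • (s • chartS f x e))) := by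
      simp_rw [smul_add, dot3_sub_right (u _) (curl3 _ _ - grad3 _ _), dot3_add_right]
      have h1 := integral_sub hi3 (hi1.add hi2)
      simp only [Pi.add_apply] at h1
      rw [h1, integral_add hi1 hi2]
      ring
    rw [hsplit]
    refine (ENNReal.ofReal_le_ofReal (abs_sub _ _)).trans ?_
    rw [ENNReal.ofReal_add (abs_nonneg _) (abs_nonneg _)]
    exact add_le_add hpair herr
  have hlim := (h.tendsto_integral_source hs hΩ hu hχ.continuous hχs (fun y => (hχb y).1) hx
    (bump.one_of_mem_closedBall (Metric.ball_subset_closedBall hx.1)) e).add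
    (h.tendsto_integral_image hbd hu hχs (fun y => (hχb y).1) hx (s • chartS f x e))
  have hle := le_of_tendsto (ENNReal.tendsto_ofReal hlim.abs)
    (eventually_nhdsWithin_of_forall hfin)
  rw [add_zero, hue, abs_mul, ← Real.norm_eq_abs, hi, abs_of_pos hc0] at hle
  have hu0 : ENNReal.ofReal ‖u x‖ = ENNReal.ofReal c0⁻¹ * ENNReal.ofReal (‖u x‖ * c0) := by
    rw [← ENNReal.ofReal_mul (by positivity)]
    congr 1
    field_simp
  rw [hu0, div_eq_inv_mul, ENNReal.ofReal_mul (p := c0⁻¹) (by positivity), mul_assoc]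
  gcongr
  refine hle.trans ?_
  rw [mul_add]
  gcongr <;> nlinarith [mul_nonneg hC hK]

/-- A `C²` function with nonvanishing differential at `p` describing `Ω` near `p` gives a chart. -/
theorem exists_isChart_of_eventually {Ω : Set E3} {f : E3 → ℝ} {p : E3} (hf : ContDiff ℝ 2 f)
    (hp : fderiv ℝ f p ≠ 0) (hΩf : ∀ᶠ y in nhds p, y ∈ Ω ↔ f y < 0) :
    ∃ R M L n, IsChart Ω f p R M L n ∧ 20 * L * ‖n‖ * R ≤ 1 := by
  obtain ⟨v, hv⟩ : ∃ v, fderiv ℝ f p v ≠ 0 := by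
    by_contra! hne
    exact hp (ContinuousLinearMap.ext hne)
  set n := (2 / fderiv ℝ f p v) • v
  have hn : fderiv ℝ f p n = 2 := by
    rw [map_smul, smul_eq_mul, div_mul_cancel₀ _ hv]
  have hd : ContDiff ℝ 1 (fderiv ℝ f) := hf.fderiv_right (by norm_num)
  obtain ⟨L, t, ht, hL⟩ := hd.contDiffAt.exists_lipschitzOnWith (x := p)
  have h1 : ∀ᶠ y in nhds p, 1 < fderiv ℝ f y n :=
    (hd.continuous.clm_apply continuous_const).continuousAt.eventually_const_lt
      (by simp only [hn]; norm_num)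
  have h2 : ∀ᶠ y in nhds p, ‖fderiv ℝ f y‖ < ‖fderiv ℝ f p‖ + 1 :=
    hd.continuous.norm.continuousAt.eventually_lt_const (by linarith)
  obtain ⟨ε, hε, hb⟩ := Metric.eventually_nhds_iff_ball.1 (hΩf.and (h1.and (h2.and ht)))
  have hden : 0 < 20 * (L : ℝ) * ‖n‖ + 1 := by positivity
  set R := min (ε / 4) (20 * (L : ℝ) * ‖n‖ + 1)⁻¹
  have hR : 0 < R := lt_min (by positivity) (by positivity)
  have hsub : Metric.ball p (4 * R) ⊆ Metric.ball p ε :=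
    Metric.ball_subset_ball (by linarith [min_le_left (ε / 4) (20 * (L : ℝ) * ‖n‖ + 1)⁻¹])
  refine ⟨R, ‖fderiv ℝ f p‖ + 1, L, n, ⟨hR, hf, fun y hy => (hb y (hsub hy)).1,
    fun y hy => (hb y (hsub hy)).2.2.1.le, fun y hy z hz => ?_,
    fun y hy => (hb y (hsub hy)).2.1.le⟩, ?_⟩
  · have := hL.dist_le_mul y (hb y (hsub hy)).2.2.2 z (hb z (hsub hz)).2.2.2
    rwa [dist_eq_norm, dist_eq_norm] at this
  · have h3 : R ≤ (20 * (L : ℝ) * ‖n‖ + 1)⁻¹ := min_le_right _ _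
    calc 20 * (L : ℝ) * ‖n‖ * R ≤ (20 * (L : ℝ) * ‖n‖ + 1) * (20 * (L : ℝ) * ‖n‖ + 1)⁻¹ := by
          gcongr; linarith
      _ = 1 := mul_inv_cancel₀ hden.ne'

theorem C2Boundary.exists_isChart {Ω : Set E3} (hC2 : C2Boundary Ω) (hΩ : IsOpen Ω) {p : E3}
    (hp : p ∈ closure Ω) :
    ∃ f R M L n, IsChart Ω f p R M L n ∧ 20 * L * ‖n‖ * R ≤ 1 := by
  by_cases hpΩ : p ∈ Ω
  · set f : E3 → ℝ := fun y => y 0 - (p 0 + 1)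
    have hf : ContDiff ℝ 2 f := (contDiff_apply ℝ ℝ (0 : Fin 3)).sub contDiff_const
    have hd : fderiv ℝ f p = ContinuousLinearMap.proj (R := ℝ) (φ := fun _ : Fin 3 => ℝ) 0 :=
      ((hasFDerivAt_apply (𝕜 := ℝ) (0 : Fin 3) p).sub_const _).fderiv
    refine ⟨f, exists_isChart_of_eventually hf ?_ ?_⟩
    · intro h0
      rw [hd] at h0
      simpa using congrArg (fun T : E3 →L[ℝ] ℝ => T (Pi.single 0 1)) h0
    · filter_upwards [hΩ.mem_nhds hpΩ, hf.continuous.continuousAt.eventually_lt_const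
        (show f p < 0 by simp [f])] with y h1 h2 using iff_of_true h1 h2
  · obtain ⟨U, f, hU, hpU, hf, hne, hΩU⟩ := hC2 p (by rw [hΩ.frontier_eq]; exact ⟨hp, hpΩ⟩)
    refine ⟨f, exists_isChart_of_eventually hf (hne p hpU) ?_⟩
    filter_upwards [hU.mem_nhds hpU] with y hy
    have := Set.ext_iff.1 hΩU y
    simpa [hy] using this

/-- Pointwise representation bound on all of `Ω`. -/
theorem exists_pointwise_bound {Ω : Set E3} (hΩ : IsOpen Ω) (hbd : Bornology.IsBounded Ω)
    (hC2 : C2Boundary Ω) {ν : E3 → E3} (hν : IsOutwardNormal Ω ν) {θ : ℝ} (hθ : 0 < θ)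
    (hθ1 : θ < 1) :
    ∃ K, 0 < K ∧ ∀ (u : E3 → E3) (B0 B1 : ℝ) (lam : Option (Fin 3) → ℕ → ℝ)
      (a : Option (Fin 3) → ℕ → E3 → ℝ) (c : Option (Fin 3) → ℕ → E3)
      (r : Option (Fin 3) → ℕ → ℝ), IsRegularField Ω u B0 B1 →
      (∀ o, IsBallDecomp Ω θ (divCurl u o) (lam o) (a o) (c o) (r o)) →
      ((∀ y ∈ frontier Ω, dot3 (ν y) (u y) = 0) ∨ (∀ y ∈ frontier Ω, cross3 (ν y) (u y) = 0)) →
      ∀ x ∈ Ω, ENNReal.ofReal ‖u x‖ ≤ ENNReal.ofReal K *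
        (∑' j : Option (Fin 3) × ℕ, ENNReal.ofReal |lam j.1 j.2| *
          ENNReal.ofReal (atomProfile θ (r j.1 j.2) ‖x - c j.1 j.2‖) +
        ∫⁻ y in Ω, ENNReal.ofReal (‖y - x‖ ^ (-2 : ℝ)) * ENNReal.ofReal ‖u y‖) := by
  choose! f R M L n hchart hs using fun p (hp : p ∈ closure Ω) => hC2.exists_isChart hΩ hp
  choose! K hK hKb using fun p (hp : p ∈ closure Ω) =>
    (hchart p hp).exists_pointwise_bound (hs p hp) hΩ hbd hν hθ hθ1
  obtain ⟨T, hT, hcover⟩ := hbd.isCompact_closure.elim_nhds_subcover (fun p => Metric.ball p (R p))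
    fun p hp => Metric.ball_mem_nhds p (hchart p hp).pos
  have hK0 : ∀ p ∈ T, 0 ≤ K p := fun p hp => (hK p (hT p hp)).le
  refine ⟨∑ p ∈ T, K p + 1, add_pos_of_nonneg_of_pos (Finset.sum_nonneg hK0) one_pos, ?_⟩
  intro u B0 B1 lam a c r hu hdec hbc x hx
  obtain ⟨p, hpT, hxp⟩ := mem_iUnion₂.1 (hcover (subset_closure hx))
  refine (hKb p (hT p hpT) u B0 B1 lam a c r hu hdec hbc x ⟨hxp, hx⟩).trans ?_
  gcongr
  exact (Finset.single_le_sum hK0 hpT).trans (by linarith)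

theorem MemHardy.exists_isHardyDecomp_lt {Ω : Set E3} {μ₀ : ℝ} {F : E3 → ℝ} (hF : MemHardy Ω μ₀ F)
    {ε : ℝ} (hε : 0 < ε) :
    ∃ lam a Q, IsHardyDecomp Ω μ₀ F lam a Q ∧ ∑' k, |lam k| < hardyNorm Ω μ₀ F + ε := by
  obtain ⟨lam, a, Q, h⟩ := hF
  obtain ⟨S, ⟨lam', a', Q', h', rfl⟩, hlt⟩ := Real.lt_sInf_add_pos
    (s := {S : ℝ | ∃ lam a Q, IsHardyDecomp Ω μ₀ F lam a Q ∧ S = ∑' k, |lam k|})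
    ⟨_, lam, a, Q, h, rfl⟩ hε
  exact ⟨lam', a', Q', h', hlt⟩

/-- Main theorem. If `u ∈ C^{1,α}(Ω̄)` has divergence and
curl in the atomic Hardy space `H_{μ₀}(Ω)` and either the normal or the
tangential component of `u` vanishes on `∂Ω`, then
`‖u‖_{L(3/2,1)} ≤ C(‖div u‖_{H} + ‖curl u‖_{H} + ‖u‖_{L¹})`. -/
theorem lorentz_estimate_div_curl_hardy (Ω : Set E3) (hΩ : BoundedDomain Ω)
    (hC2 : C2Boundary Ω) (ν : E3 → E3) (hν : IsOutwardNormal Ω ν)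
    (μ₀ : ℝ) (hμ₀ : 0 < μ₀) :
    ∃ C : ℝ, 0 < C ∧ ∀ (α : ℝ) (u : E3 → E3), 0 < α → HolderC1 α Ω u →
      MemHardy Ω μ₀ (div3 u) → MemHardyV Ω μ₀ (curl3 u) →
      ((∀ x ∈ frontier Ω, dot3 (ν x) (u x) = 0) ∨
        (∀ x ∈ frontier Ω, cross3 (ν x) (u x) = 0)) →
      lorentzNormV (volume.restrict Ω) u (3 / 2) 1 ≤
        ENNReal.ofReal (C * (hardyNorm Ω μ₀ (div3 u) +
          hardyNormV Ω μ₀ (curl3 u) + ∫ x in Ω, ‖u x‖)) := by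
  obtain ⟨hopen, -, hbd⟩ := hΩ
  set θ : ℝ := min (1 / 2) (3 * μ₀)
  have hθ : 0 < θ := lt_min (by norm_num) (by positivity)
  have hθ1 : θ < 1 := (min_le_left _ _).trans_lt (by norm_num)
  obtain ⟨K, hK, hKb⟩ := exists_pointwise_bound hopen hbd hC2 hν hθ hθ1
  have hvol : volume Ω ≤ ENNReal.ofReal (volume.real Ω + 1)  :=
    (ENNReal.le_ofReal_iff_toReal_le hbd.measure_lt_top.ne (by positivity)).2
      (le_add_of_nonneg_right zero_le_one)
  obtain ⟨C, hC, hCb⟩ := lorentzNormV_le_of_potential_bound hopen.measurableSet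
    (R := volume.real Ω + 1) (by positivity) hvol hθ hθ1 hK
  refine ⟨C, hC, ?_⟩
  intro α u hα hu hdiv hcurl hbc
  obtain ⟨B0, B1, hreg⟩ := hu.exists_isRegularField hopen hbd hα
  have hmem : ∀ o, MemHardy Ω μ₀ (divCurl u o) := fun o => by
    cases o with
    | none => exact hdiv
    | some i => exact hcurl i
  have hint : IntegrableOn (fun x => ‖u x‖) Ω :=
    (hreg.cont.norm.integrableOn_compact hbd.isCompact_closure).mono_set subset_closure
  have hI : ∫⁻ x in Ω, ENNReal.ofReal ‖u x‖ = ENNReal.ofReal (∫ x in Ω, ‖u x‖) :=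
    (ofReal_integral_eq_lintegral_ofReal hint
      (Filter.Eventually.of_forall fun x => norm_nonneg _)).symm
  have hsum : hardyNorm Ω μ₀ (div3 u) + hardyNormV Ω μ₀ (curl3 u) =
      ∑ o, hardyNorm Ω μ₀ (divCurl u o) := by
    rw [Fintype.sum_option]; rfl
  have hI0 : 0 ≤ ∫ x in Ω, ‖u x‖ := integral_nonneg fun x => norm_nonneg _
  have hε : ∀ ε : ℝ, 0 < ε → lorentzNormV (volume.restrict Ω) u (3 / 2) 1 ≤
      ENNReal.ofReal (C * (hardyNorm Ω μ₀ (div3 u) +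
          hardyNormV Ω μ₀ (curl3 u) + (∫ x in Ω, ‖u x‖) + 5 * ε)) := fun ε hε => by
    choose lam a Q hdec hlt using fun o => (hmem o).exists_isHardyDecomp_lt hε
    choose c r hball using fun o => (hdec o).exists_isBallDecomp hθ (min_le_right _ _)
    refine (hCb (ι := Option (Fin 3) × ℕ) (fun j => ENNReal.ofReal |lam j.1 j.2|)
      (fun j => r j.1 j.2) (fun j => c j.1 j.2) ((∫ x in Ω, ‖u x‖) + ε) u B0
      (fun j => (hball j.1).pos j.2) (by positivity) hreg.bound ?_
      (hKb u B0 B1 lam a c r hreg hball hbc)).trans ?_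
    · rw [hI]; exact ENNReal.ofReal_le_ofReal (by linarith)
    · rw [ENNReal.tsum_prod (f := fun o k => ENNReal.ofReal |lam o k|), tsum_fintype]
      have h1 : ∀ o, ∑' k, ENNReal.ofReal |lam o k| = ENNReal.ofReal (∑' k, |lam o k|) := fun o =>
        (ENNReal.ofReal_tsum_of_nonneg (fun k => abs_nonneg _) (hball o).summable).symm
      simp_rw [h1]
      rw [← ENNReal.ofReal_sum_of_nonneg fun o _ => tsum_nonneg fun k => abs_nonneg _,
        ← ENNReal.ofReal_add (Finset.sum_nonneg fun o _ => tsum_nonneg fun k => abs_nonneg _)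
          (by positivity), ← ENNReal.ofReal_mul hC.le]
      refine ENNReal.ofReal_le_ofReal (mul_le_mul_of_nonneg_left ?_ hC.le)
      have h2 : ∑ o, ∑' k, |lam o k| ≤ ∑ o, (hardyNorm Ω μ₀ (divCurl u o) + ε) :=
        Finset.sum_le_sum fun o _ => (hlt o).le
      rw [Finset.sum_add_distrib, ← hsum] at h2
      simp only [Finset.sum_const, Finset.card_univ, Fintype.card_option, Fintype.card_fin,
        nsmul_eq_mul] at h2
      push_cast at h2
      linarith
  have hlim : Filter.Tendsto (fun ε : ℝ => ENNReal.ofReal (C * (hardyNorm Ω μ₀ (div3 u) +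
      hardyNormV Ω μ₀ (curl3 u) + (∫ x in Ω, ‖u x‖) + 5 * ε))) (nhdsWithin 0 (Ioi 0))
      (nhds (ENNReal.ofReal (C * (hardyNorm Ω μ₀ (div3 u) +
        hardyNormV Ω μ₀ (curl3 u) + ∫ x in Ω, ‖u x‖)))) := by
    refine ENNReal.tendsto_ofReal (Filter.Tendsto.mono_left ?_ nhdsWithin_le_nhds)
    exact Continuous.tendsto' (by fun_prop) _ _ (by simp)
  exact ge_of_tendsto hlim (eventually_nhdsWithin_of_forall hε)
end
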